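/- arXiv:1302.2421 — 2 statements merged into one kernel-verified Lean document; each statement's English description precedes it below -/
import Mathlib

section
/- Let 0 < α₀ ≤ β₀ < 1, let 0 < d < α₀ and η > 0 satisfy d(1+ηβ₀) ≤ β₀ and d(1+ηα₀) ≤ α₀. Then there exists a monotone non-decreasing continuous function Z : ℝ → ℝ with Z(x) = 0 for x ≤ 0 and Z(x) = 1 for x ≥ 1, such that: d_Z(+∞) := dim_H {x : h_Z(x) = +∞} = 1; for every h ∈ [α₀, β₀], d_Z(h) = d(1+ηh); and d_Z(h) = −∞ for every h ∈ [0,∞) \ [α₀, β₀]. Moreover Z can be constructed so that: (i) the set {x : h_Z(x) < +∞} = {x : h_Z(x) < 1} = {x : h_Z(x) ≤ β₀} is contained in a closed nowhere dense (Cantor) set 𝒞 strictly included in [0,1]; (ii) [0,1] \ 𝒞 consists of countably many open intervals each of length less than 1/10; (iii) there exists 0 < r₀ < 1 such that for every x ∈ [0,1] and every 0 < r < r₀, Z(x+r) − Z(x−r) ≤ (2r)^{α₀}. -/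
open MeasureTheory Metric Filter Set
open scoped ENNReal Topology
open Classical

/-- `Z ∈ C^α(x₀)`: there are a polynomial `P` of degree less than `α` and a constant `C > 0`
such that `|Z x - P (x - x₀)| ≤ C |x - x₀| ^ α` in a neighborhood of `x₀`. -/
def HolderAt (Z : ℝ → ℝ) (α : ℝ) (x₀ : ℝ) : Prop :=
  ∃ (P : Polynomial ℝ) (C δ : ℝ), 0 < C ∧ 0 < δ ∧
    (P = 0 ∨ (P.natDegree : ℝ) < α) ∧
    ∀ x : ℝ, |x - x₀| < δ → |Z x - P.eval (x - x₀)| ≤ C * |x - x₀| ^ α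

/-- The pointwise Hölder exponent `h_Z(x₀) = sup {α ≥ 0 : Z ∈ C^α(x₀)}`. -/
noncomputable def holderExp (Z : ℝ → ℝ) (x₀ : ℝ) : EReal :=
  sSup {h : EReal | ∃ α : ℝ, 0 ≤ α ∧ HolderAt Z α x₀ ∧ h = (α : EReal)}

/-- Hausdorff dimension of a set, with the convention `dim ∅ = -∞`. -/
noncomputable def dimHE (s : Set ℝ) : EReal :=
  if s.Nonempty then ((dimH s : ℝ≥0∞) : EReal) else ⊥

/-- The multifractal spectrum of a function on `[0,1]`:
`d_Z(h) = dim_H {x ∈ [0,1] : h_Z(x) = h}`, with `dim ∅ = -∞`. -/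
noncomputable def specF (Z : ℝ → ℝ) (h : EReal) : EReal :=
  dimHE {x ∈ Set.Icc (0:ℝ) 1 | holderExp Z x = h}

/-- A function on `[0,1]` is homogeneously multifractal (HM) if its restriction to any
non-degenerate subinterval of `[0,1]` has the same multifractal spectrum as `Z` itself. -/
def IsHMF (Z : ℝ → ℝ) : Prop :=
  ∀ a b : ℝ, 0 ≤ a → a < b → b ≤ 1 →
    ∀ h : EReal, dimHE {x ∈ Set.Ioo a b | holderExp Z x = h} = specF Z h

/-- The class `𝓕` of admissible spectra: suprema of countably many step functions `f_n`,
each supported by a closed subinterval `Iₙ ⊆ [0,1]`, bounded away from `0` uniformly,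
constant (with value `vₙ ∈ [0,1]`) on `Iₙ`, with `fₙ(x) ≤ x` on `Iₙ`, and `f = sup_n fₙ`. -/
def MemF (f : ℝ → EReal) : Prop :=
  ∃ (I : ℕ → Set ℝ) (v : ℕ → EReal),
    (∀ n, ∃ a b : ℝ, a ≤ b ∧ I n = Set.Icc a b) ∧
    (∀ n, I n ⊆ Set.Icc (0:ℝ) 1) ∧
    (∃ c : ℝ, 0 < c ∧ ∀ n, ∀ x ∈ I n, c ≤ x) ∧
    (∀ n, 0 ≤ v n ∧ v n ≤ 1) ∧
    (∀ n, ∀ x ∈ I n, v n ≤ (x : EReal)) ∧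
    (∀ x : ℝ, f x = ⨆ n, (if x ∈ I n then v n else ⊥))

/-- The piecewise affine ramp rising from `0` to `1` on `[0,1]`. -/
noncomputable def ramp (x : ℝ) : ℝ := max 0 (min 1 x)

lemma ramp_nonneg (x : ℝ) : 0 ≤ ramp x := le_max_left _ _

lemma ramp_le_one (x : ℝ) : ramp x ≤ 1 := max_le zero_le_one (min_le_left _ _)

lemma ramp_of_nonpos {x : ℝ} (hx : x ≤ 0) : ramp x = 0 :=
  max_eq_left ((min_le_right _ _).trans hx)

lemma ramp_of_one_le {x : ℝ} (hx : 1 ≤ x) : ramp x = 1 := by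
  simp [ramp, min_eq_left hx]

lemma ramp_of_mem {x : ℝ} (hx : x ∈ Icc (0 : ℝ) 1) : ramp x = x := by
  simp [ramp, min_eq_right hx.2, max_eq_right hx.1]

lemma ramp_mono : Monotone ramp := fun _ _ h => max_le_max le_rfl (min_le_min le_rfl h)

lemma ramp_sub_le {u v : ℝ} (h : u ≤ v) : ramp v - ramp u ≤ v - u := by
  unfold ramp
  rcases max_cases 0 (min 1 v) with a | a <;> rcases max_cases 0 (min 1 u) with b | b <;>
    rcases min_cases 1 v with c | c <;> rcases min_cases 1 u with e | e <;> linarith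

lemma ramp_sub_le_rpow {u v a : ℝ} (h : u ≤ v) (ha : 0 < a) (ha1 : a ≤ 1) :
    ramp v - ramp u ≤ (v - u) ^ a := by
  rcases le_total (v - u) 1 with h' | h'
  · calc ramp v - ramp u ≤ v - u := ramp_sub_le h
      _ = (v - u) ^ (1 : ℝ) := (Real.rpow_one _).symm
      _ ≤ (v - u) ^ a :=
        Real.rpow_le_rpow_of_exponent_ge_of_imp (by linarith) h' ha1 (fun _ h0 => by linarith)
  · have := ramp_le_one v
    have := ramp_nonneg u
    have := Real.one_le_rpow h' ha.le
    linarith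

/-- A nondecreasing continuous prescribed spectrum `dim` on an interval `[lo, hi] ⊆ (0,1)` lying
below the diagonal. -/
structure SpectrumData where
  lo : ℝ
  hi : ℝ
  dim : ℝ → ℝ
  lo_pos : 0 < lo
  lo_le_hi : lo ≤ hi
  hi_lt_one : hi < 1
  dim_pos : ∀ t ∈ Icc lo hi, 0 < dim t
  dim_le : ∀ t ∈ Icc lo hi, dim t ≤ t
  dim_mono : MonotoneOn dim (Icc lo hi)
  dim_cont : ContinuousOn dim (Icc lo hi)

/-- An interval `[pos, pos + len]` of the Cantor construction, with the current approximation of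
the local exponent and the mass attached to the interval. -/
structure CantorNode where
  depth : ℕ
  expo : ℝ
  len : ℝ
  mass : ℝ
  pos : ℝ

/-- The weight that remains to be distributed by the digits of index at least `n`; only the digits
where `n + 2` is a power of two carry weight. -/
noncomputable def digitTail (n : ℕ) : ℝ := (1 / 2) ^ Nat.log 2 (n + 1)

lemma digitTail_zero : digitTail 0 = 1 := by simp [digitTail]

lemma digitTail_pos (n : ℕ) : 0 < digitTail n := by unfold digitTail; positivity

lemma log_step (n : ℕ) : Nat.log 2 (n + 1 + 1) = Nat.log 2 (n + 1) ∨
    Nat.log 2 (n + 1 + 1) = Nat.log 2 (n + 1) + 1 := by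
  have h1 : Nat.log 2 (n + 1) ≤ Nat.log 2 (n + 1 + 1) := Nat.log_mono_right (by omega)
  have h2 : Nat.log 2 (n + 1 + 1) < Nat.log 2 (n + 1) + 2 := by
    apply Nat.log_lt_of_lt_pow (by omega)
    have := Nat.lt_pow_succ_log_self (b := 2) (by norm_num) (n + 1)
    rw [pow_succ] at this ⊢
    have h3 : 1 ≤ 2 ^ Nat.log 2 (n + 1) := Nat.one_le_two_pow
    rw [pow_succ]; omega
  omega

lemma digitTail_step (n : ℕ) : digitTail (n + 1) = digitTail n ∨
    digitTail (n + 1) = digitTail n / 2 := by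
  unfold digitTail
  rcases log_step n with h | h
  · left; rw [h]
  · right; rw [h, pow_succ]; ring

lemma digitTail_succ_le (n : ℕ) : digitTail (n + 1) ≤ digitTail n := by
  rcases digitTail_step n with h | h <;> linarith [digitTail_pos n]

lemma tendsto_digitTail : Tendsto digitTail atTop (𝓝 0) := by
  refine (tendsto_pow_atTop_nhds_zero_of_lt_one (r := (1 / 2 : ℝ)) (by norm_num)
    (by norm_num)).comp ?_
  refine tendsto_atTop_atTop.2 fun b => ⟨2 ^ b, fun a ha => ?_⟩
  exact (Nat.le_log_iff_pow_le (by norm_num) (by omega)).2 (by omega)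

namespace SpectrumData

variable (S : SpectrumData)

/-- Contraction ratio of the construction where the local exponent is `t`. -/
noncomputable def ratio (t : ℝ) : ℝ := (2 : ℝ) ^ (-(1 / S.dim t))

/-- The largest contraction ratio. -/
noncomputable def maxRatio : ℝ := (2 : ℝ) ^ (-(1 / S.hi))

/-- The relative size of the smallest gap between two siblings. -/
noncomputable def gap : ℝ := 1 - 2 * S.maxRatio

lemma hi_pos : 0 < S.hi := S.lo_pos.trans_le S.lo_le_hi

lemma maxRatio_pos : 0 < S.maxRatio := Real.rpow_pos_of_pos two_pos _

lemma maxRatio_lt_half : S.maxRatio < 1 / 2 := by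
  have h : (1 : ℝ) < 1 / S.hi := by
    rw [lt_div_iff₀ S.hi_pos]; linarith [S.hi_lt_one]
  calc S.maxRatio < (2 : ℝ) ^ (-1 : ℝ) := Real.rpow_lt_rpow_of_exponent_lt (by norm_num) (by linarith)
    _ = 1 / 2 := by rw [Real.rpow_neg_one]; norm_num

lemma gap_pos : 0 < S.gap := by
  have := S.maxRatio_lt_half
  unfold gap; linarith

lemma gap_lt_one : S.gap < 1 := by
  have := S.maxRatio_pos
  unfold gap; linarith

lemma ratio_pos (t : ℝ) : 0 < S.ratio t := Real.rpow_pos_of_pos two_pos _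

lemma ratio_mono {s t : ℝ} (hs : s ∈ Icc S.lo S.hi) (ht : t ∈ Icc S.lo S.hi) (h : s ≤ t) :
    S.ratio s ≤ S.ratio t := by
  apply Real.rpow_le_rpow_of_exponent_le one_le_two
  have := one_div_le_one_div_of_le (S.dim_pos s hs) (S.dim_mono hs ht h)
  linarith

lemma ratio_le_maxRatio {t : ℝ} (ht : t ∈ Icc S.lo S.hi) : S.ratio t ≤ S.maxRatio := by
  apply Real.rpow_le_rpow_of_exponent_le one_le_two
  have := one_div_le_one_div_of_le (S.dim_pos t ht) ((S.dim_le t ht).trans ht.2)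
  linarith

lemma ratio_lt_half {t : ℝ} (ht : t ∈ Icc S.lo S.hi) : S.ratio t < 1 / 2 :=
  (S.ratio_le_maxRatio ht).trans_lt S.maxRatio_lt_half

lemma ratio_rpow_dim {t : ℝ} (ht : t ∈ Icc S.lo S.hi) : S.ratio t ^ S.dim t = 1 / 2 := by
  rw [ratio, ← Real.rpow_mul two_pos.le]
  have := (S.dim_pos t ht).ne'
  rw [show -(1 / S.dim t) * S.dim t = -1 by field_simp, Real.rpow_neg_one]
  norm_num

lemma ratio_rpow_self_le {t : ℝ} (ht : t ∈ Icc S.lo S.hi) : S.ratio t ^ t ≤ 1 / 2 := by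
  rw [← S.ratio_rpow_dim ht]
  exact Real.rpow_le_rpow_of_exponent_ge (S.ratio_pos t)
    (by linarith [S.ratio_lt_half ht]) (S.dim_le t ht)

/-- The child of an interval selected by a digit. -/
noncomputable def child (w : CantorNode) (b : Bool) : CantorNode where
  depth := w.depth + 1
  expo := w.expo + if b then (S.hi - S.lo) * (digitTail w.depth - digitTail (w.depth + 1)) else 0
  len := w.len * S.ratio w.expo
  mass := w.mass * S.ratio w.expo ^ w.expo
  pos := w.pos + if b then w.len - w.len * S.ratio w.expo else 0

/-- The unit interval, as root of the construction. -/
noncomputable def root : CantorNode := ⟨0, S.lo, 1, 1, 0⟩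

/-- The bounds satisfied by all intervals of the construction. -/
structure Valid (w : CantorNode) : Prop where
  lo_le : S.lo ≤ w.expo
  le_hi : w.expo + (S.hi - S.lo) * digitTail w.depth ≤ S.hi
  len_pos : 0 < w.len
  mass_pos : 0 < w.mass

variable {S}

lemma Valid.mem {w : CantorNode} (h : S.Valid w) : w.expo ∈ Icc S.lo S.hi :=
  ⟨h.lo_le, by
    have := mul_nonneg (sub_nonneg.2 S.lo_le_hi) (digitTail_pos w.depth).le
    linarith [h.le_hi]⟩

lemma Valid.expo_pos {w : CantorNode} (h : S.Valid w) : 0 < w.expo := S.lo_pos.trans_le h.lo_le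

lemma Valid.expo_le_child {w : CantorNode} (_ : S.Valid w) (b : Bool) :
    w.expo ≤ (S.child w b).expo := by
  have := mul_nonneg (sub_nonneg.2 S.lo_le_hi) (sub_nonneg.2 (digitTail_succ_le w.depth))
  cases b <;> simp [child, this]

lemma Valid.child {w : CantorNode} (h : S.Valid w) (b : Bool) : S.Valid (S.child w b) where
  lo_le := h.lo_le.trans (h.expo_le_child b)
  le_hi := by
    have := mul_nonneg (sub_nonneg.2 S.lo_le_hi) (sub_nonneg.2 (digitTail_succ_le w.depth))
    have := h.le_hi
    cases b <;> simp [SpectrumData.child] <;> linarith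
  len_pos := mul_pos h.len_pos (S.ratio_pos _)
  mass_pos := mul_pos h.mass_pos (Real.rpow_pos_of_pos (S.ratio_pos _) _)

lemma Valid.two_mul_child_mass_le {w : CantorNode} (h : S.Valid w) (b : Bool) :
    2 * (S.child w b).mass ≤ w.mass := by
  have := mul_le_mul_of_nonneg_left (S.ratio_rpow_self_le h.mem) h.mass_pos.le
  simp only [SpectrumData.child]; linarith

lemma Valid.child_len_le {w : CantorNode} (h : S.Valid w) (b : Bool) :
    (S.child w b).len ≤ w.len * S.maxRatio :=
  mul_le_mul_of_nonneg_left (S.ratio_le_maxRatio h.mem) h.len_pos.le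

lemma Valid.child_len_lt {w : CantorNode} (h : S.Valid w) (b : Bool) :
    2 * (S.child w b).len < w.len := by
  have := mul_lt_mul_of_pos_left (S.ratio_lt_half h.mem) h.len_pos
  simp only [SpectrumData.child]; linarith

/-- Siblings are separated by a gap proportional to the length of their parent. -/
lemma Valid.gap_le {w : CantorNode} (h : S.Valid w) :
    (S.child w false).pos + (S.child w false).len + S.gap * w.len ≤ (S.child w true).pos := by
  have := mul_le_mul_of_nonneg_left (S.ratio_le_maxRatio h.mem) h.len_pos.le
  simp only [SpectrumData.child, gap]
  simp
  linarith

lemma Valid.pos_le_child_pos {w : CantorNode} (h : S.Valid w) (b : Bool) :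
    w.pos ≤ (S.child w b).pos := by
  have := h.child_len_lt b
  have := (h.child b).len_pos
  cases b <;> simp [SpectrumData.child] at * <;> linarith

lemma Valid.child_end_le {w : CantorNode} (h : S.Valid w) (b : Bool) :
    (S.child w b).pos + (S.child w b).len ≤ w.pos + w.len := by
  have := h.child_len_lt b
  have := (h.child b).len_pos
  cases b <;> simp [SpectrumData.child] at * <;> linarith

variable (S)

lemma valid_root : S.Valid S.root where
  lo_le := le_rfl
  le_hi := by simp [root, digitTail_zero]
  len_pos := one_pos
  mass_pos := one_pos

/-- The superposition of the ramps over the `k`-th generation descendants of `w`. -/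
noncomputable def layer : ℕ → CantorNode → ℝ → ℝ
  | 0, w, x => w.mass * ramp ((x - w.pos) / w.len)
  | k + 1, w, x => layer k (S.child w false) x + layer k (S.child w true) x

variable {S}

lemma layer_mono (k : ℕ) {w : CantorNode} (h : S.Valid w) : Monotone (S.layer k w) := by
  induction k generalizing w with
  | zero =>
    intro x y hxy
    exact mul_le_mul_of_nonneg_left (ramp_mono (div_le_div_of_nonneg_right (by linarith)
      h.len_pos.le)) h.mass_pos.le
  | succ k ih => exact (ih (h.child false)).add (ih (h.child true))

lemma layer_of_le (k : ℕ) {w : CantorNode} (h : S.Valid w) {x : ℝ} (hx : x ≤ w.pos) :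
    S.layer k w x = 0 := by
  induction k generalizing w with
  | zero =>
    rw [layer, ramp_of_nonpos (div_nonpos_of_nonpos_of_nonneg (by linarith) h.len_pos.le),
      mul_zero]
  | succ k ih =>
    rw [layer, ih (h.child _) (hx.trans (h.pos_le_child_pos _)),
      ih (h.child _) (hx.trans (h.pos_le_child_pos _)), add_zero]

lemma layer_nonneg (k : ℕ) {w : CantorNode} (h : S.Valid w) (x : ℝ) : 0 ≤ S.layer k w x := by
  rw [← layer_of_le k h (min_le_right x w.pos)]
  exact layer_mono k h (min_le_left _ _)

lemma layer_of_ge (k : ℕ) {w : CantorNode} (h : S.Valid w) {x y : ℝ} (hx : w.pos + w.len ≤ x)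
    (hy : w.pos + w.len ≤ y) : S.layer k w x = S.layer k w y := by
  induction k generalizing w with
  | zero =>
    rw [layer, layer, ramp_of_one_le, ramp_of_one_le] <;> rw [le_div_iff₀ h.len_pos] <;> linarith
  | succ k ih =>
    rw [layer, layer]
    congr 1 <;> exact ih (h.child _) ((h.child_end_le _).trans hx) ((h.child_end_le _).trans hy)

lemma layer_le_mass (k : ℕ) {w : CantorNode} (h : S.Valid w) (x : ℝ) :
    S.layer k w x ≤ w.mass := by
  induction k generalizing w with
  | zero => exact mul_le_of_le_one_right h.mass_pos.le (ramp_le_one _)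
  | succ k ih =>
    have := ih (h.child false)
    have := ih (h.child true)
    have := h.two_mul_child_mass_le false
    have := h.two_mul_child_mass_le true
    rw [layer]; linarith

lemma layer_sub_le_mass (k : ℕ) {w : CantorNode} (h : S.Valid w) (u v : ℝ) :
    S.layer k w v - S.layer k w u ≤ w.mass := by
  linarith [layer_le_mass k h v, layer_nonneg k h u]

lemma layer_zero_sub_le {w : CantorNode} (h : S.Valid w) {a u v : ℝ} (ha : 0 < a) (ha1 : a ≤ 1)
    (huv : u ≤ v) :
    S.layer 0 w v - S.layer 0 w u ≤ w.mass * ((v - u) / w.len) ^ a := by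
  rw [layer, layer, ← mul_sub]
  refine mul_le_mul_of_nonneg_left ?_ h.mass_pos.le
  have := ramp_sub_le_rpow (u := (u - w.pos) / w.len) (v := (v - w.pos) / w.len)
    (div_le_div_of_nonneg_right (by linarith) h.len_pos.le) ha ha1
  rwa [← sub_div, sub_sub_sub_cancel_right] at this

lemma mass_le_of_gap_le {w : CantorNode} (h : S.Valid w) {a u v : ℝ} (ha : 0 < a) (ha1 : a ≤ 1)
    (huv : S.gap * w.len ≤ v - u) : w.mass ≤ S.gap⁻¹ * w.mass * ((v - u) / w.len) ^ a := by
  have h1 : S.gap ≤ (v - u) / w.len := by rwa [le_div_iff₀ h.len_pos]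
  have h2 : S.gap ≤ ((v - u) / w.len) ^ a :=
    calc S.gap = S.gap ^ (1 : ℝ) := (Real.rpow_one _).symm
      _ ≤ S.gap ^ a := Real.rpow_le_rpow_of_exponent_ge S.gap_pos S.gap_lt_one.le ha1
      _ ≤ _ := Real.rpow_le_rpow S.gap_pos.le h1 ha.le
  have h3 := S.gap_pos
  calc w.mass = S.gap⁻¹ * w.mass * S.gap := by field_simp
    _ ≤ _ := mul_le_mul_of_nonneg_left h2 (mul_nonneg (inv_nonneg.2 h3.le) h.mass_pos.le)

lemma child_mass_mul_le {w : CantorNode} (h : S.Valid w) (b : Bool) {a r : ℝ}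
    (ha1 : a ≤ w.expo) (hr : 0 ≤ r) :
    (S.child w b).mass * (r / (S.child w b).len) ^ a ≤ w.mass * (r / w.len) ^ a := by
  simp only [SpectrumData.child]
  have hp := S.ratio_pos w.expo
  have hl := h.len_pos
  rw [← div_div, Real.div_rpow (div_nonneg hr hl.le) hp.le]
  have h1 : S.ratio w.expo ^ w.expo ≤ S.ratio w.expo ^ a :=
    Real.rpow_le_rpow_of_exponent_ge hp (by linarith [S.ratio_lt_half h.mem]) ha1
  have h2 : 0 < S.ratio w.expo ^ a := Real.rpow_pos_of_pos hp _
  have h3 : 0 ≤ (r / w.len) ^ a := Real.rpow_nonneg (div_nonneg hr hl.le) _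
  rw [mul_assoc]
  refine mul_le_mul_of_nonneg_left ?_ h.mass_pos.le
  rw [mul_div_assoc', div_le_iff₀ h2, mul_comm]
  exact mul_le_mul_of_nonneg_left h1 h3

/-- Every layer below `w` is Hölder continuous with the exponent carried by `w`, uniformly in the
generation. -/
lemma layer_sub_le (k : ℕ) {w : CantorNode} (h : S.Valid w) {a u v : ℝ} (ha : 0 < a)
    (ha1 : a ≤ w.expo) (huv : u ≤ v) :
    S.layer k w v - S.layer k w u ≤ S.gap⁻¹ * w.mass * ((v - u) / w.len) ^ a := by
  have hg : 1 ≤ S.gap⁻¹ := (one_le_inv₀ S.gap_pos).2 S.gap_lt_one.le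
  have ha' : a ≤ 1 := ha1.trans (h.mem.2.trans S.hi_lt_one.le)
  induction k generalizing w with
  | zero =>
    refine (layer_zero_sub_le h ha ha' huv).trans ?_
    have := mul_nonneg h.mass_pos.le (Real.rpow_nonneg (div_nonneg (sub_nonneg.2 huv)
      h.len_pos.le) a)
    rw [mul_assoc]
    exact le_mul_of_one_le_left this hg
  | succ k ih =>
    have key : ∀ b, S.layer k (S.child w b) v - S.layer k (S.child w b) u ≤
        S.gap⁻¹ * w.mass * ((v - u) / w.len) ^ a := fun b => by
      refine (ih (h.child b) (ha1.trans (h.expo_le_child b))).trans ?_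
      rw [mul_assoc, mul_assoc]
      exact mul_le_mul_of_nonneg_left (child_mass_mul_le h b ha1 (sub_nonneg.2 huv))
        (by linarith)
    by_cases h1 : v ≤ (S.child w true).pos
    · have := key false
      rw [layer, layer, layer_of_le k (h.child true) h1,
        layer_of_le k (h.child true) (huv.trans h1)]
      linarith
    by_cases h2 : (S.child w false).pos + (S.child w false).len ≤ u
    · have := key true
      rw [layer, layer, layer_of_ge k (h.child false) h2 (h2.trans huv)]
      linarith
    refine (layer_sub_le_mass _ h u v).trans (mass_le_of_gap_le h ha ha' ?_)
    linarith [h.gap_le]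

end SpectrumData

namespace SpectrumData

variable (S : SpectrumData)

/-- The decreasing sequence of intervals selected by a digit sequence. -/
noncomputable def path (y : ℕ → Bool) : ℕ → CantorNode
  | 0 => S.root
  | n + 1 => S.child (path y n) (y n)

/-- The point with a given digit sequence. -/
noncomputable def point (y : ℕ → Bool) : ℝ := ⨆ n, (S.path y n).pos

/-- The local exponent prescribed at the point with a given digit sequence. -/
noncomputable def limExpo (y : ℕ → Bool) : ℝ := ⨆ n, (S.path y n).expo

/-- The Cantor set supporting all the singularities. -/
def cantorSupport : Set ℝ := range S.point

lemma valid_path (y : ℕ → Bool) (n : ℕ) : S.Valid (S.path y n) := by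
  induction n with
  | zero => exact S.valid_root
  | succ n ih => exact ih.child _

lemma path_congr {y z : ℕ → Bool} {n : ℕ} (h : ∀ i < n, y i = z i) :
    S.path y n = S.path z n := by
  induction n with
  | zero => rfl
  | succ n ih => rw [path, path, ih fun i hi => h i (hi.trans n.lt_succ_self), h n n.lt_succ_self]

lemma depth_path (y : ℕ → Bool) (n : ℕ) : (S.path y n).depth = n := by
  induction n with
  | zero => rfl
  | succ n ih => simp [path, child, ih]

lemma expo_mono (y : ℕ → Bool) : Monotone fun n => (S.path y n).expo :=
  monotone_nat_of_le_succ fun n => (S.valid_path y n).expo_le_child _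

lemma expo_bddAbove (y : ℕ → Bool) : BddAbove (range fun n => (S.path y n).expo) :=
  ⟨S.hi, by rintro _ ⟨n, rfl⟩; exact (S.valid_path y n).mem.2⟩

lemma expo_le_limExpo (y : ℕ → Bool) (n : ℕ) : (S.path y n).expo ≤ S.limExpo y :=
  le_ciSup (S.expo_bddAbove y) n

lemma limExpo_mem (y : ℕ → Bool) : S.limExpo y ∈ Icc S.lo S.hi :=
  ⟨S.expo_le_limExpo y 0, ciSup_le fun n => (S.valid_path y n).mem.2⟩

lemma len_path_le_pow (y : ℕ → Bool) (n : ℕ) : (S.path y n).len ≤ S.maxRatio ^ n := by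
  induction n with
  | zero => simp [path, root]
  | succ n ih =>
    rw [pow_succ]
    exact ((S.valid_path y n).child_len_le _).trans
      (mul_le_mul_of_nonneg_right ih S.maxRatio_pos.le)

lemma len_antitone (y : ℕ → Bool) : Antitone fun n => (S.path y n).len :=
  antitone_nat_of_succ_le fun n => by
    have := (S.valid_path y n).child_len_lt (y n)
    have := ((S.valid_path y n).child (y n)).len_pos
    rw [path]; linarith

lemma point_mem (y : ℕ → Bool) (n : ℕ) :
    S.point y ∈ Icc (S.path y n).pos ((S.path y n).pos + (S.path y n).len) := by
  refine mem_iInter.1 (ciSup_mem_iInter_Icc_of_antitone_Icc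
    (f := fun n => (S.path y n).pos) (g := fun n => (S.path y n).pos + (S.path y n).len)
    (antitone_nat_of_succ_le fun n => ?_) fun n => ?_) n
  · exact Icc_subset_Icc ((S.valid_path y n).pos_le_child_pos _)
      ((S.valid_path y n).child_end_le _)
  · linarith [(S.valid_path y n).len_pos]

lemma point_mem_unit (y : ℕ → Bool) : S.point y ∈ Icc (0 : ℝ) 1 := by
  simpa [path, root] using S.point_mem y 0

lemma abs_point_sub_le {y z : ℕ → Bool} {n : ℕ} (h : ∀ i < n, y i = z i) :
    |S.point y - S.point z| ≤ (S.path y n).len := by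
  have h1 := S.point_mem y n
  have h2 := S.point_mem z n
  rw [← S.path_congr h] at h2
  rw [abs_le]
  constructor <;> linarith [h1.1, h1.2, h2.1, h2.2]

lemma gap_mul_len_le {y z : ℕ → Bool} {n : ℕ} (h : ∀ i < n, y i = z i) (hn : y n ≠ z n) :
    S.gap * (S.path y n).len ≤ |S.point y - S.point z| := by
  have h1 := S.point_mem y (n + 1)
  have h2 := S.point_mem z (n + 1)
  rw [path] at h1 h2
  rw [← S.path_congr h] at h2
  have hg := (S.valid_path y n).gap_le
  cases hy : y n <;> cases hz : z n <;> rw [hy] at h1 hn <;> rw [hz] at h2 hn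
  · exact absurd rfl hn
  · rw [abs_sub_comm]; exact le_trans (by linarith [h1.2, h2.1]) (le_abs_self _)
  · exact le_trans (by linarith [h1.1, h2.2]) (le_abs_self _)
  · exact absurd rfl hn

lemma exists_first_ne {y z : ℕ → Bool} {n : ℕ} (h : ¬ ∀ i < n, y i = z i) :
    ∃ j < n, (∀ i < j, y i = z i) ∧ y j ≠ z j := by
  push Not at h
  obtain ⟨i, hi, hne⟩ := h
  have hex : ∃ i, y i ≠ z i := ⟨i, hne⟩
  refine ⟨Nat.find hex, (Nat.find_min' hex hne).trans_lt hi, fun k hk => ?_, Nat.find_spec hex⟩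
  by_contra hk'
  exact Nat.find_min hex hk hk'

lemma continuous_point : Continuous S.point := by
  rw [continuous_iff_continuousAt]
  intro y
  rw [ContinuousAt, Metric.tendsto_nhds]
  intro e he
  obtain ⟨n, hn⟩ := exists_pow_lt_of_lt_one he (S.maxRatio_lt_half.trans (by norm_num))
  have hU : Set.pi (Finset.range n : Set ℕ) (fun i => ({y i} : Set Bool)) ∈ 𝓝 y :=
    set_pi_mem_nhds (Finset.finite_toSet _) fun i _ => by simp
  filter_upwards [hU] with z hz
  rw [dist_comm, Real.dist_eq]
  refine ((S.abs_point_sub_le (n := n) fun i hi => ?_).trans (S.len_path_le_pow y n)).trans_lt hn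
  exact (by simpa using hz i (by simpa using hi) : z i = y i).symm

lemma isClosed_cantorSupport : IsClosed S.cantorSupport :=
  (isCompact_range S.continuous_point).isClosed

/-- Both end points of an interval of the construction are points of the Cantor set. -/
lemma endpoints_mem (y : ℕ → Bool) (n : ℕ) :
    (S.path y n).pos ∈ S.cantorSupport ∧
      (S.path y n).pos + (S.path y n).len ∈ S.cantorSupport := by
  have agree : ∀ b, ∀ i < n, y i = if i < n then y i else b := fun b i hi => by simp [hi]
  have tail : ∀ b k, (if n + k < n then y (n + k) else b) = b := fun b k => by simp
  have hlim : ∀ z : ℕ → Bool, Tendsto (fun k => (S.path z (n + k)).len) atTop (𝓝 0) := fun z => by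
    refine squeeze_zero (fun k => (S.valid_path z _).len_pos.le)
      (fun k => S.len_path_le_pow z (n + k)) ?_
    have := tendsto_pow_atTop_nhds_zero_of_lt_one S.maxRatio_pos.le
      (S.maxRatio_lt_half.trans (by norm_num))
    simpa [add_comm] using (tendsto_add_atTop_iff_nat n).2 this
  constructor
  · refine ⟨fun i => if i < n then y i else false, ?_⟩
    set z : ℕ → Bool := fun i => if i < n then y i else false with hz
    have hp : ∀ k, (S.path z (n + k)).pos = (S.path y n).pos := fun k => by
      induction k with
      | zero => rw [S.path_congr (agree false)]; rfl
      | succ k ih =>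
        rw [← add_assoc, path, show z (n + k) = false from tail false k]
        simpa [child] using ih
    have := fun k => S.point_mem z (n + k)
    simp only [hp] at this
    refine le_antisymm ?_ (this 0).1
    refine ge_of_tendsto' (x := atTop) (f := fun k => (S.path y n).pos + (S.path z (n + k)).len) ?_
      fun k => (this k).2
    simpa using (hlim z).const_add (S.path y n).pos
  · refine ⟨fun i => if i < n then y i else true, ?_⟩
    set z : ℕ → Bool := fun i => if i < n then y i else true with hz
    have hp : ∀ k, (S.path z (n + k)).pos + (S.path z (n + k)).len =
        (S.path y n).pos + (S.path y n).len := fun k => by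
      induction k with
      | zero => rw [S.path_congr (agree true)]; rfl
      | succ k ih =>
        rw [← add_assoc, path, show z (n + k) = true from tail true k, ← ih]
        simp only [child, if_true]
        ring
    have := fun k => S.point_mem z (n + k)
    refine le_antisymm (hp 0 ▸ (this 0).2) ?_
    refine le_of_tendsto' (x := atTop) (f := fun k => (S.path y n).pos + (S.path y n).len -
      (S.path z (n + k)).len) ?_ fun k => ?_
    · simpa using (hlim z).const_sub ((S.path y n).pos + (S.path y n).len)
    · linarith [(this k).1, hp k]

lemma len_rpow_limExpo_le_mass (y : ℕ → Bool) (n : ℕ) :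
    (S.path y n).len ^ S.limExpo y ≤ (S.path y n).mass := by
  induction n with
  | zero => simp [path, root]
  | succ n ih =>
    have hv := S.valid_path y n
    rw [path]
    simp only [child]
    rw [Real.mul_rpow hv.len_pos.le (S.ratio_pos _).le]
    refine mul_le_mul ih ?_ (Real.rpow_nonneg (S.ratio_pos _).le _) hv.mass_pos.le
    exact Real.rpow_le_rpow_of_exponent_ge (S.ratio_pos _)
      (by linarith [S.ratio_lt_half hv.mem]) (S.expo_le_limExpo y n)

lemma layer_path_sub_le (y : ℕ → Bool) (n k : ℕ) {u v : ℝ} (huv : u ≤ v) :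
    S.layer k (S.path y n) v - S.layer k (S.path y n) u ≤
      S.layer (n + k) S.root v - S.layer (n + k) S.root u := by
  induction n generalizing k with
  | zero => rw [zero_add]; rfl
  | succ n ih =>
    have := ih (k + 1)
    rw [show n + 1 + k = n + (k + 1) by ring]
    refine le_trans ?_ this
    have hv := S.valid_path y n
    have h0 := layer_mono k (hv.child false) huv
    have h1 := layer_mono k (hv.child true) huv
    rw [layer, layer, path]
    cases y n <;> linarith

lemma layer_succ_path_sub_le (y : ℕ → Bool) (n k : ℕ) {a u v : ℝ} (ha : 0 < a) (ha1 : a ≤ 1)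
    (hu : u ≤ S.point y) (hv : S.point y ≤ v) :
    S.layer (k + 1) (S.path y n) v - S.layer (k + 1) (S.path y n) u ≤
      (S.layer k (S.path y (n + 1)) v - S.layer k (S.path y (n + 1)) u) +
        S.gap⁻¹ * (S.path y n).mass * ((v - u) / (S.path y n).len) ^ a := by
  have hw := S.valid_path y n
  have hp := S.point_mem y (n + 1)
  have huv := hu.trans hv
  have hpos : 0 ≤ S.gap⁻¹ * (S.path y n).mass * ((v - u) / (S.path y n).len) ^ a :=
    mul_nonneg (mul_nonneg (inv_nonneg.2 S.gap_pos.le) hw.mass_pos.le)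
      (Real.rpow_nonneg (div_nonneg (sub_nonneg.2 huv) hw.len_pos.le) _)
  have hm : ∀ b, S.layer k (S.child (S.path y n) b) v - S.layer k (S.child (S.path y n) b) u ≤
      (S.path y n).mass := fun b => by
    have := layer_sub_le_mass k (hw.child b) u v
    have := hw.two_mul_child_mass_le b
    have := (hw.child b).mass_pos
    linarith
  have hg := hw.gap_le
  rw [path] at hp ⊢
  rw [layer, layer]
  cases hb : y n <;> rw [hb] at hp
  · by_cases h1 : v ≤ (S.child (S.path y n) true).pos
    · rw [layer_of_le k (hw.child true) h1, layer_of_le k (hw.child true) (huv.trans h1)]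
      linarith
    · have := mass_le_of_gap_le hw ha ha1 (u := u) (v := v) (by linarith [hp.2])
      linarith [hm true]
  · by_cases h1 : (S.child (S.path y n) false).pos + (S.child (S.path y n) false).len ≤ u
    · rw [layer_of_ge k (hw.child false) h1 (h1.trans huv)]
      linarith
    · have := mass_le_of_gap_le hw ha ha1 (u := u) (v := v) (by linarith [hp.1])
      linarith [hm false]

lemma exists_layer_sub_le_add (y : ℕ → Bool) (n : ℕ) {a : ℝ} (ha : 0 < a) (ha1 : a ≤ 1) :
    ∃ A : ℝ, 0 ≤ A ∧ ∀ k u v, u ≤ S.point y → S.point y ≤ v →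
      S.layer k S.root v - S.layer k S.root u ≤ A * (v - u) ^ a +
        if n ≤ k then S.layer (k - n) (S.path y n) v - S.layer (k - n) (S.path y n) u else 0 := by
  induction n with
  | zero => exact ⟨0, le_rfl, fun k u v _ _ => by simp [path]⟩
  | succ n ih =>
    obtain ⟨A, hA, h⟩ := ih
    have hw := S.valid_path y n
    have hl := hw.len_pos
    have hg : 1 ≤ S.gap⁻¹ := (one_le_inv₀ S.gap_pos).2 S.gap_lt_one.le
    set B := S.gap⁻¹ * (S.path y n).mass / (S.path y n).len ^ a with hB
    have hB0 : 0 ≤ B := by have := hw.mass_pos; positivity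
    have hBe : ∀ u v, u ≤ v → S.gap⁻¹ * (S.path y n).mass * ((v - u) / (S.path y n).len) ^ a =
        B * (v - u) ^ a := fun u v huv => by
      rw [Real.div_rpow (sub_nonneg.2 huv) hl.le, hB]; ring
    refine ⟨A + B, by positivity, fun k u v hu hv => (h k u v hu hv).trans ?_⟩
    have huv := hu.trans hv
    have hr : 0 ≤ B * (v - u) ^ a := mul_nonneg hB0 (Real.rpow_nonneg (sub_nonneg.2 huv) _)
    rw [add_mul]
    rcases lt_trichotomy k n with hk | hk | hk
    · rw [if_neg (by omega), if_neg (by omega)]; linarith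
    · subst hk
      rw [if_pos le_rfl, if_neg (by omega), Nat.sub_self, ← hBe u v huv]
      have h0 := layer_zero_sub_le hw ha ha1 huv
      have : 0 ≤ (S.path y k).mass * ((v - u) / (S.path y k).len) ^ a :=
        mul_nonneg hw.mass_pos.le (Real.rpow_nonneg (div_nonneg (sub_nonneg.2 huv) hl.le) _)
      have := le_mul_of_one_le_left this hg
      rw [← mul_assoc] at this
      linarith
    · obtain ⟨j, rfl⟩ := Nat.exists_eq_add_of_lt hk
      rw [if_pos (by omega), if_pos (by omega), show n + j + 1 - n = j + 1 by omega,
        show n + j + 1 - (n + 1) = j by omega]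
      have := S.layer_succ_path_sub_le y n j ha ha1 hu hv
      rw [hBe u v huv] at this
      linarith

/-- At a point of the Cantor set, the layers satisfy a pointwise Hölder bound which is uniform in
the generation. -/
lemma exists_layer_sub_le (y : ℕ → Bool) (n : ℕ) :
    ∃ A : ℝ, 0 ≤ A ∧ ∀ k u v, u ≤ S.point y → S.point y ≤ v →
      S.layer k S.root v - S.layer k S.root u ≤ A * (v - u) ^ (S.path y n).expo := by
  have hw := S.valid_path y n
  set a := (S.path y n).expo
  have ha : 0 < a := hw.expo_pos
  obtain ⟨A, hA, h⟩ := S.exists_layer_sub_le_add y n ha (hw.mem.2.trans S.hi_lt_one.le)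
  have hB0 : 0 ≤ S.gap⁻¹ * (S.path y n).mass / (S.path y n).len ^ a := by
    have := hw.mass_pos; have := hw.len_pos; have := S.gap_pos; positivity
  refine ⟨A + S.gap⁻¹ * (S.path y n).mass / (S.path y n).len ^ a, by positivity,
    fun k u v hu hv => (h k u v hu hv).trans ?_⟩
  have huv := hu.trans hv
  rw [add_mul]
  gcongr
  split_ifs
  · refine (layer_sub_le _ hw ha le_rfl huv).trans (le_of_eq ?_)
    rw [Real.div_rpow (sub_nonneg.2 huv) hw.len_pos.le]; ring
  · exact mul_nonneg hB0 (Real.rpow_nonneg (sub_nonneg.2 huv) _)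

end SpectrumData

lemma holderExp_eq_top_of_affine {Z : ℝ → ℝ} {x c δ : ℝ} (hδ : 0 < δ)
    (h : ∀ y, |y - x| < δ → Z y = Z x + c * (y - x)) : holderExp Z x = ⊤ := by
  rw [EReal.eq_top_iff_forall_lt]
  intro r
  have hlt : ((r : ℝ) : EReal) < ((max r 1 + 1 : ℝ) : EReal) :=
    EReal.coe_lt_coe_iff.2 (by linarith [le_max_left r 1])
  refine hlt.trans_le (le_sSup ⟨max r 1 + 1, by linarith [le_max_right r 1], ?_, rfl⟩)
  refine ⟨Polynomial.C c * Polynomial.X + Polynomial.C (Z x), 1, δ, one_pos, hδ, Or.inr ?_,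
    fun y hy => ?_⟩
  · have : ((Polynomial.C c * Polynomial.X + Polynomial.C (Z x)).natDegree : ℝ) ≤ 1 := by
      exact_mod_cast Polynomial.natDegree_linear_le
    linarith [le_max_right r 1]
  · rw [h y hy]
    simp only [Polynomial.eval_add, Polynomial.eval_mul, Polynomial.eval_C, Polynomial.eval_X]
    rw [show Z x + c * (y - x) - (c * (y - x) + Z x) = 0 by ring, abs_zero, one_mul]
    exact Real.rpow_nonneg (abs_nonneg _) _

/-- A two-sided increment bound of order `a` gives a lower bound for the pointwise exponent. -/
lemma le_holderExp_of_monotone {Z : ℝ → ℝ} (hZ : Monotone Z) {x a A : ℝ} (ha : 0 < a)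
    (h : ∀ u v, u ≤ x → x ≤ v → v - u ≤ 1 → Z v - Z u ≤ A * (v - u) ^ a) :
    (a : EReal) ≤ holderExp Z x := by
  refine le_sSup ⟨a, ha.le, ⟨Polynomial.C (Z x), max A 1, 1, by positivity, one_pos,
    Or.inr (by simpa using ha), fun y hy => ?_⟩, rfl⟩
  rw [Polynomial.eval_C]
  have hp : 0 ≤ |y - x| ^ a := Real.rpow_nonneg (abs_nonneg _) _
  refine le_trans ?_ (mul_le_mul_of_nonneg_right (le_max_left A 1) hp)
  rcases le_total x y with hxy | hxy
  · rw [abs_of_nonneg (sub_nonneg.2 hxy)] at hy ⊢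
    rw [abs_of_nonneg (sub_nonneg.2 (hZ hxy))]
    exact h x y le_rfl hxy hy.le
  · rw [abs_sub_comm y x, abs_of_nonneg (sub_nonneg.2 hxy)] at hy ⊢
    rw [abs_sub_comm, abs_of_nonneg (sub_nonneg.2 (hZ hxy))]
    exact h y x hxy le_rfl hy.le

/-- The symmetric increments at a point of Hölder regularity `α` are of order `min 1 α`. -/
lemma HolderAt.exists_symm_sub_le {Z : ℝ → ℝ} {α x : ℝ} (h : HolderAt Z α x) :
    ∃ A : ℝ, 0 ≤ A ∧ ∀ᶠ r in 𝓝[>] (0 : ℝ), Z (x + r) - Z (x - r) ≤ A * r ^ min 1 α := by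
  obtain ⟨P, C, δ, hC, hδ, -, hP⟩ := h
  obtain ⟨K, hK⟩ := (P.hasDerivAt 0).isBigO_sub.bound
  have hK' : ∀ᶠ r in 𝓝 (0 : ℝ), ‖P.eval (-r) - P.eval 0‖ ≤ K * ‖-r - 0‖ :=
    (by simpa using (continuous_neg (G := ℝ)).tendsto 0 :
      Tendsto (fun r : ℝ => -r) (𝓝 0) (𝓝 0)).eventually hK
  refine ⟨2 * C + 2 * |K|, by positivity, ?_⟩
  filter_upwards [nhdsWithin_le_nhds hK, nhdsWithin_le_nhds hK', self_mem_nhdsWithin,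
    nhdsWithin_le_nhds (Iio_mem_nhds hδ), nhdsWithin_le_nhds (Iio_mem_nhds one_pos)]
    with r h1 h2 h3 h4 h5
  have hr : 0 < r := h3
  have e1 := hP (x + r) (by simpa [abs_of_pos hr] using h4)
  have e2 := hP (x - r) (by simpa [abs_of_pos hr] using h4)
  have hr' : |x - r - x| = r := by rw [show x - r - x = -r by ring, abs_neg, abs_of_pos hr]
  rw [hr', show x - r - x = -r by ring] at e2
  rw [add_sub_cancel_left, abs_of_pos hr] at e1
  simp only [sub_zero, Real.norm_eq_abs, abs_neg, abs_of_pos hr] at h1 h2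
  have hm1 : r ^ α ≤ r ^ min 1 α := Real.rpow_le_rpow_of_exponent_ge hr h5.le (min_le_right _ _)
  have hm2 : r ≤ r ^ min 1 α := by
    conv_lhs => rw [← Real.rpow_one r]
    exact Real.rpow_le_rpow_of_exponent_ge hr h5.le (min_le_left _ _)
  have hk : K * r ≤ |K| * r ^ min 1 α :=
    mul_le_mul (le_abs_self K) hm2 hr.le (abs_nonneg K)
  have hc := mul_le_mul_of_nonneg_left hm1 hC.le
  rw [abs_le] at e1 e2 h1 h2
  linarith [e1.2, e2.1, h1.2, h2.1]

/-- The subexponential weights of the layers. -/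
noncomputable def layerWeight (k : ℕ) : ℝ := 1 / ((k : ℝ) + 1) ^ 2

lemma layerWeight_pos (k : ℕ) : 0 < layerWeight k := by unfold layerWeight; positivity

lemma summable_layerWeight : Summable layerWeight := by
  have := (summable_nat_add_iff 1).2 (Real.summable_one_div_nat_pow.2 (one_lt_two))
  exact this.congr fun k => by simp [layerWeight]

lemma tsum_layerWeight_pos : 0 < ∑' k, layerWeight k :=
  summable_layerWeight.tsum_pos (fun k => (layerWeight_pos k).le) 0 (layerWeight_pos 0)

namespace SpectrumData

variable (S : SpectrumData)

/-- The weighted sum of all the layers. -/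
noncomputable def cascade (x : ℝ) : ℝ := ∑' k, layerWeight k * S.layer k S.root x

lemma summable_cascade (x : ℝ) : Summable fun k => layerWeight k * S.layer k S.root x :=
  summable_layerWeight.of_nonneg_of_le
    (fun k => mul_nonneg (layerWeight_pos k).le (layer_nonneg k S.valid_root x))
    (fun k => mul_le_of_le_one_right (layerWeight_pos k).le (layer_le_mass k S.valid_root x))

lemma cascade_sub (u v : ℝ) : S.cascade v - S.cascade u =
    ∑' k, layerWeight k * (S.layer k S.root v - S.layer k S.root u) := by
  rw [cascade, cascade, ← (S.summable_cascade v).tsum_sub (S.summable_cascade u)]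
  simp only [mul_sub]

lemma summable_cascade_sub (u v : ℝ) :
    Summable fun k => layerWeight k * (S.layer k S.root v - S.layer k S.root u) := by
  simpa only [mul_sub] using (S.summable_cascade v).sub (S.summable_cascade u)

lemma cascade_sub_le {u v B : ℝ} (h : ∀ k, S.layer k S.root v - S.layer k S.root u ≤ B) :
    S.cascade v - S.cascade u ≤ (∑' k, layerWeight k) * B := by
  rw [cascade_sub, ← tsum_mul_right]
  exact (S.summable_cascade_sub u v).tsum_le_tsum
    (fun k => mul_le_mul_of_nonneg_left (h k) (layerWeight_pos k).le)
    (summable_layerWeight.mul_right B)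

lemma le_cascade_sub {u v : ℝ} (huv : u ≤ v) (k : ℕ) :
    layerWeight k * (S.layer k S.root v - S.layer k S.root u) ≤ S.cascade v - S.cascade u := by
  rw [cascade_sub]
  exact (S.summable_cascade_sub u v).le_tsum k fun j _ =>
    mul_nonneg (layerWeight_pos j).le (sub_nonneg.2 (layer_mono j S.valid_root huv))

lemma cascade_mono : Monotone S.cascade := fun u v huv => by
  refine sub_nonneg.1 (le_trans ?_ (S.le_cascade_sub huv 0))
  exact mul_nonneg (layerWeight_pos 0).le (sub_nonneg.2 (layer_mono 0 S.valid_root huv))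

lemma cascade_of_nonpos {x : ℝ} (hx : x ≤ 0) : S.cascade x = 0 := by
  simp [cascade, layer_of_le _ S.valid_root (x := x) hx]

lemma cascade_of_one_le {x : ℝ} (hx : 1 ≤ x) : S.cascade x = S.cascade 1 := by
  unfold cascade
  congr 1
  ext k
  rw [layer_of_ge k S.valid_root (x := x) (y := 1)] <;> simp [root, hx]

lemma cascade_nonneg (x : ℝ) : 0 ≤ S.cascade x := by
  rw [← S.cascade_of_nonpos (min_le_right x 0)]
  exact S.cascade_mono (min_le_left _ _)

lemma cascade_le (x : ℝ) : S.cascade x ≤ ∑' k, layerWeight k := by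
  have := S.cascade_sub_le (u := 0) (v := x) (B := 1)
    fun k => layer_sub_le_mass k S.valid_root 0 x
  rwa [S.cascade_of_nonpos le_rfl, sub_zero, mul_one] at this

lemma cascade_sub_le_rpow {u v : ℝ} (huv : u ≤ v) : S.cascade v - S.cascade u ≤
    (∑' k, layerWeight k) * (S.gap⁻¹ * (v - u) ^ S.lo) :=
  S.cascade_sub_le fun k => by
    simpa [root] using layer_sub_le k S.valid_root (a := S.lo) S.lo_pos le_rfl huv

/-- The size of the singular part of the function. -/
noncomputable def amp : ℝ := S.gap / (2 * ∑' k, layerWeight k)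

lemma amp_pos : 0 < S.amp := div_pos S.gap_pos (mul_pos two_pos tsum_layerWeight_pos)

lemma amp_mul_cascade_one_le : S.amp * S.cascade 1 ≤ 1 := by
  have h := tsum_layerWeight_pos
  calc S.amp * S.cascade 1 ≤ S.amp * ∑' k, layerWeight k :=
        mul_le_mul_of_nonneg_left (S.cascade_le 1) S.amp_pos.le
    _ = S.gap / 2 := by unfold amp; field_simp
    _ ≤ 1 := by linarith [S.gap_lt_one]

/-- The monotone function whose multifractal spectrum is the prescribed one. -/
noncomputable def func (x : ℝ) : ℝ :=
  (1 - S.amp * S.cascade 1) * ramp x + S.amp * S.cascade x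

lemma func_mono : Monotone S.func := fun _ _ huv =>
  add_le_add
    (mul_le_mul_of_nonneg_left (ramp_mono huv) (sub_nonneg.2 S.amp_mul_cascade_one_le))
    (mul_le_mul_of_nonneg_left (S.cascade_mono huv) S.amp_pos.le)

lemma func_of_nonpos {x : ℝ} (hx : x ≤ 0) : S.func x = 0 := by
  simp [func, ramp_of_nonpos hx, S.cascade_of_nonpos hx]

lemma func_of_one_le {x : ℝ} (hx : 1 ≤ x) : S.func x = 1 := by
  rw [func, ramp_of_one_le hx, S.cascade_of_one_le hx]; ring

lemma func_sub_le {u v : ℝ} (huv : u ≤ v) :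
    S.func v - S.func u ≤ (v - u) + S.amp * (S.cascade v - S.cascade u) := by
  have h1 := ramp_sub_le huv
  have h2 : (1 - S.amp * S.cascade 1) * (ramp v - ramp u) ≤ 1 * (v - u) :=
    mul_le_mul (by linarith [mul_nonneg S.amp_pos.le (S.cascade_nonneg 1)]) h1
      (sub_nonneg.2 (ramp_mono huv)) zero_le_one
  unfold func; linarith

lemma func_sub_le_rpow {u v : ℝ} (huv : u ≤ v) :
    S.func v - S.func u ≤ (v - u) + 1 / 2 * (v - u) ^ S.lo := by
  refine (S.func_sub_le huv).trans (add_le_add le_rfl ?_)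
  refine (mul_le_mul_of_nonneg_left (S.cascade_sub_le_rpow huv) S.amp_pos.le).trans (le_of_eq ?_)
  have h := tsum_layerWeight_pos
  have := S.gap_pos
  unfold amp; field_simp

lemma le_func_sub {u v : ℝ} (huv : u ≤ v) (k : ℕ) :
    S.amp * (layerWeight k * (S.layer k S.root v - S.layer k S.root u)) ≤
      S.func v - S.func u := by
  have h1 := mul_le_mul_of_nonneg_left (S.le_cascade_sub huv k) S.amp_pos.le
  have h2 := mul_nonneg (sub_nonneg.2 S.amp_mul_cascade_one_le) (sub_nonneg.2 (ramp_mono huv))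
  unfold func; linarith

lemma continuous_func : Continuous S.func := by
  have hb : ∀ u v, |S.func v - S.func u| ≤ |v - u| + 1 / 2 * |v - u| ^ S.lo := fun u v => by
    rcases le_total u v with h | h
    · rw [abs_of_nonneg (sub_nonneg.2 h), abs_of_nonneg (sub_nonneg.2 (S.func_mono h))]
      exact S.func_sub_le_rpow h
    · rw [abs_sub_comm, abs_sub_comm v, abs_of_nonneg (sub_nonneg.2 h),
        abs_of_nonneg (sub_nonneg.2 (S.func_mono h))]
      exact S.func_sub_le_rpow h
  rw [continuous_iff_continuousAt]
  intro x
  rw [ContinuousAt, tendsto_iff_dist_tendsto_zero]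
  refine squeeze_zero (fun _ => dist_nonneg) (fun v => hb x v) ?_
  have hc : Continuous fun v : ℝ => |v - x| + 1 / 2 * |v - x| ^ S.lo := by
    have : Continuous fun v : ℝ => |v - x| ^ S.lo :=
      (continuous_id.sub continuous_const).abs.rpow_const fun _ => Or.inr S.lo_pos.le
    fun_prop
  simpa [Real.zero_rpow S.lo_pos.ne'] using hc.tendsto x

lemma exists_layer_affine {x δ : ℝ} (hδ : 0 < δ) (h : Disjoint (ball x δ) S.cantorSupport)
    (k : ℕ) (y : ℕ → Bool) (n : ℕ) : ∃ c : ℝ, ∀ z ∈ ball x δ,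
      S.layer k (S.path y n) z = S.layer k (S.path y n) x + c * (z - x) := by
  have hx : x ∈ ball x δ := mem_ball_self hδ
  induction k generalizing y n with
  | zero =>
    have hl := (S.valid_path y n).len_pos
    have h1 : (S.path y n).pos ∉ ball x δ :=
      fun h' => disjoint_left.1 h h' (S.endpoints_mem y n).1
    have h2 : (S.path y n).pos + (S.path y n).len ∉ ball x δ :=
      fun h' => disjoint_left.1 h h' (S.endpoints_mem y n).2
    rw [Real.ball_eq_Ioo] at *
    simp only [mem_Ioo, not_and, not_lt] at h1 h2
    simp only [layer]
    by_cases ha : x ≤ (S.path y n).pos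
    · refine ⟨0, fun z hz => ?_⟩
      rw [ramp_of_nonpos, ramp_of_nonpos] <;>
        first | exact div_nonpos_of_nonpos_of_nonneg (by linarith [h1 (by linarith), hz.2]) hl.le
              | simp
    by_cases hb : (S.path y n).pos + (S.path y n).len ≤ x
    · refine ⟨0, fun z hz => ?_⟩
      have : (S.path y n).pos + (S.path y n).len ≤ x - δ := by
        by_contra! h'
        linarith [h2 h']
      rw [ramp_of_one_le, ramp_of_one_le] <;>
        first | (rw [le_div_iff₀ hl]; linarith [hz.1]) | simp
    push Not at ha hb
    have ha' : (S.path y n).pos ≤ x - δ := by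
      by_contra! h'
      linarith [h1 h']
    have hb' := h2 (by linarith)
    have hmem : ∀ z ∈ Ioo (x - δ) (x + δ),
        (z - (S.path y n).pos) / (S.path y n).len ∈ Icc (0 : ℝ) 1 := fun z hz =>
      ⟨div_nonneg (by linarith [hz.1]) hl.le, (div_le_one hl).2 (by linarith [hz.2])⟩
    refine ⟨(S.path y n).mass / (S.path y n).len, fun z hz => ?_⟩
    rw [ramp_of_mem (hmem z hz), ramp_of_mem (hmem x hx)]
    field_simp
    ring
  | succ k ih =>
    have hc : ∀ b, ∃ z : ℕ → Bool, S.child (S.path y n) b = S.path z (n + 1) := fun b => by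
      refine ⟨Function.update y n b, ?_⟩
      rw [path, Function.update_self, S.path_congr (y := y) fun i hi => ?_]
      rw [Function.update_of_ne hi.ne]
    obtain ⟨y₀, h₀⟩ := hc false
    obtain ⟨y₁, h₁⟩ := hc true
    obtain ⟨c₀, hc₀⟩ := ih y₀ (n + 1)
    obtain ⟨c₁, hc₁⟩ := ih y₁ (n + 1)
    refine ⟨c₀ + c₁, fun z hz => ?_⟩
    rw [layer, layer, h₀, h₁, hc₀ z hz, hc₁ z hz]
    ring

lemma holderExp_func_of_notMem {x : ℝ} (hx : x ∉ S.cantorSupport) :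
    holderExp S.func x = ⊤ := by
  obtain ⟨δ, hδ, hball⟩ := Metric.isOpen_iff.1 S.isClosed_cantorSupport.isOpen_compl x hx
  have hdis : Disjoint (ball x δ) S.cantorSupport := disjoint_left.2 fun z hz => hball hz
  have h := fun k => S.exists_layer_affine hδ hdis k (fun _ => false) 0
  choose c hc using h
  replace hc : ∀ k, ∀ z ∈ ball x δ, S.layer k S.root z = S.layer k S.root x + c k * (z - x) := hc
  obtain ⟨e, he⟩ : ∃ e : ℝ, ∀ z ∈ ball x δ, ramp z = ramp x + e * (z - x) := by
    refine ⟨c 0, fun z hz => ?_⟩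
    simpa [layer, root] using hc 0 z hz
  refine holderExp_eq_top_of_affine (δ := δ) (c := (1 - S.amp * S.cascade 1) * e +
    S.amp * ∑' k, layerWeight k * c k) hδ fun z hz => ?_
  have hz' : z ∈ ball x δ := by rwa [mem_ball, Real.dist_eq]
  have hs : S.cascade z - S.cascade x = (∑' k, layerWeight k * c k) * (z - x) := by
    rw [cascade_sub, ← tsum_mul_right]
    congr 1
    ext k
    rw [hc k z hz']; ring
  rw [func, func, he z hz', show S.cascade z = S.cascade x +
    (∑' k, layerWeight k * c k) * (z - x) by linarith]
  ring

lemma mass_le_layer_sub (y : ℕ → Bool) (n : ℕ) :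
    (S.path y n).mass ≤ S.layer n S.root (S.point y + (S.path y n).len) -
      S.layer n S.root (S.point y - (S.path y n).len) := by
  have hl := (S.valid_path y n).len_pos
  have hp := S.point_mem y n
  refine le_trans (le_of_eq ?_) (S.layer_path_sub_le y n 0 (by linarith))
  rw [layer, layer, ramp_of_one_le, ramp_of_nonpos]
  · ring
  · exact div_nonpos_of_nonpos_of_nonneg (by linarith [hp.2]) hl.le
  · rw [le_div_iff₀ hl]; linarith [hp.1]

lemma tendsto_len (y : ℕ → Bool) : Tendsto (fun n => (S.path y n).len) atTop (𝓝[>] 0) := by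
  refine tendsto_nhdsWithin_iff.2 ⟨?_, Eventually.of_forall fun n => (S.valid_path y n).len_pos⟩
  exact squeeze_zero (fun n => (S.valid_path y n).len_pos.le) (S.len_path_le_pow y)
    (tendsto_pow_atTop_nhds_zero_of_lt_one S.maxRatio_pos.le
      (S.maxRatio_lt_half.trans (by norm_num)))

lemma le_limExpo_of_holderAt {y : ℕ → Bool} {α : ℝ} (h : HolderAt S.func α (S.point y)) :
    α ≤ S.limExpo y := by
  by_contra! hlt
  obtain ⟨A, hA, hev⟩ := h.exists_symm_sub_le
  have hb : 0 < min 1 α - S.limExpo y :=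
    sub_pos.2 (lt_min ((S.limExpo_mem y).2.trans_lt S.hi_lt_one) hlt)
  set b := min 1 α - S.limExpo y with hbdef
  set q := S.maxRatio ^ b with hq
  have hq0 : 0 < q := Real.rpow_pos_of_pos S.maxRatio_pos _
  have hq1 : q < 1 := Real.rpow_lt_one S.maxRatio_pos.le
    (S.maxRatio_lt_half.trans (by norm_num)) hb
  have key : ∀ᶠ n in atTop, S.amp ≤ A / q * (((n + 1 : ℕ) : ℝ) ^ 2 * q ^ (n + 1)) := by
    filter_upwards [(S.tendsto_len y).eventually hev] with n hn
    have hl := (S.valid_path y n).len_pos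
    have h1 := S.le_func_sub (u := S.point y - (S.path y n).len)
      (v := S.point y + (S.path y n).len) (by linarith) n
    have h2 := (S.len_rpow_limExpo_le_mass y n).trans (S.mass_le_layer_sub y n)
    have h3 : S.amp * (layerWeight n * (S.path y n).len ^ S.limExpo y) ≤
        A * (S.path y n).len ^ min 1 α :=
      (mul_le_mul_of_nonneg_left (mul_le_mul_of_nonneg_left h2 (layerWeight_pos n).le)
        S.amp_pos.le).trans (h1.trans hn)
    have hpl : 0 < (S.path y n).len ^ S.limExpo y := Real.rpow_pos_of_pos hl _
    rw [show min 1 α = b + S.limExpo y by rw [hbdef]; ring, Real.rpow_add hl, ← mul_assoc,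
      ← mul_assoc] at h3
    have h4 : S.amp * layerWeight n ≤ A * (S.path y n).len ^ b := le_of_mul_le_mul_right h3 hpl
    have h5 : (S.path y n).len ^ b ≤ q ^ n := by
      rw [hq, ← Real.rpow_natCast, ← Real.rpow_mul S.maxRatio_pos.le, mul_comm,
        Real.rpow_mul S.maxRatio_pos.le, Real.rpow_natCast]
      exact Real.rpow_le_rpow hl.le (S.len_path_le_pow y n) hb.le
    have h6 := h4.trans (mul_le_mul_of_nonneg_left h5 hA)
    rw [layerWeight, mul_one_div, div_le_iff₀ (by positivity)] at h6
    refine h6.trans (le_of_eq ?_)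
    push_cast
    field_simp
    ring
  have hlim : Tendsto (fun n : ℕ => A / q * (((n + 1 : ℕ) : ℝ) ^ 2 * q ^ (n + 1))) atTop
      (𝓝 (A / q * 0)) :=
    ((tendsto_add_atTop_iff_nat 1).2 (tendsto_pow_const_mul_const_pow_of_abs_lt_one 2
      (by rwa [abs_of_pos hq0]))).const_mul _
  have := ge_of_tendsto hlim key
  linarith [S.amp_pos]

/-- At a point of the Cantor set, the pointwise exponent is the prescribed one. -/
lemma holderExp_func_point (y : ℕ → Bool) : holderExp S.func (S.point y) = S.limExpo y := by
  refine le_antisymm (sSup_le ?_) ?_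
  · rintro _ ⟨α, -, h, rfl⟩
    exact EReal.coe_le_coe_iff.2 (S.le_limExpo_of_holderAt h)
  · have hn : ∀ n, ((S.path y n).expo : EReal) ≤ holderExp S.func (S.point y) := fun n => by
      obtain ⟨A, hA, h⟩ := S.exists_layer_sub_le y n
      have hw := S.valid_path y n
      refine le_holderExp_of_monotone S.func_mono
        (A := 1 + S.amp * (∑' k, layerWeight k) * A) hw.expo_pos fun u v hu hv h1 => ?_
      have huv := sub_nonneg.2 (hu.trans hv)
      have e1 := S.func_sub_le (hu.trans hv)
      have e2 := mul_le_mul_of_nonneg_left (S.cascade_sub_le fun k => h k u v hu hv) S.amp_pos.le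
      have e3 : v - u ≤ (v - u) ^ (S.path y n).expo := by
        conv_lhs => rw [← Real.rpow_one (v - u)]
        exact Real.rpow_le_rpow_of_exponent_ge_of_imp huv h1
          (hw.mem.2.trans S.hi_lt_one.le) (fun _ h0 => by linarith)
      linarith
    refine le_of_tendsto' (x := atTop) (f := fun n => ((S.path y n).expo : EReal)) ?_ hn
    exact (continuous_coe_real_ereal.tendsto _).comp
      (tendsto_atTop_ciSup (S.expo_mono y) (S.expo_bddAbove y))

end SpectrumData

/-- Mass distribution principle for the image of a probability measure. -/
lemma le_dimH_of_measureReal_le {Ω : Type*} [MeasurableSpace Ω] (μ : Measure Ω)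
    [IsProbabilityMeasure μ] {f : Ω → ℝ} (hf : Measurable f) {s : Set ℝ} (hs : ∀ ω, f ω ∈ s)
    {c D e : ℝ} (hc : 0 < c) (he : 0 < e) (heD : e < D)
    (h : ∀ (n : ℕ) ω, μ.real {ω' | |f ω' - f ω| ≤ c * ((2 : ℝ) ^ (-(1 / D))) ^ n} ≤
      (n + 1) * (1 / 2) ^ n) :
    ENNReal.ofReal e ≤ dimH s := by
  have hD : 0 < D := he.trans heD
  set ρ : ℝ := (2 : ℝ) ^ (-(1 / D)) with hρ
  have hρ0 : 0 < ρ := Real.rpow_pos_of_pos two_pos _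
  have hρ1 : ρ < 1 := Real.rpow_lt_one_of_one_lt_of_neg one_lt_two (by simpa using hD)
  have hρD : ρ ^ D = 1 / 2 := by
    rw [hρ, ← Real.rpow_mul two_pos.le, show -(1 / D) * D = -1 by field_simp, Real.rpow_neg_one]
    norm_num
  set q : ℝ := ρ ^ (D - e) with hq
  have hq0 : 0 < q := Real.rpow_pos_of_pos hρ0 _
  have hq1 : q < 1 := Real.rpow_lt_one hρ0.le hρ1 (by linarith)
  have hqe : q * ρ ^ e = 1 / 2 := by rw [hq, ← Real.rpow_add hρ0, sub_add_cancel, hρD]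
  have hlim : Tendsto (fun n : ℕ => ((n : ℝ) + 1) * q ^ n) atTop (𝓝 0) := by
    have := (tendsto_self_mul_const_pow_of_lt_one hq0.le hq1).add
      (tendsto_pow_atTop_nhds_zero_of_lt_one hq0.le hq1)
    simpa [add_mul] using this
  obtain ⟨N, hN⟩ := eventually_atTop.1
    (hlim.eventually_lt_const (show 0 < (c * ρ) ^ e by positivity))
  have hpow : ∀ n, N ≤ n → ((n : ℝ) + 1) * (1 / 2) ^ n ≤ (c * ρ ^ (n + 1)) ^ e := by
    intro n hn
    have h1 : (c * ρ ^ (n + 1)) ^ e = (c * ρ) ^ e * (ρ ^ e) ^ n := by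
      rw [pow_succ', ← mul_assoc, Real.mul_rpow (by positivity) (by positivity),
        ← Real.rpow_natCast, ← Real.rpow_natCast, ← Real.rpow_mul hρ0.le, ← Real.rpow_mul hρ0.le,
        mul_comm (n : ℝ)]
    rw [h1, ← hqe, mul_pow, ← mul_assoc]
    exact mul_le_mul_of_nonneg_right (hN n hn).le (by positivity)
  have hle : μ.map f ≤ μH[e] := by
    refine Measure.le_hausdorffMeasure e _ (ENNReal.ofReal (c * ρ ^ N))
      (ENNReal.ofReal_pos.2 (by positivity)) fun U hU => ?_
    refine (measure_mono subset_closure).trans ?_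
    rw [← Metric.ediam_closure] at hU ⊢
    rw [Measure.map_apply hf isClosed_closure.measurableSet]
    generalize closure U = V at hU ⊢
    rcases (f ⁻¹' V).eq_empty_or_nonempty with h0 | ⟨ω, hω⟩
    · simp [h0]
    have hfin : Metric.ediam V ≠ ∞ := ne_top_of_le_ne_top ENNReal.ofReal_ne_top hU
    set δ := (Metric.ediam V).toReal with hδ
    have hVδ : Metric.ediam V = ENNReal.ofReal δ := (ENNReal.ofReal_toReal hfin).symm
    have hδN : δ ≤ c * ρ ^ N := ENNReal.toReal_le_of_le_ofReal (by positivity) hU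
    have hmeas : ∀ n : ℕ, δ ≤ c * ρ ^ n → μ.real (f ⁻¹' V) ≤ (n + 1) * (1 / 2) ^ n := by
      intro n hn
      refine le_trans (measureReal_mono fun ω' hω' => ?_) (h n ω)
      have := Metric.edist_le_ediam_of_mem (mem_preimage.1 hω') (mem_preimage.1 hω)
      rw [edist_dist, hVδ, ENNReal.ofReal_le_ofReal_iff ENNReal.toReal_nonneg, Real.dist_eq] at this
      exact this.trans hn
    rw [hVδ, ENNReal.ofReal_rpow_of_nonneg ENNReal.toReal_nonneg he.le,
      ← ofReal_measureReal]
    apply ENNReal.ofReal_le_ofReal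
    rcases (ENNReal.toReal_nonneg : 0 ≤ δ).eq_or_lt with h0 | h0
    · rw [← h0, Real.zero_rpow he.ne']
      have hlim' : Tendsto (fun n : ℕ => ((n : ℝ) + 1) * (1 / 2) ^ n) atTop (𝓝 0) := by
        have := (tendsto_self_mul_const_pow_of_lt_one (r := (1 / 2 : ℝ)) (by norm_num)
          (by norm_num)).add (tendsto_pow_atTop_nhds_zero_of_lt_one (r := (1 / 2 : ℝ))
          (by norm_num) (by norm_num))
        simpa [add_mul] using this
      exact ge_of_tendsto' hlim' fun n => hmeas n (h0.symm.le.trans (by positivity))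
    · have h1 : δ / c ≤ ρ ^ N := by rw [div_le_iff₀ hc]; linarith
      obtain ⟨n, hn1, hn2⟩ := exists_nat_pow_near_of_lt_one (div_pos h0 hc)
        (h1.trans (pow_le_one₀ hρ0.le hρ1.le)) hρ0 hρ1
      have hNn : N ≤ n := Nat.lt_succ_iff.1
        ((pow_lt_pow_iff_right_of_lt_one₀ hρ0 hρ1).1 (hn1.trans_le h1))
      rw [lt_div_iff₀ hc] at hn1
      rw [div_le_iff₀ hc] at hn2
      refine (hmeas n (by linarith)).trans ((hpow n hNn).trans ?_)
      exact Real.rpow_le_rpow (by positivity) (by linarith) he.le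
  have hne : μH[(e.toNNReal : ℝ)] s ≠ 0 := by
    rw [Real.coe_toNNReal e he.le]
    have h1 : (μ.map f) s = 1 := by
      have : μ (f ⁻¹' s) ≤ μ.map f s := Measure.le_map_apply hf.aemeasurable s
      rw [show f ⁻¹' s = univ from eq_univ_of_forall hs, measure_univ] at this
      have := Measure.isProbabilityMeasure_map (μ := μ) hf.aemeasurable
      exact le_antisymm prob_le_one ‹_›
    have := hle s
    rw [h1] at this
    exact (zero_lt_one.trans_le this).ne'
  exact le_dimH_of_hausdorffMeasure_ne_zero hne

namespace SpectrumData

variable (S : SpectrumData)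

lemma dimH_image_point_le {A : Set (ℕ → Bool)} {D : ℝ} (hD : 0 < D)
    (h : ∀ y ∈ A, ∀ n, (S.path y n).len ≤ ((2 : ℝ) ^ (-(1 / D))) ^ n) :
    dimH (S.point '' A) ≤ ENNReal.ofReal D := by
  set ρ : ℝ := (2 : ℝ) ^ (-(1 / D)) with hρ
  have hρ0 : 0 < ρ := Real.rpow_pos_of_pos two_pos _
  have hρ1 : ρ < 1 := Real.rpow_lt_one_of_one_lt_of_neg one_lt_two (by simpa using hD)
  have hρD : ρ ^ D = 1 / 2 := by
    rw [hρ, ← Real.rpow_mul two_pos.le, show -(1 / D) * D = -1 by field_simp, Real.rpow_neg_one]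
    norm_num
  let t : ∀ n : ℕ, (Fin n → Bool) → Set ℝ :=
    fun n w => S.point '' {y ∈ A | ∀ i : Fin n, y i = w i}
  have hdiam : ∀ n w, Metric.ediam (t n w) ≤ ENNReal.ofReal (ρ ^ n) := by
    intro n w
    refine Metric.ediam_le ?_
    rintro _ ⟨y, ⟨hy, hyw⟩, rfl⟩ _ ⟨z, ⟨-, hzw⟩, rfl⟩
    rw [edist_dist, Real.dist_eq]
    refine ENNReal.ofReal_le_ofReal ((S.abs_point_sub_le (n := n) fun i hi => ?_).trans (h y hy n))
    exact (hyw ⟨i, hi⟩).trans (hzw ⟨i, hi⟩).symm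
  have hle := Measure.hausdorffMeasure_le_liminf_sum D (S.point '' A) (l := atTop)
    (fun n => ENNReal.ofReal (ρ ^ n))
    (by simpa using ENNReal.tendsto_ofReal (tendsto_pow_atTop_nhds_zero_of_lt_one hρ0.le hρ1))
    t (.of_forall hdiam) (.of_forall fun n => by
      rintro _ ⟨y, hy, rfl⟩
      exact mem_iUnion.2 ⟨fun i => y i, y, ⟨hy, fun _ => rfl⟩, rfl⟩)
  have hsum : ∀ n, ∑ w, Metric.ediam (t n w) ^ D ≤ 1 := by
    intro n
    calc ∑ w, Metric.ediam (t n w) ^ D ≤ ∑ _w : Fin n → Bool, ENNReal.ofReal ((1 / 2) ^ n) := by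
          refine Finset.sum_le_sum fun w _ => ?_
          refine (ENNReal.rpow_le_rpow (hdiam n w) hD.le).trans_eq ?_
          rw [ENNReal.ofReal_rpow_of_nonneg (by positivity) hD.le, ← hρD, ← Real.rpow_natCast,
            ← Real.rpow_natCast, ← Real.rpow_mul hρ0.le, ← Real.rpow_mul hρ0.le, mul_comm (n : ℝ)]
      _ = 1 := by
          rw [Finset.sum_const, Finset.card_univ, Fintype.card_fun, Fintype.card_bool,
            Fintype.card_fin, nsmul_eq_mul, ← ENNReal.ofReal_natCast,
            ← ENNReal.ofReal_mul (by positivity)]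
          push_cast
          rw [← mul_pow]
          norm_num
  have hne : μH[(D.toNNReal : ℝ)] (S.point '' A) ≠ ∞ := by
    rw [Real.coe_toNNReal D hD.le]
    refine ne_top_of_le_ne_top ENNReal.one_ne_top (hle.trans ?_)
    calc _ ≤ liminf (fun _ : ℕ => (1 : ℝ≥0∞)) atTop := liminf_le_liminf (.of_forall hsum)
      _ = 1 := liminf_const _
  exact dimH_le_of_hausdorffMeasure_ne_top hne

lemma dimH_cantorSupport_le : dimH S.cantorSupport ≤ ENNReal.ofReal S.hi := by
  rw [cantorSupport, ← image_univ]
  exact S.dimH_image_point_le S.hi_pos fun y _ n => S.len_path_le_pow y n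

lemma interior_cantorSupport : interior S.cantorSupport = ∅ := by
  by_contra h
  have h1 := Real.dimH_of_nonempty_interior (nonempty_iff_ne_empty.2 h)
  have h2 := S.dimH_cantorSupport_le
  rw [h1, Module.finrank_self, Nat.cast_one, ← ENNReal.ofReal_one,
    ENNReal.ofReal_le_ofReal_iff S.hi_pos.le] at h2
  linarith [S.hi_lt_one]

lemma len_path_le_ratio_pow (y : ℕ → Bool) (n : ℕ) :
    (S.path y n).len ≤ S.ratio (S.limExpo y) ^ n := by
  induction n with
  | zero => simp [path, root]
  | succ n ih =>
    rw [pow_succ]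
    exact mul_le_mul ih (S.ratio_mono (S.valid_path y n).mem (S.limExpo_mem y)
      (S.expo_le_limExpo y n)) (S.ratio_pos _).le (pow_nonneg (S.ratio_pos _).le _)

lemma dimH_levelSet_le {h : ℝ} (hh : h ∈ Icc S.lo S.hi) :
    dimH (S.point '' {y | S.limExpo y = h}) ≤ ENNReal.ofReal (S.dim h) :=
  S.dimH_image_point_le (S.dim_pos h hh) fun y hy n => by
    have := S.len_path_le_ratio_pow y n
    rwa [hy] at this

/-- The greedy sequence of exponents that increases to `h`. -/
noncomputable def greedy (h : ℝ) : ℕ → ℝ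
  | 0 => S.lo
  | n + 1 =>
    if greedy h n + (S.hi - S.lo) * (digitTail n - digitTail (n + 1)) ≤ h then
      greedy h n + (S.hi - S.lo) * (digitTail n - digitTail (n + 1)) else greedy h n

lemma greedy_bounds {h : ℝ} (hh : h ∈ Icc S.lo S.hi) (n : ℕ) :
    S.greedy h n ≤ h ∧ h ≤ S.greedy h n + (S.hi - S.lo) * digitTail n := by
  induction n with
  | zero => exact ⟨hh.1, by rw [greedy, digitTail_zero]; linarith [hh.2]⟩
  | succ n ih =>
    rw [greedy]
    split_ifs with hc
    · exact ⟨hc, by linarith [ih.2]⟩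
    · refine ⟨ih.1, ?_⟩
      rcases digitTail_step n with hs | hs <;> rw [hs] at hc ⊢
      · exact ih.2
      · push Not at hc
        linarith

lemma lo_le_greedy (h : ℝ) (n : ℕ) : S.lo ≤ S.greedy h n := by
  induction n with
  | zero => exact le_rfl
  | succ n ih =>
    rw [greedy]
    have := mul_nonneg (sub_nonneg.2 S.lo_le_hi) (sub_nonneg.2 (digitTail_succ_le n))
    split_ifs <;> linarith

lemma greedy_mem {h : ℝ} (hh : h ∈ Icc S.lo S.hi) (n : ℕ) : S.greedy h n ∈ Icc S.lo S.hi :=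
  ⟨S.lo_le_greedy h n, (S.greedy_bounds hh n).1.trans hh.2⟩

lemma tendsto_greedy {h : ℝ} (hh : h ∈ Icc S.lo S.hi) :
    Tendsto (S.greedy h) atTop (𝓝 h) := by
  refine tendsto_of_tendsto_of_tendsto_of_le_of_le
    (g := fun n => h - (S.hi - S.lo) * digitTail n) ?_ tendsto_const_nhds
    (fun n => by linarith [(S.greedy_bounds hh n).2]) (fun n => (S.greedy_bounds hh n).1)
  simpa using tendsto_const_nhds.sub (tendsto_digitTail.const_mul (S.hi - S.lo))

/-- The digit sequence whose weighted digits follow the greedy sequence of exponents and whose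
other digits are free. -/
noncomputable def steer (h : ℝ) (z : ℕ → Bool) (n : ℕ) : Bool :=
  if digitTail (n + 1) = digitTail n then z n else
    decide (S.greedy h n + (S.hi - S.lo) * (digitTail n - digitTail (n + 1)) ≤ h)

lemma expo_path_steer (h : ℝ) (z : ℕ → Bool) (n : ℕ) :
    (S.path (S.steer h z) n).expo = S.greedy h n := by
  induction n with
  | zero => rfl
  | succ n ih =>
    simp only [path, child, greedy, ih, depth_path, steer]
    by_cases hs : digitTail (n + 1) = digitTail n
    · simp [hs]
    · split_ifs <;> simp_all

lemma limExpo_steer {h : ℝ} (hh : h ∈ Icc S.lo S.hi) (z : ℕ → Bool) :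
    S.limExpo (S.steer h z) = h := by
  refine tendsto_nhds_unique (tendsto_atTop_ciSup (S.expo_mono _) (S.expo_bddAbove _)) ?_
  simpa only [S.expo_path_steer h] using S.tendsto_greedy hh

lemma exists_le_len_path_steer {h D : ℝ} (hh : h ∈ Icc S.lo S.hi) (hD : 0 < D)
    (hDh : D < S.dim h) :
    ∃ c > 0, ∀ z n, c * ((2 : ℝ) ^ (-(1 / D))) ^ n ≤ (S.path (S.steer h z) n).len := by
  set ρ : ℝ := (2 : ℝ) ^ (-(1 / D)) with hρ
  have hρ0 : 0 < ρ := Real.rpow_pos_of_pos two_pos _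
  have hρ1 : ρ < 1 := Real.rpow_lt_one_of_one_lt_of_neg one_lt_two (by simpa using hD)
  have hlim : Tendsto (fun n => S.dim (S.greedy h n)) atTop (𝓝 (S.dim h)) :=
    (S.dim_cont h hh).tendsto.comp (tendsto_nhdsWithin_iff.2
      ⟨S.tendsto_greedy hh, .of_forall (S.greedy_mem hh)⟩)
  obtain ⟨N, hN⟩ := eventually_atTop.1 (hlim.eventually_const_lt hDh)
  have hratio : ∀ n, N ≤ n → ρ ≤ S.ratio (S.greedy h n) := fun n hn => by
    apply Real.rpow_le_rpow_of_exponent_le one_le_two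
    have := one_div_le_one_div_of_le hD (hN n hn).le
    linarith
  have hlen : ∀ z n, (S.path (S.steer h z) n).len =
      ∏ i ∈ Finset.range n, S.ratio (S.greedy h i) := by
    intro z n
    induction n with
    | zero => rfl
    | succ n ih => rw [Finset.prod_range_succ, ← ih, path, child, S.expo_path_steer h]
  have hpos : ∀ n, 0 < ∏ i ∈ Finset.range n, S.ratio (S.greedy h i) :=
    fun n => Finset.prod_pos fun i _ => S.ratio_pos _
  refine ⟨∏ i ∈ Finset.range N, S.ratio (S.greedy h i), hpos N, fun z n => ?_⟩
  rw [hlen]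
  rcases le_total N n with hn | hn
  · induction n, hn using Nat.le_induction with
    | base => exact mul_le_of_le_one_right (hpos N).le (pow_le_one₀ hρ0.le hρ1.le)
    | succ n hn ih =>
      rw [pow_succ, ← mul_assoc, Finset.prod_range_succ]
      exact mul_le_mul ih (hratio n hn) hρ0.le (hpos n).le
  · refine (mul_le_of_le_one_right (hpos N).le (pow_le_one₀ hρ0.le hρ1.le)).trans ?_
    rw [← hlen (fun _ => false), ← hlen (fun _ => false)]
    exact S.len_antitone _ hn

end SpectrumData

lemma card_filter_digitTail_add_log (n : ℕ) :
    ((Finset.range n).filter fun i => digitTail (i + 1) = digitTail i).card +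
      Nat.log 2 (n + 1) = n := by
  induction n with
  | zero => simp
  | succ n ih =>
    rw [Finset.range_add_one, Finset.filter_insert]
    have hiff : digitTail (n + 1) = digitTail n ↔ Nat.log 2 (n + 1 + 1) = Nat.log 2 (n + 1) := by
      unfold digitTail
      exact (pow_right_injective₀ (by norm_num) (by norm_num)).eq_iff
    split_ifs with hc
    · rw [Finset.card_insert_of_notMem (by simp)]
      have := hiff.1 hc
      omega
    · have := (log_step n).resolve_left (mt hiff.2 hc)
      omega

/-- The law of a fair coin. -/
noncomputable def coin : Measure Bool := (PMF.uniformOfFintype Bool).toMeasure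

instance : IsProbabilityMeasure coin := PMF.toMeasure.isProbabilityMeasure _

lemma coin_singleton (b : Bool) : coin {b} = 2⁻¹ := by
  simp [coin]

lemma infinitePi_coin_agree_le (z : ℕ → Bool) (n : ℕ) :
    (Measure.infinitePi fun _ : ℕ => coin).real
      {z' | ∀ i < n, digitTail (i + 1) = digitTail i → z' i = z i} ≤ (n + 1) * (1 / 2) ^ n := by
  set F := (Finset.range n).filter fun i => digitTail (i + 1) = digitTail i with hF
  have hset : {z' : ℕ → Bool | ∀ i < n, digitTail (i + 1) = digitTail i → z' i = z i} =
      Set.pi (F : Set ℕ) fun i => {z i} := by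
    ext z'
    simp [hF, Set.mem_pi]
  rw [hset, Measure.real, Measure.infinitePi_pi _ fun _ _ => measurableSet_singleton _]
  simp only [coin_singleton, Finset.prod_const, ENNReal.toReal_pow, ENNReal.toReal_inv,
    ENNReal.toReal_ofNat]
  have hcard := card_filter_digitTail_add_log n
  have hlog : (2 : ℝ) ^ Nat.log 2 (n + 1) ≤ n + 1 := by
    exact_mod_cast Nat.pow_log_le_self 2 (Nat.succ_ne_zero n)
  calc ((2 : ℝ)⁻¹) ^ F.card = 2 ^ Nat.log 2 (n + 1) * (1 / 2) ^ (F.card + Nat.log 2 (n + 1)) := by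
        rw [pow_add, mul_left_comm, ← mul_pow]; norm_num
    _ ≤ (n + 1) * (1 / 2) ^ n := by
        rw [hcard]
        exact mul_le_mul_of_nonneg_right hlog (by positivity)

namespace SpectrumData

variable (S : SpectrumData)

lemma measurable_steer (h : ℝ) : Measurable (S.steer h) :=
  measurable_pi_lambda _ fun n => by
    unfold steer
    split_ifs
    · exact measurable_pi_apply n
    · exact measurable_const

lemma le_dimH_levelSet {h : ℝ} (hh : h ∈ Icc S.lo S.hi) :
    ENNReal.ofReal (S.dim h) ≤ dimH (S.point '' {y | S.limExpo y = h}) := by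
  have key : ∀ e : ℝ, 0 < e → e < S.dim h →
      ENNReal.ofReal e ≤ dimH (S.point '' {y | S.limExpo y = h}) := by
    intro e he heh
    obtain ⟨D, heD, hDh⟩ := exists_between heh
    obtain ⟨c, hc, hlen⟩ := S.exists_le_len_path_steer hh (he.trans heD) hDh
    have hg := S.gap_pos
    refine le_dimH_of_measureReal_le (Measure.infinitePi fun _ : ℕ => coin)
      (f := fun z => S.point (S.steer h z))
      (S.continuous_point.measurable.comp (S.measurable_steer h))
      (s := S.point '' {y | S.limExpo y = h})
      (fun z => ⟨_, S.limExpo_steer hh z, rfl⟩) (c := S.gap * c / 2) (D := D) (by positivity)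
      he heD fun n z => ?_
    refine le_trans (measureReal_mono fun z' hz' => ?_) (infinitePi_coin_agree_le z n)
    have hagree : ∀ i < n, S.steer h z i = S.steer h z' i := by
      by_contra hne
      obtain ⟨j, hj, hlt, hjne⟩ := exists_first_ne hne
      have h1 := S.gap_mul_len_le hlt hjne
      have h2 := S.len_antitone (S.steer h z) hj.le
      have h3 := hlen z n
      have h4 : 0 < c * ((2 : ℝ) ^ (-(1 / D))) ^ n := by positivity
      have h5 := mul_le_mul_of_nonneg_left (h3.trans h2) hg.le
      have h6 : |S.point (S.steer h z') - S.point (S.steer h z)| ≤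
        S.gap * c / 2 * ((2 : ℝ) ^ (-(1 / D))) ^ n := hz'
      rw [abs_sub_comm] at h6
      nlinarith [mul_pos hg h4]
    intro i hi hfree
    have := hagree i hi
    simpa [steer, hfree] using this.symm
  refine le_of_forall_lt fun a ha => ?_
  obtain ⟨b, hab, hb⟩ := exists_between ha
  have hbt : b ≠ ∞ := ne_top_of_lt hb
  have hb0 : 0 < b.toReal := ENNReal.toReal_pos (pos_of_gt hab).ne' hbt
  have := key b.toReal hb0 ((ENNReal.lt_ofReal_iff_toReal_lt hbt).1 hb)
  rw [ENNReal.ofReal_toReal hbt] at this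
  exact hab.trans_le this

lemma dimH_levelSet {h : ℝ} (hh : h ∈ Icc S.lo S.hi) :
    dimH (S.point '' {y | S.limExpo y = h}) = ENNReal.ofReal (S.dim h) :=
  (S.dimH_levelSet_le hh).antisymm (S.le_dimH_levelSet hh)

end SpectrumData

namespace SpectrumData

variable (S : SpectrumData)

lemma cantorSupport_subset_unit : S.cantorSupport ⊆ Icc 0 1 := by
  rintro _ ⟨y, rfl⟩
  exact S.point_mem_unit y

lemma holderExp_func_lt_top_iff {x : ℝ} : holderExp S.func x < ⊤ ↔ x ∈ S.cantorSupport := by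
  constructor
  · intro h
    by_contra hx
    exact h.ne (S.holderExp_func_of_notMem hx)
  · rintro ⟨y, rfl⟩
    rw [S.holderExp_func_point]
    exact EReal.coe_lt_top _

lemma holderExp_func_le_hi {x : ℝ} (hx : holderExp S.func x < ⊤) :
    holderExp S.func x ≤ S.hi := by
  obtain ⟨y, rfl⟩ := S.holderExp_func_lt_top_iff.1 hx
  rw [S.holderExp_func_point]
  exact EReal.coe_le_coe_iff.2 (S.limExpo_mem y).2

lemma levelSet_eq (h : ℝ) :
    {x ∈ Icc (0 : ℝ) 1 | holderExp S.func x = h} = S.point '' {y | S.limExpo y = h} := by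
  ext x
  constructor
  · rintro ⟨-, hx⟩
    obtain ⟨y, rfl⟩ := S.holderExp_func_lt_top_iff.1 (hx ▸ EReal.coe_lt_top h)
    rw [S.holderExp_func_point] at hx
    exact ⟨y, EReal.coe_eq_coe_iff.1 hx, rfl⟩
  · rintro ⟨y, hy, rfl⟩
    exact ⟨S.point_mem_unit y, by rw [S.holderExp_func_point, hy]⟩

lemma specF_func_coe {h : ℝ} (hh : h ∈ Icc S.lo S.hi) : specF S.func h = (S.dim h : ℝ) := by
  have hne : (S.point '' {y | S.limExpo y = h}).Nonempty :=
    ⟨_, _, S.limExpo_steer hh fun _ => false, rfl⟩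
  rw [specF, S.levelSet_eq, dimHE, if_pos hne, S.dimH_levelSet hh, EReal.coe_ennreal_ofReal,
    max_eq_left (S.dim_pos h hh).le]

lemma specF_func_coe_of_notMem {h : ℝ} (hh : h ∉ Icc S.lo S.hi) : specF S.func h = ⊥ := by
  rw [specF, S.levelSet_eq, dimHE, if_neg]
  rintro ⟨_, y, hy, -⟩
  exact hh (hy ▸ S.limExpo_mem y)

lemma specF_func_top : specF S.func ⊤ = 1 := by
  set E := {x ∈ Icc (0 : ℝ) 1 | holderExp S.func x = ⊤}
  have hsub : Ioo (0 : ℝ) 1 \ S.cantorSupport ⊆ interior E :=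
    interior_maximal (fun x hx => ⟨Ioo_subset_Icc_self hx.1, S.holderExp_func_of_notMem hx.2⟩)
      (isOpen_Ioo.sdiff S.isClosed_cantorSupport)
  have hne : (interior E).Nonempty := by
    refine Set.Nonempty.mono hsub (sdiff_nonempty.2 fun h => ?_)
    have := interior_maximal h isOpen_Ioo
    rw [S.interior_cantorSupport] at this
    exact this (show (1 / 2 : ℝ) ∈ Ioo (0 : ℝ) 1 by norm_num)
  rw [specF, dimHE, if_pos (hne.mono interior_subset), Real.dimH_of_nonempty_interior hne]
  simp

lemma func_symm_sub_le {x ρ : ℝ} (hρ : 0 < ρ) (hρ' : ρ < 1 / 2 * (1 / 2) ^ (1 / (1 - S.lo))) :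
    S.func (x + ρ) - S.func (x - ρ) ≤ (2 * ρ) ^ S.lo := by
  have hlo : 0 < 1 - S.lo := by linarith [S.lo_le_hi, S.hi_lt_one]
  have h1 := S.func_sub_le_rpow (show x - ρ ≤ x + ρ by linarith)
  rw [show x + ρ - (x - ρ) = 2 * ρ by ring] at h1
  have h2 : 2 * ρ = (2 * ρ) ^ (1 - S.lo) * (2 * ρ) ^ S.lo := by
    rw [← Real.rpow_add (by positivity), sub_add_cancel, Real.rpow_one]
  have h3 : (2 * ρ) ^ (1 - S.lo) ≤ 1 / 2 := by
    calc (2 * ρ) ^ (1 - S.lo) ≤ ((1 / 2 : ℝ) ^ (1 / (1 - S.lo))) ^ (1 - S.lo) :=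
          Real.rpow_le_rpow (by positivity) (by linarith) hlo.le
      _ = 1 / 2 := by
          rw [← Real.rpow_mul (by norm_num), one_div_mul_cancel hlo.ne', Real.rpow_one]
  have h4 := mul_le_mul_of_nonneg_right h3 (show 0 ≤ (2 * ρ) ^ S.lo by positivity)
  linarith

end SpectrumData

/-- The points of `[0,1]` that are multiples of `1/20`. -/
def mesh : Set ℝ := range fun i : Fin 21 => (i : ℝ) / 20

lemma finite_mesh : mesh.Finite := finite_range _

lemma mesh_subset_unit : mesh ⊆ Icc 0 1 := by
  rintro _ ⟨i, rfl⟩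
  have : (i : ℝ) ≤ 20 := by exact_mod_cast Nat.lt_succ_iff.1 i.2
  exact ⟨by positivity, by dsimp only; linarith⟩

lemma sub_lt_of_Ioo_subset {a b : ℝ} (h : Ioo a b ⊆ Icc 0 1 \ mesh) : b - a < 1 / 10 := by
  by_contra! hab
  have hlt : a < b := by linarith
  have hcl := closure_mono (h.trans sdiff_subset)
  rw [closure_Ioo hlt.ne, isClosed_Icc.closure_eq] at hcl
  have ha := (hcl (left_mem_Icc.2 hlt.le)).1
  have hb := (hcl (right_mem_Icc.2 hlt.le)).2
  have h1 := Nat.floor_le (show 0 ≤ 20 * a by positivity)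
  have h2 := Nat.lt_floor_add_one (20 * a)
  have h3 : ⌊20 * a⌋₊ + 1 < 21 := by
    have : (⌊20 * a⌋₊ : ℝ) + 1 < 21 := by linarith
    exact_mod_cast this
  refine (h (a := ((⌊20 * a⌋₊ + 1 : ℕ) : ℝ) / 20) ⟨?_, ?_⟩).2 ⟨⟨_, h3⟩, rfl⟩
  · push_cast; linarith
  · push_cast; linarith

/-- Existence of a (non-HM) monotone continuous function with prescribed affine multifractal
spectrum `h ↦ d(1+ηh)` on `[α₀,β₀]`, together with the structural properties (i)-(iii):
singularities located on a Cantor set `C ⊊ [0,1]` whose complementary intervals have length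
less than `1/10`, and a uniform modulus-of-continuity bound with exponent `α₀`. -/
theorem affine_spectrum_function (α₀ β₀ d η : ℝ)
    (h1 : 0 < α₀) (h2 : α₀ ≤ β₀) (h3 : β₀ < 1)
    (h4 : 0 < d) (h5 : d < α₀) (h6 : 0 < η)
    (h7 : d * (1 + η * β₀) ≤ β₀) (h8 : d * (1 + η * α₀) ≤ α₀) :
    ∃ Z : ℝ → ℝ, Monotone Z ∧ Continuous Z ∧
      (∀ x : ℝ, x ≤ 0 → Z x = 0) ∧ (∀ x : ℝ, 1 ≤ x → Z x = 1) ∧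
      specF Z ⊤ = 1 ∧
      (∀ h : ℝ, α₀ ≤ h → h ≤ β₀ → specF Z (h : EReal) = ((d * (1 + η * h) : ℝ) : EReal)) ∧
      (∀ h : ℝ, 0 ≤ h → h ∉ Set.Icc α₀ β₀ → specF Z (h : EReal) = ⊥) ∧
      ∃ C : Set ℝ, IsClosed C ∧ C ⊆ Set.Icc 0 1 ∧ C ≠ Set.Icc 0 1 ∧ interior C = ∅ ∧
        {x ∈ Set.Icc (0:ℝ) 1 | holderExp Z x < ⊤} ⊆ C ∧
        {x ∈ Set.Icc (0:ℝ) 1 | holderExp Z x < ⊤}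
          = {x ∈ Set.Icc (0:ℝ) 1 | holderExp Z x < (1 : EReal)} ∧
        {x ∈ Set.Icc (0:ℝ) 1 | holderExp Z x < ⊤}
          = {x ∈ Set.Icc (0:ℝ) 1 | holderExp Z x ≤ (β₀ : EReal)} ∧
        (∀ a b : ℝ, Set.Ioo a b ⊆ Set.Icc 0 1 \ C → b - a < 1 / 10) ∧
        ∃ r₀ : ℝ, 0 < r₀ ∧ r₀ < 1 ∧
          ∀ x ∈ Set.Icc (0:ℝ) 1, ∀ ρ : ℝ, 0 < ρ → ρ < r₀ →
            Z (x + ρ) - Z (x - ρ) ≤ (2 * ρ) ^ α₀ := by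
  let S : SpectrumData :=
    { lo := α₀
      hi := β₀
      dim := fun t => d * (1 + η * t)
      lo_pos := h1
      lo_le_hi := h2
      hi_lt_one := h3
      dim_pos := fun t ht => by
        have : 0 < t := h1.trans_le ht.1
        positivity
      dim_le := fun t ht => by
        rcases le_total (d * η) 1 with hs | hs
        · nlinarith [mul_nonneg (sub_nonneg.2 hs) (sub_nonneg.2 ht.1)]
        · nlinarith [mul_nonneg (sub_nonneg.2 hs) (sub_nonneg.2 ht.2)]
      dim_mono := fun s _ t _ hst => by
        have := mul_le_mul_of_nonneg_left hst (mul_pos h4 h6).le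
        dsimp only
        linarith
      dim_cont := by fun_prop }
  have hempty : interior (S.cantorSupport ∪ mesh) = ∅ := by
    rw [interior_union_isClosed_of_interior_empty S.isClosed_cantorSupport
      (interior_eq_empty_iff_dense_compl.2 (finite_mesh.countable.dense_compl ℝ)), S.interior_cantorSupport]
  have hhi : (β₀ : EReal) < 1 := by exact_mod_cast h3
  refine ⟨S.func, S.func_mono, S.continuous_func, fun x => S.func_of_nonpos,
    fun x => S.func_of_one_le, S.specF_func_top, fun h ha hb => S.specF_func_coe ⟨ha, hb⟩,
    fun h _ hh => S.specF_func_coe_of_notMem hh, S.cantorSupport ∪ mesh,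
    S.isClosed_cantorSupport.union finite_mesh.isClosed,
    union_subset S.cantorSupport_subset_unit mesh_subset_unit, fun heq => ?_, hempty,
    fun x hx => Or.inl (S.holderExp_func_lt_top_iff.1 hx.2), ?_, ?_,
    fun a b hab => sub_lt_of_Ioo_subset (hab.trans (sdiff_subset_sdiff_right subset_union_right)),
    1 / 2 * (1 / 2) ^ (1 / (1 - α₀)), by positivity, ?_,
    fun x _ ρ hρ hρ' => S.func_symm_sub_le hρ hρ'⟩
  · rw [heq, interior_Icc] at hempty
    exact (nonempty_Ioo.2 one_pos).ne_empty hempty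
  · ext x
    exact and_congr_right fun _ => ⟨fun hx => (S.holderExp_func_le_hi hx).trans_lt hhi,
      fun hx => hx.trans_le le_top⟩
  · ext x
    exact and_congr_right fun _ => ⟨S.holderExp_func_le_hi,
      fun hx => hx.trans_lt (EReal.coe_lt_top _)⟩
  · have : (1 / 2 : ℝ) ^ (1 / (1 - α₀)) ≤ 1 :=
      Real.rpow_le_one (by norm_num) (by norm_num) (one_div_nonneg.2 (by linarith))
    linarith
end

section
/- For every f in the class 𝓕, there exists a Borel probability measure μ supported in [0,1] such that: (1) for all h ∈ Support(f) \ {1}, d_μ(h) = f(h); (2) d_μ(h) = −∞ for all h ∈ [0,∞) \ (Support(f) ∪ {1}); (3) the set {x ∈ [0,1] : h_μ(x) = 1} has Lebesgue measure 1. In particular, Support(d_μ) = Support(f) ∪ {1}. -/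
open MeasureTheory Metric Filter Set
open scoped ENNReal Topology
open Classical

/-- The lower local dimension (local Hölder exponent) of a measure `μ` on `ℝ` at `x`:
`liminf_{r → 0⁺} log μ(B(x,r)) / log r`, with the convention that it is `+∞`
when `x` does not belong to the support of `μ`. -/
noncomputable def locDim (μ : Measure ℝ) (x : ℝ) : EReal :=
  if ∀ r : ℝ, 0 < r → 0 < μ (ball x r) then
    Filter.liminf
      (fun r : ℝ => ((Real.log ((μ (ball x r)).toReal) / Real.log r : ℝ) : EReal))
      (nhdsWithin 0 (Set.Ioi 0))
  else ⊤

/-- The multifractal spectrum of a measure supported in `[0,1]`: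
`d_μ(h) = dim_H {x ∈ [0,1] : h_μ(x) = h}`, with `dim ∅ = -∞`. -/
noncomputable def spec (μ : Measure ℝ) (h : EReal) : EReal :=
  dimHE {x ∈ Set.Icc (0:ℝ) 1 | locDim μ x = h}

/-- A measure supported in `[0,1]` is homogeneously multifractal (HM) if its restriction to any
non-degenerate subinterval of `[0,1]` has the same multifractal spectrum as the whole measure. -/
def IsHM (μ : Measure ℝ) : Prop :=
  ∀ a b : ℝ, 0 ≤ a → a < b → b ≤ 1 →
    ∀ h : EReal, 0 ≤ h →
      dimHE {x ∈ Set.Ioo a b | locDim μ x = h} = spec μ h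

/-- Scales `ℓ` of a Cantor set of dimension `v`: they decay at least geometrically with ratio
`ρ < 1 / 2`, never much faster than polynomially from one step to the next, and `2 ^ j * ℓ j ^ s`
decays geometrically for every `s > v`. -/
structure CantorScale (ℓ : ℕ → ℝ) (ρ v : ℝ) : Prop where
  pos : ∀ j, 0 < ℓ j
  le_one : ∀ j, ℓ j ≤ 1
  ratio_pos : 0 < ρ
  ratio_lt : ρ < 1 / 2
  succ_le : ∀ j, ℓ (j + 1) ≤ ρ * ℓ j
  nonneg : 0 ≤ v
  lt_one : v < 1
  le_succ : ∀ ε : ℝ, 0 < ε → ∃ A : ℝ, 0 < A ∧ ∀ j, A * ℓ j ^ (1 + ε) ≤ ℓ (j + 1)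
  decay : ∀ s : ℝ, v < s → ∃ θ : ℝ, 0 < θ ∧ θ < 1 ∧
    ∃ N, ∀ j, N ≤ j → 2 * ℓ (j + 1) ^ s ≤ θ * ℓ j ^ s

/-- The point with digits `ω` of the Cantor set with base point `p` and scales `ℓ`. -/
noncomputable def cantorPoint (p : ℝ) (ℓ : ℕ → ℝ) (ω : ℕ → Fin 2) : ℝ :=
  p + ∑' j, ((ω j : ℕ) : ℝ) * ℓ j

namespace CantorScale

variable {ℓ : ℕ → ℝ} {ρ v : ℝ}

/-- Half of the relative separation between cylinders of the Cantor set. -/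
noncomputable def sep (ρ : ℝ) : ℝ := (1 - 2 * ρ) / (2 * (1 - ρ))

theorem sep_pos (h : CantorScale ℓ ρ v) : 0 < sep ρ := by
  have := h.ratio_lt
  have := h.ratio_pos
  unfold sep
  apply div_pos <;> linarith

theorem sep_le_one (h : CantorScale ℓ ρ v) : sep ρ ≤ 1 := by
  have := h.ratio_lt
  have := h.ratio_pos
  unfold sep
  rw [div_le_one] <;> linarith

theorem add_le (h : CantorScale ℓ ρ v) (i j : ℕ) : ℓ (j + i) ≤ ρ ^ j * ℓ i := by
  induction j with
  | zero => simp
  | succ j ih =>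
    have h1 := h.succ_le (j + i)
    have h2 := mul_le_mul_of_nonneg_left ih h.ratio_pos.le
    calc ℓ (j + 1 + i) = ℓ (j + i + 1) := by congr 1; omega
      _ ≤ ρ * (ρ ^ j * ℓ i) := h1.trans h2
      _ = ρ ^ (j + 1) * ℓ i := by ring

theorem antitone (h : CantorScale ℓ ρ v) : Antitone ℓ := by
  refine antitone_nat_of_succ_le fun j => (h.succ_le j).trans ?_
  have := h.pos j
  have := h.ratio_lt
  nlinarith

theorem summable_add (h : CantorScale ℓ ρ v) (i : ℕ) : Summable fun j => ℓ (j + i) := by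
  have h1 : Summable fun j => ρ ^ j * ℓ i :=
    (summable_geometric_of_lt_one h.ratio_pos.le (by linarith [h.ratio_lt])).mul_right _
  exact Summable.of_nonneg_of_le (fun j => (h.pos _).le) (h.add_le i) h1

theorem tsum_add_le (h : CantorScale ℓ ρ v) (i : ℕ) : ∑' j, ℓ (j + i) ≤ ℓ i / (1 - ρ) := by
  have hr : ρ < 1 := by linarith [h.ratio_lt]
  have h1 : Summable fun j => ρ ^ j * ℓ i :=
    (summable_geometric_of_lt_one h.ratio_pos.le hr).mul_right _
  refine ((h.summable_add i).tsum_le_tsum (h.add_le i) h1).trans ?_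
  rw [tsum_mul_right, tsum_geometric_of_lt_one h.ratio_pos.le hr]
  exact le_of_eq (by ring)

theorem tendsto_zero (h : CantorScale ℓ ρ v) : Tendsto ℓ atTop (𝓝 0) :=
  (h.summable_add 0).tendsto_atTop_zero

theorem abs_digit_sub_le (a b : Fin 2) : |((a : ℕ) : ℝ) - ((b : ℕ) : ℝ)| ≤ 1 := by
  fin_cases a <;> fin_cases b <;> simp

theorem summable_digits (h : CantorScale ℓ ρ v) (ω : ℕ → Fin 2) :
    Summable fun j => ((ω j : ℕ) : ℝ) * ℓ j := by
  refine Summable.of_nonneg_of_le (fun j => mul_nonneg (by positivity) (h.pos _).le)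
    (fun j => ?_) (h.summable_add 0)
  have : ((ω j : ℕ) : ℝ) ≤ 1 := by exact_mod_cast Nat.lt_succ_iff.1 (ω j).2
  simpa using mul_le_mul_of_nonneg_right this (h.pos j).le

theorem cantorPoint_sub (h : CantorScale ℓ ρ v) (p : ℝ) (ω ω' : ℕ → Fin 2) :
    cantorPoint p ℓ ω - cantorPoint p ℓ ω' =
      ∑' j, (((ω j : ℕ) : ℝ) - ((ω' j : ℕ) : ℝ)) * ℓ j := by
  simp only [cantorPoint, sub_mul]
  rw [(h.summable_digits ω).tsum_sub (h.summable_digits ω')]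
  ring

theorem abs_cantorPoint_sub_le' (h : CantorScale ℓ ρ v) (p : ℝ) {ω ω' : ℕ → Fin 2} {i : ℕ}
    (hi : ∀ j < i, ω j = ω' j) :
    |cantorPoint p ℓ ω - cantorPoint p ℓ ω'| ≤ ℓ i / (1 - ρ) := by
  have hs : Summable fun j => (((ω j : ℕ) : ℝ) - ((ω' j : ℕ) : ℝ)) * ℓ j := by
    simpa only [sub_mul] using (h.summable_digits ω).sub (h.summable_digits ω')
  rw [h.cantorPoint_sub, ← hs.sum_add_tsum_nat_add i,
    Finset.sum_eq_zero (fun j hj => by rw [hi j (Finset.mem_range.1 hj)]; ring), zero_add,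
    ← Real.norm_eq_abs]
  refine (tsum_of_norm_bounded (h.summable_add i).hasSum fun j => ?_).trans (h.tsum_add_le i)
  rw [norm_mul, Real.norm_eq_abs, Real.norm_eq_abs, abs_of_pos (h.pos _)]
  have := mul_le_mul_of_nonneg_right (abs_digit_sub_le (ω (j + i)) (ω' (j + i))) (h.pos (j + i)).le
  linarith

theorem abs_cantorPoint_sub_le (h : CantorScale ℓ ρ v) (p : ℝ) {ω ω' : ℕ → Fin 2} {i : ℕ}
    (hi : ∀ j < i, ω j = ω' j) :
    |cantorPoint p ℓ ω - cantorPoint p ℓ ω'| ≤ 2 * ℓ i := by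
  refine (h.abs_cantorPoint_sub_le' p hi).trans ?_
  have := h.pos i
  have := h.ratio_lt
  rw [div_le_iff₀ (by linarith)]
  nlinarith

theorem le_abs_cantorPoint_sub (h : CantorScale ℓ ρ v) (p : ℝ) {ω ω' : ℕ → Fin 2} {k : ℕ}
    (hk : ∀ j < k, ω j = ω' j) (hne : ω k ≠ ω' k) :
    2 * sep ρ * ℓ k ≤ |cantorPoint p ℓ ω - cantorPoint p ℓ ω'| := by
  have h1 : |cantorPoint p ℓ ω - cantorPoint p ℓ (Function.update ω' k (ω k))| ≤
      ℓ (k + 1) / (1 - ρ) := by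
    refine h.abs_cantorPoint_sub_le' p fun j hj => ?_
    rcases eq_or_ne j k with rfl | hjk
    · simp
    · rw [Function.update_of_ne hjk, hk j (by omega)]
  have h2 : |cantorPoint p ℓ (Function.update ω' k (ω k)) - cantorPoint p ℓ ω'| = ℓ k := by
    rw [h.cantorPoint_sub, tsum_eq_single k, abs_mul, abs_of_pos (h.pos k)]
    · have : |(((Function.update ω' k (ω k)) k : ℕ) : ℝ) - ((ω' k : ℕ) : ℝ)| = 1 := by
        rw [Function.update_self]
        revert hne
        generalize ω k = a
        generalize ω' k = b
        fin_cases a <;> fin_cases b <;> simp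
      rw [this, one_mul]
    · intro j hj
      rw [Function.update_of_ne hj]
      ring
  have h3 : ℓ (k + 1) / (1 - ρ) ≤ ρ / (1 - ρ) * ℓ k := by
    have : 0 < 1 - ρ := by linarith [h.ratio_lt]
    rw [div_mul_eq_mul_div]
    exact div_le_div_of_nonneg_right (h.succ_le k) this.le
  have h4 : 2 * sep ρ * ℓ k = ℓ k - ρ / (1 - ρ) * ℓ k := by
    have : 1 - ρ ≠ 0 := by linarith [h.ratio_lt]
    unfold sep
    field_simp
    ring
  have h5 := abs_sub_abs_le_abs_sub
    (cantorPoint p ℓ (Function.update ω' k (ω k)) - cantorPoint p ℓ ω')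
    (cantorPoint p ℓ (Function.update ω' k (ω k)) - cantorPoint p ℓ ω)
  rw [sub_sub_sub_cancel_left] at h5
  rw [abs_sub_comm] at h1
  linarith

theorem agree_of_abs_lt (h : CantorScale ℓ ρ v) (p : ℝ) {ω ω' : ℕ → Fin 2} {J : ℕ}
    (hJ : |cantorPoint p ℓ ω - cantorPoint p ℓ ω'| < 2 * sep ρ * ℓ J) :
    ∀ j < J, ω j = ω' j := by
  by_contra! hcon
  have hex : ∃ j, ω j ≠ ω' j := ⟨hcon.choose, hcon.choose_spec.2⟩
  have h1 := h.le_abs_cantorPoint_sub p (k := Nat.find hex)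
    (fun j hj => not_not.1 (Nat.find_min hex hj)) (Nat.find_spec hex)
  have h2 : Nat.find hex ≤ J :=
    (Nat.find_min' hex hcon.choose_spec.2).trans hcon.choose_spec.1.le
  have h3 := mul_le_mul_of_nonneg_left (h.antitone h2)
    (mul_pos two_pos h.sep_pos).le
  linarith

theorem continuous_cantorPoint (h : CantorScale ℓ ρ v) (p : ℝ) :
    Continuous (cantorPoint p ℓ) := by
  refine continuous_const.add (continuous_tsum (u := ℓ) (fun j => ?_) (h.summable_add 0) ?_)
  · exact ((continuous_of_discreteTopology (f := fun a : Fin 2 => ((a : ℕ) : ℝ))).comp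
      (continuous_apply j)).mul_const _
  · intro j ω
    rw [norm_mul, Real.norm_eq_abs, Real.norm_eq_abs, abs_of_pos (h.pos _)]
    have : |((ω j : ℕ) : ℝ)| ≤ 1 := by simpa using abs_digit_sub_le (ω j) 0
    simpa using mul_le_mul_of_nonneg_right this (h.pos j).le

theorem injective_cantorPoint (h : CantorScale ℓ ρ v) (p : ℝ) :
    Function.Injective (cantorPoint p ℓ) := by
  intro ω ω' heq
  funext j
  refine h.agree_of_abs_lt p (J := j + 1) ?_ j (Nat.lt_succ_self j)
  rw [heq, sub_self, abs_zero]
  exact mul_pos (mul_pos two_pos h.sep_pos) (h.pos _)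

theorem isClosedEmbedding_cantorPoint (h : CantorScale ℓ ρ v) (p : ℝ) :
    Topology.IsClosedEmbedding (cantorPoint p ℓ) :=
  (h.continuous_cantorPoint p).isClosedEmbedding (h.injective_cantorPoint p)

theorem range_cantorPoint_subset (h : CantorScale ℓ ρ v) (p : ℝ) :
    range (cantorPoint p ℓ) ⊆ Icc p (p + 2 * ℓ 0) := by
  rintro _ ⟨ω, rfl⟩
  have h0 : cantorPoint p ℓ (fun _ => 0) = p := by simp [cantorPoint]
  have h1 := h.abs_cantorPoint_sub_le p (ω := ω) (ω' := fun _ => 0) (i := 0) (by simp)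
  rw [h0] at h1
  have h2 : 0 ≤ ∑' j, ((ω j : ℕ) : ℝ) * ℓ j :=
    tsum_nonneg fun j => mul_nonneg (by positivity) (h.pos j).le
  refine ⟨by unfold cantorPoint; linarith, ?_⟩
  linarith [le_abs_self (cantorPoint p ℓ ω - p)]

/-- The sequence following `ω` up to index `J`, then `w`, then constantly `0`. -/
def splice {m : ℕ} (ω : ℕ → Fin 2) (J : ℕ) (w : Fin m → Fin 2) : ℕ → Fin 2 := fun j =>
  if j < J then ω j else if hj : j - J < m then w ⟨j - J, hj⟩ else 0

theorem exists_splice (h : CantorScale ℓ ρ v) (p : ℝ) {ω ω' : ℕ → Fin 2} {J : ℕ} (m : ℕ)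
    (hJ : ∀ j < J, ω' j = ω j) :
    ∃ w : Fin m → Fin 2,
      |cantorPoint p ℓ ω' - cantorPoint p ℓ (splice ω J w)| ≤ 2 * ℓ (J + m) := by
  refine ⟨fun i => ω' (J + i), h.abs_cantorPoint_sub_le p fun j hj => ?_⟩
  unfold splice
  split_ifs with h1 h2
  · exact hJ j h1
  · congr 1
    simp only
    omega
  · omega

theorem volume_cylinder_nhds_le (h : CantorScale ℓ ρ v) (p : ℝ) (ω : ℕ → Fin 2) (J m : ℕ) :
    volume {y : ℝ | ∃ ω' : ℕ → Fin 2, (∀ j < J, ω' j = ω j) ∧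
      |y - cantorPoint p ℓ ω'| < sep ρ * ℓ (J + m)} ≤
      ENNReal.ofReal (2 ^ m * (6 * ℓ (J + m))) := by
  have hsub : {y : ℝ | ∃ ω' : ℕ → Fin 2, (∀ j < J, ω' j = ω j) ∧
      |y - cantorPoint p ℓ ω'| < sep ρ * ℓ (J + m)} ⊆
      ⋃ w : Fin m → Fin 2, ball (cantorPoint p ℓ (splice ω J w)) (3 * ℓ (J + m)) := by
    rintro y ⟨ω', hω', hy⟩
    obtain ⟨w, hw⟩ := h.exists_splice p m hω'
    refine mem_iUnion.2 ⟨w, ?_⟩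
    rw [mem_ball, Real.dist_eq]
    have h1 := abs_sub_le y (cantorPoint p ℓ ω') (cantorPoint p ℓ (splice ω J w))
    have h2 := mul_le_mul_of_nonneg_right h.sep_le_one (h.pos (J + m)).le
    linarith
  refine (measure_mono hsub).trans ((measure_iUnion_fintype_le _ _).trans ?_)
  simp only [Real.volume_ball]
  rw [Finset.sum_const, Finset.card_univ, nsmul_eq_mul,
    show 2 * (3 * ℓ (J + m)) = 6 * ℓ (J + m) by ring, ← ENNReal.ofReal_natCast,
    ← ENNReal.ofReal_mul (by positivity)]
  simp

theorem pow_mul_rpow_le {s θ : ℝ} {N : ℕ}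
    (hθ : 0 < θ) (hN : ∀ j, N ≤ j → 2 * ℓ (j + 1) ^ s ≤ θ * ℓ j ^ s) {J : ℕ} (hJ : N ≤ J) (m : ℕ) :
    2 ^ m * ℓ (J + m) ^ s ≤ θ ^ m * ℓ J ^ s := by
  induction m with
  | zero => simp
  | succ m ih =>
    have h1 := mul_le_mul_of_nonneg_left (hN (J + m) (by omega)) (pow_nonneg two_pos.le m (M₀ := ℝ))
    have h2 := mul_le_mul_of_nonneg_left ih hθ.le
    calc (2 : ℝ) ^ (m + 1) * ℓ (J + (m + 1)) ^ s = 2 ^ m * (2 * ℓ (J + m + 1) ^ s) := by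
          rw [← add_assoc]; ring
      _ ≤ θ * (2 ^ m * ℓ (J + m) ^ s) := by linarith
      _ ≤ _ := by rw [pow_succ]; linarith

theorem dimH_range_le (h : CantorScale ℓ ρ v) (p : ℝ) :
    dimH (range (cantorPoint p ℓ)) ≤ ENNReal.ofReal v := by
  refine le_of_forall_gt_imp_ge_of_dense fun s' hs' => ?_
  rcases eq_or_ne s' ⊤ with rfl | hs'top
  · exact le_top
  lift s' to NNReal using hs'top
  have hs : v < (s' : ℝ) := by
    rwa [← ENNReal.ofReal_coe_nnreal, ENNReal.ofReal_lt_ofReal_iff_of_nonneg h.nonneg] at hs'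
  have hs0 : 0 ≤ (s' : ℝ) := s'.2
  have hdiam : ∀ x r : ℝ, ediam (closedBall x r) = ENNReal.ofReal (2 * r) := fun x r => by
    rw [Real.closedBall_eq_Icc, Real.ediam_Icc]
    congr 1
    ring
  obtain ⟨θ, hθ0, hθ1, N, hN⟩ := h.decay s' hs
  refine dimH_le_of_hausdorffMeasure_ne_top (ne_top_of_le_ne_top (b := ENNReal.ofReal
    (2 ^ N * 4 ^ (s' : ℝ) * ℓ N ^ (s' : ℝ))) ENNReal.ofReal_ne_top ?_)
  refine (Measure.hausdorffMeasure_le_liminf_sum (β := ℕ) (ι := fun n => Fin (N + n) → Fin 2)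
    (s' : ℝ) (range (cantorPoint p ℓ)) (l := atTop) (fun n => ENNReal.ofReal (4 * ℓ (N + n))) ?_
    (fun n w => closedBall (cantorPoint p ℓ (splice (fun _ => 0) 0 w)) (2 * ℓ (N + n))) ?_ ?_).trans
    ?_
  · have h1 : Tendsto (fun n => 4 * ℓ (N + n)) atTop (𝓝 (4 * 0)) :=
      (h.tendsto_zero.comp (tendsto_add_atTop_nat N |>.congr fun n => add_comm n N)).const_mul 4
    have h2 := ENNReal.tendsto_ofReal h1
    simpa using h2
  · refine Eventually.of_forall fun n w => ?_
    rw [hdiam]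
    exact ENNReal.ofReal_le_ofReal (by linarith)
  · refine Eventually.of_forall fun n => ?_
    rintro _ ⟨ω, rfl⟩
    obtain ⟨w, hw⟩ := h.exists_splice p (ω := fun _ => 0) (ω' := ω) (J := 0) (N + n) (by simp)
    refine mem_iUnion.2 ⟨w, ?_⟩
    rw [mem_closedBall, Real.dist_eq]
    simpa using hw
  · refine (liminf_le_liminf (v := fun _ => ENNReal.ofReal
      (2 ^ N * 4 ^ (s' : ℝ) * ℓ N ^ (s' : ℝ))) (Eventually.of_forall fun n => ?_)).trans
      (liminf_const _).le
    have hp := h.pos (N + n)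
    have hq := Real.rpow_pos_of_pos (h.pos N) s'
    have h4 : (0 : ℝ) < 4 ^ (s' : ℝ) := by positivity
    simp only [hdiam]
    rw [Finset.sum_const, Finset.card_univ, nsmul_eq_mul,
      ENNReal.ofReal_rpow_of_pos (by linarith), ← ENNReal.ofReal_natCast,
      ← ENNReal.ofReal_mul (by positivity)]
    refine ENNReal.ofReal_le_ofReal ?_
    have h1 := pow_mul_rpow_le hθ0 hN le_rfl n
    have h2 : θ ^ n ≤ 1 := pow_le_one₀ hθ0.le hθ1.le
    have h3 : θ ^ n * ℓ N ^ (s' : ℝ) ≤ ℓ N ^ (s' : ℝ) := by nlinarith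
    calc ((Fintype.card (Fin (N + n) → Fin 2) : ℕ) : ℝ) * (2 * (2 * ℓ (N + n))) ^ (s' : ℝ)
        = 2 ^ N * 4 ^ (s' : ℝ) * (2 ^ n * ℓ (N + n) ^ (s' : ℝ)) := by
          rw [show 2 * (2 * ℓ (N + n)) = 4 * ℓ (N + n) by ring,
            Real.mul_rpow (by norm_num) hp.le]
          simp [pow_add]
          ring
      _ ≤ _ := mul_le_mul_of_nonneg_left (h1.trans h3) (by positivity)

theorem volume_range (h : CantorScale ℓ ρ v) (p : ℝ) :
    volume (range (cantorPoint p ℓ)) = 0 := by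
  rw [← hausdorffMeasure_real]
  have : dimH (range (cantorPoint p ℓ)) < ((1 : NNReal) : ENNReal) :=
    (h.dimH_range_le p).trans_lt (by simpa using h.lt_one)
  simpa using hausdorffMeasure_of_dimH_lt this

end CantorScale
namespace CantorScale

variable {ℓ : ℕ → ℝ} {ρ v : ℝ}

theorem exists_layer (h : CantorScale ℓ ρ v) {J : ℕ} {d : ℝ} (hd : 0 < d)
    (hJ : d < sep ρ * ℓ J) :
    ∃ i, J ≤ i ∧ sep ρ * ℓ (i + 1) ≤ d ∧ d < sep ρ * ℓ i := by
  have ht : Tendsto (fun i => sep ρ * ℓ i) atTop (𝓝 0) := by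
    simpa using h.tendsto_zero.const_mul (sep ρ)
  have hex : ∃ i, sep ρ * ℓ i ≤ d := ((ht.eventually (gt_mem_nhds hd)).exists).imp fun _ hi => hi.le
  have hspec := Nat.find_spec hex
  have hgt : J < Nat.find hex := by
    by_contra! hle
    have := mul_le_mul_of_nonneg_left (h.antitone hle) h.sep_pos.le
    linarith
  obtain ⟨i, hi⟩ : ∃ i, Nat.find hex = i + 1 := ⟨Nat.find hex - 1, by omega⟩
  rw [hi] at hspec hgt
  refine ⟨i, by omega, hspec, ?_⟩
  have := Nat.find_min hex (m := i) (by omega)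
  linarith

theorem lintegral_infDist_rpow_le_tsum (h : CantorScale ℓ ρ v) (p : ℝ) {q : ℝ} (hq1 : q ≤ 1)
    {r : ℝ} {J : ℕ} (hr : r ≤ sep ρ * ℓ J) (ω : ℕ → Fin 2) :
    ∫⁻ y in ball (cantorPoint p ℓ ω) r,
        ENNReal.ofReal (infDist y (range (cantorPoint p ℓ))) ^ (q - 1) ≤
      ∑' m, ENNReal.ofReal ((sep ρ * ℓ (J + m + 1)) ^ (q - 1)) *
        ENNReal.ofReal (2 ^ m * (6 * ℓ (J + m))) := by
  set C := range (cantorPoint p ℓ) with hC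
  set x := cantorPoint p ℓ ω with hx
  have hCne : C.Nonempty := range_nonempty _
  have hCcl : IsClosed C := (h.isClosedEmbedding_cantorPoint p).isClosed_range
  let E : ℕ → Set ℝ := fun m => {y | y ∈ ball x r ∧ infDist y C < sep ρ * ℓ (J + m)}
  have hE : ∀ m, MeasurableSet (E m) := fun m =>
    measurableSet_ball.inter (measurableSet_lt (continuous_infDist_pt C).measurable measurable_const)
  have hvol : ∀ m, volume (E m) ≤ ENNReal.ofReal (2 ^ m * (6 * ℓ (J + m))) := by
    intro m
    refine (measure_mono ?_).trans (h.volume_cylinder_nhds_le p ω J m)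
    rintro y ⟨hy1, hy2⟩
    obtain ⟨z, ⟨ω', rfl⟩, hz⟩ := (infDist_lt_iff hCne).1 hy2
    rw [Real.dist_eq] at hz
    rw [mem_ball, Real.dist_eq] at hy1
    refine ⟨ω', h.agree_of_abs_lt p ?_, hz⟩
    have h1 := abs_sub_le (cantorPoint p ℓ ω') y x
    rw [abs_sub_comm (cantorPoint p ℓ ω') y] at h1
    have h2 := mul_le_mul_of_nonneg_left (h.antitone (Nat.le_add_right J m)) h.sep_pos.le
    linarith
  have hpt : ∀ y ∈ ball x r, y ∉ C → ENNReal.ofReal (infDist y C) ^ (q - 1) ≤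
      ∑' m, (E m).indicator
        (fun _ => ENNReal.ofReal ((sep ρ * ℓ (J + m + 1)) ^ (q - 1))) y := by
    intro y hy hyC
    have hd : 0 < infDist y C := (hCcl.notMem_iff_infDist_pos hCne).1 hyC
    have hdr : infDist y C < r := (infDist_le_dist_of_mem (mem_range_self ω)).trans_lt hy
    obtain ⟨i, hJi, hi1, hi2⟩ := h.exists_layer hd (hdr.trans_le hr)
    obtain ⟨m, rfl⟩ := Nat.exists_eq_add_of_le hJi
    refine le_trans ?_ (ENNReal.le_tsum m)
    rw [indicator_of_mem (show y ∈ E m from ⟨hy, hi2⟩), ENNReal.ofReal_rpow_of_pos hd]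
    exact ENNReal.ofReal_le_ofReal (Real.rpow_le_rpow_of_nonpos
      (mul_pos h.sep_pos (h.pos _)) hi1 (by linarith))
  have hae : ∀ᵐ y ∂(volume : Measure ℝ), y ∉ C := measure_eq_zero_iff_ae_notMem.1 (h.volume_range p)
  calc ∫⁻ y in ball x r, ENNReal.ofReal (infDist y C) ^ (q - 1)
      ≤ ∫⁻ y in ball x r, ∑' m, (E m).indicator
        (fun _ => ENNReal.ofReal ((sep ρ * ℓ (J + m + 1)) ^ (q - 1))) y := by
        refine lintegral_mono_ae ?_
        filter_upwards [ae_restrict_of_ae hae, ae_restrict_mem measurableSet_ball] with y h1 h2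
        exact hpt y h2 h1
    _ ≤ ∫⁻ y, ∑' m, (E m).indicator
        (fun _ => ENNReal.ofReal ((sep ρ * ℓ (J + m + 1)) ^ (q - 1))) y :=
        setLIntegral_le_lintegral _ _
    _ = ∑' m, ENNReal.ofReal ((sep ρ * ℓ (J + m + 1)) ^ (q - 1)) * volume (E m) := by
        rw [lintegral_tsum fun m => (measurable_const.indicator (hE m)).aemeasurable]
        refine tsum_congr fun m => ?_
        rw [lintegral_indicator_const (hE m)]
    _ ≤ _ := ENNReal.tsum_le_tsum fun m => mul_le_mul_right (hvol m) _

theorem exists_lintegral_infDist_rpow_le (h : CantorScale ℓ ρ v) (p : ℝ) {q ε : ℝ} (hq : v < q)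
    (hq1 : q ≤ 1) (hε : 0 < ε) :
    ∃ K : ℝ, 0 < K ∧ ∃ r₀ : ℝ, 0 < r₀ ∧ ∀ r, 0 < r → r < r₀ → ∀ ω : ℕ → Fin 2,
      ∫⁻ y in ball (cantorPoint p ℓ ω) r,
        ENNReal.ofReal (infDist y (range (cantorPoint p ℓ))) ^ (q - 1) ≤
          ENNReal.ofReal (K * r ^ (q - ε)) := by
  obtain ⟨δ, hδ, hδε, hδq⟩ : ∃ δ : ℝ, 0 < δ ∧ 2 * δ ≤ ε ∧ v < q - δ :=
    ⟨min (ε / 2) ((q - v) / 2), lt_min (by linarith) (by linarith),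
      by linarith [min_le_left (ε / 2) ((q - v) / 2)],
      by linarith [min_le_right (ε / 2) ((q - v) / 2)]⟩
  obtain ⟨θ, hθ0, hθ1, N, hN⟩ := h.decay _ hδq
  obtain ⟨A, hA, hAs⟩ := h.le_succ δ hδ
  have hκ := h.sep_pos
  have hv := h.nonneg
  set κ := sep ρ with hκdef
  set K₁ : ℝ := 6 * (κ * A) ^ (q - 1) with hK₁
  have hκA : 0 < κ * A := mul_pos hκ hA
  have hK₁pos : 0 < K₁ := by positivity
  set e : ℝ := (q - δ) / (1 + δ) with he
  have he0 : 0 ≤ e := div_nonneg (by linarith) (by linarith)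
  have heq : q - ε ≤ e := by
    rw [he, le_div_iff₀ (by linarith)]
    nlinarith
  have hterm : ∀ i, (κ * ℓ (i + 1)) ^ (q - 1) * (6 * ℓ i) ≤ K₁ * ℓ i ^ (q - δ) := by
    intro i
    have hp := h.pos i
    have h1 : (κ * ℓ (i + 1)) ^ (q - 1) ≤ (κ * A) ^ (q - 1) * ℓ i ^ ((1 + δ) * (q - 1)) := by
      rw [Real.rpow_mul hp.le, ← Real.mul_rpow hκA.le (by positivity)]
      refine Real.rpow_le_rpow_of_nonpos (by positivity) ?_ (by linarith)
      rw [mul_assoc]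
      exact mul_le_mul_of_nonneg_left (hAs i) hκ.le
    have h2 : ℓ i ^ ((1 + δ) * (q - 1)) * ℓ i ≤ ℓ i ^ (q - δ) := by
      rw [← Real.rpow_add_one hp.ne']
      refine Real.rpow_le_rpow_of_exponent_ge hp (h.le_one i) ?_
      nlinarith
    calc (κ * ℓ (i + 1)) ^ (q - 1) * (6 * ℓ i)
        ≤ (κ * A) ^ (q - 1) * ℓ i ^ ((1 + δ) * (q - 1)) * (6 * ℓ i) :=
          mul_le_mul_of_nonneg_right h1 (by positivity)
      _ = K₁ * (ℓ i ^ ((1 + δ) * (q - 1)) * ℓ i) := by rw [hK₁]; ring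
      _ ≤ _ := mul_le_mul_of_nonneg_left h2 hK₁pos.le
  set K : ℝ := K₁ * (1 - θ)⁻¹ * ((κ * A)⁻¹) ^ e with hK
  have hθ' : 0 < (1 - θ)⁻¹ := inv_pos.2 (by linarith)
  refine ⟨K, by positivity, min 1 (κ * ℓ N), lt_min one_pos (mul_pos hκ (h.pos N)), ?_⟩
  intro r hr hr0 ω
  obtain ⟨J, hNJ, hJ1, hJ2⟩ := h.exists_layer hr (hr0.trans_le (min_le_right _ _))
  refine (h.lintegral_infDist_rpow_le_tsum p hq1 hJ2.le ω).trans ?_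
  have hsum : ∀ m, ENNReal.ofReal ((κ * ℓ (J + m + 1)) ^ (q - 1)) *
      ENNReal.ofReal (2 ^ m * (6 * ℓ (J + m))) ≤
      ENNReal.ofReal (θ ^ m * (K₁ * ℓ J ^ (q - δ))) := by
    intro m
    have hp := h.pos (J + m)
    have hp' := h.pos (J + m + 1)
    rw [← ENNReal.ofReal_mul (by positivity)]
    refine ENNReal.ofReal_le_ofReal ?_
    have h1 := mul_le_mul_of_nonneg_left (hterm (J + m)) (pow_nonneg two_pos.le m (M₀ := ℝ))
    have h2 := mul_le_mul_of_nonneg_left (pow_mul_rpow_le hθ0 hN hNJ m) hK₁pos.le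
    calc _ = 2 ^ m * ((κ * ℓ (J + m + 1)) ^ (q - 1) * (6 * ℓ (J + m))) := by ring
      _ ≤ K₁ * (2 ^ m * ℓ (J + m) ^ (q - δ)) := by linarith
      _ ≤ _ := by linarith
  refine (ENNReal.tsum_le_tsum hsum).trans ?_
  have hpJ := h.pos J
  rw [← ENNReal.ofReal_tsum_of_nonneg (fun m => by positivity)
    ((summable_geometric_of_lt_one hθ0.le hθ1).mul_right _), tsum_mul_right,
    tsum_geometric_of_lt_one hθ0.le hθ1]
  refine ENNReal.ofReal_le_ofReal ?_
  have h1 : ℓ J ^ (q - δ) ≤ ((κ * A)⁻¹) ^ e * r ^ e := by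
    rw [← Real.mul_rpow (inv_pos.2 hκA).le hr.le]
    have h2 : ℓ J ^ (1 + δ) ≤ (κ * A)⁻¹ * r := by
      rw [← div_eq_inv_mul, le_div_iff₀ hκA]
      have := mul_le_mul_of_nonneg_left (hAs J) hκ.le
      linarith
    calc ℓ J ^ (q - δ) = (ℓ J ^ (1 + δ)) ^ e := by
          rw [← Real.rpow_mul hpJ.le, he, mul_div_cancel₀ _ (by linarith)]
      _ ≤ _ := Real.rpow_le_rpow (by positivity) h2 he0
  have h3 : r ^ e ≤ r ^ (q - ε) :=
    Real.rpow_le_rpow_of_exponent_ge hr (hr0.le.trans (min_le_left _ _)) heq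
  calc (1 - θ)⁻¹ * (K₁ * ℓ J ^ (q - δ))
      ≤ (1 - θ)⁻¹ * (K₁ * (((κ * A)⁻¹) ^ e * r ^ e)) := by gcongr
    _ = K * r ^ e := by rw [hK]; ring
    _ ≤ _ := mul_le_mul_of_nonneg_left h3 (by positivity)

end CantorScale
/-- The positions of the free digits. -/
def freePos (i : ℕ) : ℕ := i + Nat.sqrt i

/-- The positions of the digits that encode a local exponent; they have density zero and form
the complement of the range of `freePos`. -/
def codePos (k : ℕ) : ℕ := k ^ 2 + 3 * k + 1

theorem freePos_strictMono : StrictMono freePos := fun _ _ hij =>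
  add_lt_add_of_lt_of_le hij (Nat.sqrt_le_sqrt hij.le)

theorem codePos_injective : Function.Injective codePos := by
  have : StrictMono codePos := fun i j hij => by
    unfold codePos
    nlinarith
  exact this.injective

theorem codePos_ne_freePos (k i : ℕ) : freePos i ≠ codePos k := by
  unfold codePos freePos
  intro h
  have h1 := Nat.sqrt_le' i
  have h2 := Nat.lt_succ_sqrt' i
  rw [Nat.succ_eq_add_one] at h2
  generalize Nat.sqrt i = n at *
  rcases le_or_gt n k with hn | hn
  · nlinarith
  · nlinarith

/-- The sequence with digits `η` at the free positions and `c` at the code positions. -/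
noncomputable def mergeDigits (c η : ℕ → Fin 2) : ℕ → Fin 2 :=
  Function.extend freePos η (Function.extend codePos c 0)

theorem mergeDigits_freePos (c η : ℕ → Fin 2) (i : ℕ) : mergeDigits c η (freePos i) = η i :=
  freePos_strictMono.injective.extend_apply _ _ _

theorem mergeDigits_codePos (c η : ℕ → Fin 2) (k : ℕ) : mergeDigits c η (codePos k) = c k := by
  unfold mergeDigits
  rw [Function.extend_apply' _ _ _ (fun ⟨i, hi⟩ => codePos_ne_freePos k i hi)]
  exact codePos_injective.extend_apply _ _ _

theorem mergeDigits_agree (c : ℕ → Fin 2) {η η' : ℕ → Fin 2} {i : ℕ} (hi : ∀ j < i, η j = η' j) :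
    ∀ j < freePos i, mergeDigits c η j = mergeDigits c η' j := by
  intro j hj
  by_cases hex : ∃ k, freePos k = j
  · obtain ⟨k, rfl⟩ := hex
    rw [mergeDigits_freePos, mergeDigits_freePos, hi k (freePos_strictMono.lt_iff_lt.1 hj)]
  · unfold mergeDigits
    rw [Function.extend_apply' _ _ _ hex, Function.extend_apply' _ _ _ hex]

namespace CantorScale

variable {ℓ : ℕ → ℝ} {ρ v : ℝ}

theorem le_dimH_code (h : CantorScale ℓ ρ v) (p : ℝ)
    (hfree : ∀ r : ℝ, 0 < r → r < v → ∃ K : ℝ, 0 < K ∧ ∀ i, ((2 : ℝ) ^ i)⁻¹ ≤ K * ℓ (freePos i) ^ r)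
    (c : ℕ → Fin 2) :
    ENNReal.ofReal v ≤ dimH (cantorPoint p ℓ '' {ω | ∀ k, ω (codePos k) = c k}) := by
  refine le_of_forall_lt_imp_le_of_dense fun r' hr' => ?_
  lift r' to NNReal using (hr'.trans ENNReal.ofReal_lt_top).ne
  rcases eq_or_ne r' 0 with rfl | hr0
  · simp
  have hr0' : 0 < (r' : ℝ) := by positivity
  have hrv : (r' : ℝ) < v := by
    exact (ENNReal.ofReal_lt_ofReal_iff_of_nonneg (NNReal.coe_nonneg r')).1
      (by rwa [ENNReal.ofReal_coe_nnreal])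
  obtain ⟨K, hK, hKi⟩ := hfree r' hr0' hrv
  let x : (ℕ → Fin 2) → ℝ := fun η => cantorPoint p ℓ (mergeDigits c η)
  have hxinj : Function.Injective x := by
    intro η η' heq
    have := h.injective_cantorPoint p heq
    funext i
    rw [← mergeDigits_freePos c η, ← mergeDigits_freePos c η', this]
  have hs := h.sep_pos
  have hhol : ∀ η η', |Real.ofDigits η - Real.ofDigits η'| ≤
      K * (2 * sep ρ)⁻¹ ^ (r' : ℝ) * |x η - x η'| ^ (r' : ℝ) := by
    intro η η'
    rcases eq_or_ne η η' with rfl | hne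
    · simp [hr0]
    have hex : ∃ i, η i ≠ η' i := Function.ne_iff.1 hne
    have hmin : ∀ j < Nat.find hex, η j = η' j := fun j hj => not_not.1 (Nat.find_min hex hj)
    have hspec := Nat.find_spec hex
    generalize Nat.find hex = i at hmin hspec
    have h1 := Real.abs_ofDigits_sub_ofDigits_le hmin
    have h2 := h.le_abs_cantorPoint_sub p (mergeDigits_agree c hmin)
      (by rwa [mergeDigits_freePos, mergeDigits_freePos])
    have hp := h.pos (freePos i)
    refine h1.trans ((by exact_mod_cast hKi i : _ ≤ _).trans ?_)
    rw [mul_assoc, ← Real.mul_rpow (by positivity) (abs_nonneg _)]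
    refine mul_le_mul_of_nonneg_left (Real.rpow_le_rpow hp.le ?_ hr0'.le) hK.le
    rw [← div_eq_inv_mul, le_div_iff₀ (by positivity)]
    linarith
  have hholder : HolderOnWith (K * (2 * sep ρ)⁻¹ ^ (r' : ℝ)).toNNReal r'
      (Real.ofDigits ∘ Function.invFun x) (range x) := by
    rintro _ ⟨η, rfl⟩ _ ⟨η', rfl⟩
    simp only [Function.comp, Function.leftInverse_invFun hxinj _]
    rw [edist_dist, edist_dist, Real.dist_eq, Real.dist_eq,
      ENNReal.ofReal_rpow_of_nonneg (abs_nonneg _) hr0'.le,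
      ← ENNReal.ofReal_coe_nnreal (p := Real.toNNReal _), Real.coe_toNNReal _ (by positivity),
      ← ENNReal.ofReal_mul (by positivity)]
    exact ENNReal.ofReal_le_ofReal (hhol η η')
  have himage : Icc (0 : ℝ) 1 ⊆ (Real.ofDigits ∘ Function.invFun x) '' range x := by
    intro u hu
    obtain ⟨η, -, hη⟩ := Real.ofDigits_SurjOn (b := 2) one_lt_two hu
    exact ⟨x η, mem_range_self η, by simp [Function.leftInverse_invFun hxinj _, hη]⟩
  have hone : dimH (Icc (0 : ℝ) 1) = 1 := by
    rw [Real.dimH_of_nonempty_interior (by simp)]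
    simp
  have h3 := (dimH_mono himage).trans (hholder.dimH_image_le (pos_iff_ne_zero.2 hr0))
  rw [hone, ENNReal.le_div_iff_mul_le (by simp [hr0]) (by simp), one_mul] at h3
  refine h3.trans (dimH_mono ?_)
  rintro _ ⟨η, rfl⟩
  exact mem_image_of_mem _ fun k => mergeDigits_codePos c η k

theorem exists_geometric {v η : ℝ} (hv : 0 < v) (hv1 : v < 1) (hη : 0 < η) :
    ∃ (ℓ : ℕ → ℝ) (ρ : ℝ), CantorScale ℓ ρ v ∧ ℓ 0 ≤ η ∧
      ∀ r : ℝ, 0 < r → r < v → ∃ K : ℝ, 0 < K ∧ ∀ i, ((2 : ℝ) ^ i)⁻¹ ≤ K * ℓ (freePos i) ^ r := by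
  set lam : ℝ := 2 ^ (-(1 / v)) with hlam
  have hlam0 : 0 < lam := by positivity
  have hpow : ∀ s : ℝ, lam ^ s = 2 ^ (-(s / v)) := fun s => by
    rw [hlam, ← Real.rpow_mul two_pos.le]
    congr 1
    ring
  have hlam1 : lam < 1 / 2 := by
    have : lam < 2 ^ (-1 : ℝ) := by
      rw [hlam]
      refine Real.rpow_lt_rpow_of_exponent_lt one_lt_two ?_
      rw [neg_lt_neg_iff, lt_div_iff₀ hv]
      linarith
    rw [Real.rpow_neg_one] at this
    linarith
  set e : ℝ := min η 1 with he
  have he0 : 0 < e := lt_min hη one_pos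
  have he1 : e ≤ 1 := min_le_right _ _
  have hle : ∀ j, e * lam ^ j ≤ 1 := fun j =>
    mul_le_one₀ he1 (by positivity) (pow_le_one₀ hlam0.le (by linarith))
  refine ⟨fun j => e * lam ^ j, lam, ⟨fun j => by positivity, hle, hlam0, hlam1,
    fun j => le_of_eq (by ring), hv.le, hv1, ?_, ?_⟩, ?_, ?_⟩
  · intro ε hε
    refine ⟨lam, hlam0, fun j => ?_⟩
    have h1 : (e * lam ^ j) ^ (1 + ε) ≤ e * lam ^ j := by
      have := Real.rpow_le_rpow_of_exponent_ge (by positivity) (hle j)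
        (show (1 : ℝ) ≤ 1 + ε by linarith)
      rwa [Real.rpow_one] at this
    calc lam * (e * lam ^ j) ^ (1 + ε) ≤ lam * (e * lam ^ j) :=
          mul_le_mul_of_nonneg_left h1 hlam0.le
      _ = e * lam ^ (j + 1) := by ring
  · intro s hs
    refine ⟨2 * lam ^ s, by positivity, ?_, 0, fun j _ => ?_⟩
    · have : lam ^ s < 2 ^ (-1 : ℝ) := by
        rw [hpow]
        refine Real.rpow_lt_rpow_of_exponent_lt one_lt_two ?_
        rw [neg_lt_neg_iff, lt_div_iff₀ hv]
        linarith
      rw [Real.rpow_neg_one] at this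
      linarith
    · rw [show e * lam ^ (j + 1) = lam * (e * lam ^ j) by ring,
        Real.mul_rpow hlam0.le (by positivity)]
      exact le_of_eq (by ring)
  · simp only [pow_zero, mul_one]
    exact min_le_left _ _
  · intro r hr hrv
    set c : ℝ := r / v with hc
    have hc0 : 0 < c := div_pos hr hv
    have hc1 : c < 1 := (div_lt_one hv).2 hrv
    refine ⟨2 ^ (1 / (1 - c)) * (e ^ r)⁻¹, by positivity, fun i => ?_⟩
    have h1 : (e * lam ^ freePos i) ^ r = e ^ r * 2 ^ (-(c * freePos i)) := by
      rw [Real.mul_rpow he0.le (by positivity), ← Real.rpow_natCast, ← Real.rpow_mul hlam0.le,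
        hpow, hc]
      congr 3
      ring
    have h2 : 2 ^ (1 / (1 - c)) * (e ^ r)⁻¹ * (e ^ r * 2 ^ (-(c * (freePos i : ℝ)))) =
        (2 : ℝ) ^ (1 / (1 - c) + -(c * freePos i)) := by
      have : e ^ r ≠ 0 := by positivity
      rw [Real.rpow_add two_pos]
      field_simp
    simp only [h1]
    rw [h2, ← Real.rpow_natCast, ← Real.rpow_neg two_pos.le]
    refine Real.rpow_le_rpow_of_exponent_le one_le_two ?_
    have h3 : ((Nat.sqrt i : ℕ) : ℝ) ^ 2 ≤ i := by exact_mod_cast Nat.sqrt_le' i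
    have h4 : 0 ≤ ((Nat.sqrt i : ℕ) : ℝ) := by positivity
    have h5 : ((Nat.sqrt i : ℕ) : ℝ) ≤ (1 - c) * ((Nat.sqrt i : ℕ) : ℝ) ^ 2 + 1 / (1 - c) := by
      have hd : 0 < 1 - c := by linarith
      rcases le_total ((Nat.sqrt i : ℕ) : ℝ) (1 / (1 - c)) with h6 | h6
      · have : 0 ≤ (1 - c) * ((Nat.sqrt i : ℕ) : ℝ) ^ 2 := by positivity
        linarith
      · have h7 := (div_le_iff₀ hd).1 h6
        have h8 : 0 ≤ 1 / (1 - c) := by positivity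
        nlinarith
    have h6 : ((freePos i : ℕ) : ℝ) = i + ((Nat.sqrt i : ℕ) : ℝ) := by
      unfold freePos
      push_cast
      rfl
    rw [h6]
    nlinarith

theorem exists_superexponential {η : ℝ} (hη : 0 < η) :
    ∃ (ℓ : ℕ → ℝ) (ρ : ℝ), CantorScale ℓ ρ 0 ∧ ℓ 0 ≤ η := by
  set e : ℝ := min η 1 with he
  have he0 : 0 < e := lt_min hη one_pos
  have he1 : e ≤ 1 := min_le_right _ _
  have hle : ∀ j : ℕ, e * (1 / 4) ^ ((j + 1) ^ 2) ≤ 1 := fun j =>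
    mul_le_one₀ he1 (by positivity) (pow_le_one₀ (by norm_num) (by norm_num))
  have hsucc : ∀ j : ℕ, e * (1 / 4) ^ ((j + 1 + 1) ^ 2) =
      (1 / 4) ^ (2 * j + 3) * (e * (1 / 4) ^ ((j + 1) ^ 2)) := fun j => by
    rw [show (j + 1 + 1) ^ 2 = (2 * j + 3) + (j + 1) ^ 2 by ring, pow_add]
    ring
  refine ⟨fun j => e * (1 / 4) ^ ((j + 1) ^ 2), 1 / 4, ⟨fun j => by positivity, hle, by norm_num,
    by norm_num, fun j => ?_, le_rfl, one_pos, ?_, ?_⟩, ?_⟩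
  · rw [hsucc]
    refine mul_le_mul_of_nonneg_right ?_ (by positivity)
    simpa using pow_le_pow_of_le_one (a := (1 / 4 : ℝ)) (by norm_num) (by norm_num)
      (show 1 ≤ 2 * j + 3 by omega)
  · intro ε hε
    refine ⟨(1 / 4) ^ (1 / ε + 1), by positivity, fun j => ?_⟩
    rw [hsucc, Real.rpow_add (mul_pos he0 (by positivity)), Real.rpow_one, mul_left_comm, mul_comm]
    refine mul_le_mul_of_nonneg_right ?_ (by positivity)
    rw [Real.mul_rpow he0.le (by positivity), ← Real.rpow_natCast (1 / 4) ((j + 1) ^ 2),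
      ← Real.rpow_mul (by norm_num), ← Real.rpow_natCast (1 / 4) (2 * j + 3)]
    have h1 : e ^ ε ≤ 1 := Real.rpow_le_one he0.le he1 hε.le
    have h2 : (1 / 4 : ℝ) ^ (1 / ε + 1) * (e ^ ε * (1 / 4) ^ ((((j + 1) ^ 2 : ℕ) : ℝ) * ε)) ≤
        (1 / 4) ^ (1 / ε + 1) * (1 * (1 / 4) ^ ((((j + 1) ^ 2 : ℕ) : ℝ) * ε)) := by gcongr
    refine h2.trans ?_
    rw [one_mul, ← Real.rpow_add (by norm_num)]
    refine Real.rpow_le_rpow_of_exponent_ge (by norm_num) (by norm_num) ?_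
    push_cast
    have h3 : 2 * ((j : ℝ) + 1) ≤ 1 / ε + ((j : ℝ) + 1) ^ 2 * ε := by
      have h4 : 1 / ε + ((j : ℝ) + 1) ^ 2 * ε - 2 * ((j : ℝ) + 1) =
          (((j : ℝ) + 1) * ε - 1) ^ 2 / ε := by
        field_simp
        ring
      have h5 : 0 ≤ (((j : ℝ) + 1) * ε - 1) ^ 2 / ε := by positivity
      linarith
    linarith
  · intro s hs
    refine ⟨1 / 2, by norm_num, by norm_num, ⌈1 / s⌉₊, fun j hj => ?_⟩
    rw [hsucc, Real.mul_rpow (by positivity) (by positivity), ← mul_assoc]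
    refine mul_le_mul_of_nonneg_right ?_ (by positivity)
    have h1 : 1 / s ≤ j := (Nat.le_ceil _).trans (by exact_mod_cast hj)
    rw [div_le_iff₀ hs] at h1
    have h2 : ((1 / 4 : ℝ) ^ (2 * j + 3)) ^ s ≤ (1 / 4) ^ (1 : ℝ) := by
      rw [← Real.rpow_natCast, ← Real.rpow_mul (by norm_num)]
      refine Real.rpow_le_rpow_of_exponent_ge (by norm_num) (by norm_num) ?_
      push_cast
      nlinarith
    rw [Real.rpow_one] at h2
    linarith
  · have : (1 / 4 : ℝ) ^ ((0 + 1) ^ 2) ≤ 1 := by norm_num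
    exact (mul_le_of_le_one_right he0.le this).trans (min_le_left _ _)

/-- Cantor sets of any dimension in `[0, 1)` and of any small size exist. -/
theorem exists_scale {v η : ℝ} (hv : 0 ≤ v) (hv1 : v < 1) (hη : 0 < η) :
    ∃ (ℓ : ℕ → ℝ) (ρ : ℝ), CantorScale ℓ ρ v ∧ ℓ 0 ≤ η ∧
      ∀ r : ℝ, 0 < r → r < v → ∃ K : ℝ, 0 < K ∧ ∀ i, ((2 : ℝ) ^ i)⁻¹ ≤ K * ℓ (freePos i) ^ r := by
  rcases hv.eq_or_lt with rfl | hv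
  · obtain ⟨ℓ, ρ, h, h0⟩ := exists_superexponential hη
    exact ⟨ℓ, ρ, h, h0, fun r hr hr' => absurd hr hr'.not_gt⟩
  · exact exists_geometric hv hv1 hη

end CantorScale
/-- The measures of balls centred at `x` behave like `r ^ h` up to subpolynomial factors. -/
structure HasLocExp (μ : Measure ℝ) (x h : ℝ) : Prop where
  lower : ∀ ε : ℝ, 0 < ε → ∃ c : ℝ, 0 < c ∧
    ∀ᶠ r in 𝓝[>] (0 : ℝ), ENNReal.ofReal (c * r ^ (h + ε)) ≤ μ (ball x r)
  upper : ∀ ε : ℝ, 0 < ε → ∃ K : ℝ, 0 < K ∧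
    ∀ᶠ r in 𝓝[>] (0 : ℝ), μ (ball x r) ≤ ENNReal.ofReal (K * r ^ (h - ε))

theorem eventually_forall_ball {x : ℝ} {P : ℝ → Prop} (hP : ∀ᶠ y in 𝓝 x, P y) :
    ∀ᶠ r in 𝓝[>] (0 : ℝ), ∀ y ∈ ball x r, P y := by
  obtain ⟨δ, hδ, h⟩ := Metric.eventually_nhds_iff_ball.1 hP
  filter_upwards [Ioo_mem_nhdsGT hδ] with r hr y hy
  exact h y (ball_subset_ball hr.2.le hy)

theorem tendsto_div_log_nhdsGT (c : ℝ) :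
    Tendsto (fun r => c / Real.log r) (𝓝[>] (0 : ℝ)) (𝓝 0) :=
  Real.tendsto_log_nhdsGT_zero.const_div_atBot c

theorem HasLocExp.locDim_eq {μ : Measure ℝ} {x h : ℝ} (hμ : HasLocExp μ x h) :
    locDim μ x = (h : EReal) := by
  have hpos : ∀ r : ℝ, 0 < r → 0 < μ (ball x r) := by
    intro r hr
    obtain ⟨c, hc, hev⟩ := hμ.lower 1 one_pos
    obtain ⟨s, hs, hs'⟩ := (hev.and (Ioo_mem_nhdsGT hr)).exists
    refine lt_of_lt_of_le ?_ (hs.trans (measure_mono (ball_subset_ball hs'.2.le)))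
    have := hs'.1
    rw [ENNReal.ofReal_pos]
    positivity
  have hlim : Tendsto (fun r : ℝ => Real.log ((μ (ball x r)).toReal) / Real.log r)
      (𝓝[>] (0 : ℝ)) (𝓝 h) := by
    refine tendsto_order.2 ⟨fun a ha => ?_, fun a ha => ?_⟩
    · obtain ⟨K, hK, hev⟩ := hμ.upper ((h - a) / 2) (by linarith)
      have h1 := (tendsto_div_log_nhdsGT (Real.log K)).eventually
        (lt_mem_nhds (show -((h - a) / 2) < 0 by linarith))
      filter_upwards [hev, h1, Ioo_mem_nhdsGT one_pos] with r hr hr1 hr2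
      have hlog : Real.log r < 0 := Real.log_neg hr2.1 hr2.2
      have hrp : 0 < r ^ (h - (h - a) / 2) := Real.rpow_pos_of_pos hr2.1 _
      have hm : 0 < (μ (ball x r)).toReal :=
        ENNReal.toReal_pos (hpos r hr2.1).ne' (ne_top_of_le_ne_top ENNReal.ofReal_ne_top hr)
      have h2 : Real.log ((μ (ball x r)).toReal) ≤
          Real.log K + (h - (h - a) / 2) * Real.log r := by
        rw [← Real.log_rpow hr2.1, ← Real.log_mul hK.ne' hrp.ne']
        exact Real.log_le_log hm (ENNReal.toReal_le_of_le_ofReal (by positivity) hr)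
      have h3 : (Real.log K + (h - (h - a) / 2) * Real.log r) / Real.log r ≤
          Real.log ((μ (ball x r)).toReal) / Real.log r :=
        div_le_div_of_nonpos_of_le hlog.le h2
      rw [add_div, mul_div_cancel_right₀ _ hlog.ne] at h3
      linarith
    · obtain ⟨c, hc, hev⟩ := hμ.lower ((a - h) / 2) (by linarith)
      obtain ⟨K, hK, hev'⟩ := hμ.upper 1 one_pos
      have h1 := (tendsto_div_log_nhdsGT (Real.log c)).eventually
        (gt_mem_nhds (show 0 < (a - h) / 2 by linarith))
      filter_upwards [hev, hev', h1, Ioo_mem_nhdsGT one_pos] with r hr hr' hr1 hr2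
      have hlog : Real.log r < 0 := Real.log_neg hr2.1 hr2.2
      have hrp : 0 < r ^ (h + (a - h) / 2) := Real.rpow_pos_of_pos hr2.1 _
      have h2 : Real.log c + (h + (a - h) / 2) * Real.log r ≤
          Real.log ((μ (ball x r)).toReal) := by
        rw [← Real.log_rpow hr2.1, ← Real.log_mul hc.ne' hrp.ne']
        exact Real.log_le_log (by positivity)
          ((ENNReal.ofReal_le_iff_le_toReal (ne_top_of_le_ne_top ENNReal.ofReal_ne_top hr')).1 hr)
      have h3 : Real.log ((μ (ball x r)).toReal) / Real.log r ≤
          (Real.log c + (h + (a - h) / 2) * Real.log r) / Real.log r :=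
        div_le_div_of_nonpos_of_le hlog.le h2
      rw [add_div, mul_div_cancel_right₀ _ hlog.ne] at h3
      linarith
  unfold locDim
  rw [if_pos hpos]
  exact ((continuous_coe_real_ereal.tendsto h).comp hlim).liminf_eq

/-- A finite measure on `[p, q]` that has locally at most linear growth off a Cantor set `C` of
dimension `v`, while on `C` the local exponents are given by a function `H` all of whose level sets
over `[a, b]` have dimension `v`. -/
structure IsBlock (ν : Measure ℝ) (C : Set ℝ) (H : ℝ → ℝ) (p q v a b : ℝ) : Prop where
  finite : IsFiniteMeasure ν
  compl : ν (Icc p q)ᶜ = 0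
  subset : C ⊆ Ioo p q
  volume_eq : volume C = 0
  off : ∀ x, x ∉ C → ∃ K : ℝ, 0 < K ∧ ∀ᶠ r in 𝓝[>] (0 : ℝ), ν (ball x r) ≤ ENNReal.ofReal (K * r)
  mem : ∀ x ∈ C, H x ∈ Icc a b
  locExp : ∀ x ∈ C, HasLocExp ν x (H x)
  dimH_le : dimH C ≤ ENNReal.ofReal v
  nonempty : ∀ h ∈ Icc a b, {x ∈ C | H x = h}.Nonempty
  le_dimH : ∀ h ∈ Icc a b, ENNReal.ofReal v ≤ dimH {x ∈ C | H x = h}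

theorem rpow_le_rpow_of_nonpos_ennreal {x y : ℝ≥0∞} (hxy : x ≤ y) {z : ℝ} (hz : z ≤ 0) :
    y ^ z ≤ x ^ z := by
  have := ENNReal.inv_le_inv.2 (ENNReal.rpow_le_rpow hxy (neg_nonneg.2 hz))
  simpa [ENNReal.rpow_neg] using this

section Density

variable {ℓ : ℕ → ℝ} {ρ v p₀ p q a b : ℝ} {φ : ℝ → ℝ}

/-- The density `dist(·, C) ^ (φ - 1)` on `[p, q]`. -/
noncomputable def distDensity (C : Set ℝ) (φ : ℝ → ℝ) (p q : ℝ) : ℝ → ℝ≥0∞ :=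
  (Icc p q).indicator fun y => ENNReal.ofReal (infDist y C) ^ (φ y - 1)

theorem distDensity_le (C : Set ℝ) (φ : ℝ → ℝ) (p q y : ℝ) :
    distDensity C φ p q y ≤ ENNReal.ofReal (infDist y C) ^ (φ y - 1) :=
  indicator_le_self _ _ _

theorem exists_measure_ball_le_of_notMem {C : Set ℝ} (hC : IsClosed C) (hne : C.Nonempty)
    (hφ : ∀ y, φ y ∈ Icc (0 : ℝ) 1) {x : ℝ} (hx : x ∉ C) :
    ∃ K : ℝ, 0 < K ∧ ∀ᶠ r in 𝓝[>] (0 : ℝ),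
      volume.withDensity (distDensity C φ p q) (ball x r) ≤ ENNReal.ofReal (K * r) := by
  have hd : 0 < infDist x C := (hC.notMem_iff_infDist_pos hne).1 hx
  set δ := min 1 (infDist x C / 2) with hδ
  have hδ0 : 0 < δ := lt_min one_pos (by linarith)
  have hδx : δ < infDist x C := (min_le_right _ _).trans_lt (by linarith)
  have hev : ∀ᶠ y in 𝓝 x, δ < infDist y C :=
    (continuous_infDist_pt C).continuousAt.eventually (lt_mem_nhds hδx)
  refine ⟨δ⁻¹ * 2, by positivity, ?_⟩
  filter_upwards [eventually_forall_ball hev] with r hr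
  rw [withDensity_apply _ measurableSet_ball]
  calc ∫⁻ y in ball x r, distDensity C φ p q y
      ≤ ∫⁻ _ in ball x r, ENNReal.ofReal δ⁻¹ := by
        refine setLIntegral_mono measurable_const fun y hy => (distDensity_le C φ p q y).trans ?_
        have h0 : φ y - 1 ≤ 0 := by linarith [(hφ y).2]
        refine (rpow_le_rpow_of_nonpos_ennreal (ENNReal.ofReal_le_ofReal (hr y hy).le) h0).trans ?_
        rw [ENNReal.ofReal_rpow_of_pos hδ0, ← Real.rpow_neg_one]
        exact ENNReal.ofReal_le_ofReal (Real.rpow_le_rpow_of_exponent_ge hδ0 (min_le_left _ _)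
          (by linarith [(hφ y).1]))
    _ = ENNReal.ofReal (δ⁻¹ * 2 * r) := by
        rw [setLIntegral_const, Real.volume_ball, ← ENNReal.ofReal_mul (by positivity)]
        congr 1
        ring

theorem CantorScale.hasLocExp_distDensity (h : CantorScale ℓ ρ v)
    (hφ : ∀ y, φ y ∈ Icc a b) (hcont : Continuous φ) (hva : v < a) (hb : b ≤ 1)
    (hsub : range (cantorPoint p₀ ℓ) ⊆ Ioo p q) (ω : ℕ → Fin 2) :
    HasLocExp (volume.withDensity (distDensity (range (cantorPoint p₀ ℓ)) φ p q))
      (cantorPoint p₀ ℓ ω) (φ (cantorPoint p₀ ℓ ω)) := by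
  set C := range (cantorPoint p₀ ℓ) with hC
  set x := cantorPoint p₀ ℓ ω with hx
  have hxC : x ∈ C := mem_range_self ω
  constructor
  · intro ε hε
    refine ⟨2, two_pos, ?_⟩
    have hev : ∀ᶠ y in 𝓝 x, φ y < φ x + ε ∧ y ∈ Icc p q :=
      (hcont.continuousAt.eventually (gt_mem_nhds (by linarith))).and
        (mem_of_superset (isOpen_Ioo.mem_nhds (hsub hxC)) Ioo_subset_Icc_self)
    filter_upwards [eventually_forall_ball hev, Ioo_mem_nhdsGT one_pos] with r hr hr1
    rw [withDensity_apply _ measurableSet_ball]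
    calc ENNReal.ofReal (2 * r ^ (φ x + ε))
        = ∫⁻ _ in ball x r, ENNReal.ofReal (r ^ (φ x + ε - 1)) := by
          rw [setLIntegral_const, Real.volume_ball,
            ← ENNReal.ofReal_mul (Real.rpow_nonneg hr1.1.le _), Real.rpow_sub_one hr1.1.ne']
          have := hr1.1.ne'
          congr 1
          field_simp
      _ ≤ ∫⁻ y in ball x r, distDensity C φ p q y := by
          refine lintegral_mono_ae ?_
          filter_upwards [ae_restrict_mem measurableSet_ball] with y hy
          obtain ⟨hy1, hy2⟩ := hr y hy
          rw [distDensity, indicator_of_mem hy2]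
          have h0 : φ y - 1 ≤ 0 := by linarith [(hφ y).2]
          have h1 : infDist y C ≤ r := (infDist_le_dist_of_mem hxC).trans hy.le
          refine le_trans ?_ (rpow_le_rpow_of_nonpos_ennreal (ENNReal.ofReal_le_ofReal h1) h0)
          rw [ENNReal.ofReal_rpow_of_pos hr1.1]
          exact ENNReal.ofReal_le_ofReal
            (Real.rpow_le_rpow_of_exponent_ge hr1.1 hr1.2.le (by linarith))
  · intro ε hε
    have hxa := (hφ x).1
    have hxb := (hφ x).2
    obtain ⟨δ, hδ, hδε, hδv⟩ : ∃ δ : ℝ, 0 < δ ∧ δ ≤ ε / 2 ∧ v < φ x - δ :=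
      ⟨min (ε / 2) ((a - v) / 2), lt_min (by linarith) (by linarith), min_le_left _ _,
        by linarith [min_le_right (ε / 2) ((a - v) / 2)]⟩
    obtain ⟨K, hK, r₀, hr₀, hKr⟩ := h.exists_lintegral_infDist_rpow_le p₀ hδv (by linarith)
      (half_pos hε)
    refine ⟨K, hK, ?_⟩
    have hev : ∀ᶠ y in 𝓝 x, φ x - δ < φ y :=
      hcont.continuousAt.eventually (lt_mem_nhds (by linarith))
    filter_upwards [eventually_forall_ball hev, Ioo_mem_nhdsGT one_pos, Ioo_mem_nhdsGT hr₀]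
      with r hr hr1 hr2
    rw [withDensity_apply _ measurableSet_ball]
    calc ∫⁻ y in ball x r, distDensity C φ p q y
        ≤ ∫⁻ y in ball x r, ENNReal.ofReal (infDist y C) ^ (φ x - δ - 1) := by
          refine lintegral_mono_ae ?_
          filter_upwards [ae_restrict_mem measurableSet_ball] with y hy
          refine (distDensity_le C φ p q y).trans ?_
          have h1 : infDist y C ≤ 1 :=
            (infDist_le_dist_of_mem hxC).trans ((mem_ball.1 hy).le.trans hr1.2.le)
          refine ENNReal.rpow_le_rpow_of_exponent_ge ?_ (by linarith [hr y hy])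
          simpa using ENNReal.ofReal_le_ofReal h1
      _ ≤ ENNReal.ofReal (K * r ^ (φ x - δ - ε / 2)) := hKr r hr2.1 hr2.2 ω
      _ ≤ _ := by
          refine ENNReal.ofReal_le_ofReal (mul_le_mul_of_nonneg_left ?_ hK.le)
          exact Real.rpow_le_rpow_of_exponent_ge hr1.1 hr1.2.le (by linarith)

end Density

theorem exists_isBlock {p q v a b : ℝ} (hpq : p < q) (hv : 0 ≤ v) (hva : v < a) (hab : a ≤ b)
    (hb : b ≤ 1) : ∃ (ν : Measure ℝ) (C : Set ℝ) (H : ℝ → ℝ), IsBlock ν C H p q v a b := by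
  obtain ⟨ℓ, ρ, h, h0, hfree⟩ := CantorScale.exists_scale hv (by linarith : v < 1)
    (show 0 < (q - p) / 4 by linarith)
  set p₀ := p + (q - p) / 4 with hp₀
  set C := range (cantorPoint p₀ ℓ) with hC
  have hsub : C ⊆ Ioo p q := by
    intro x hx
    have := h.range_cantorPoint_subset p₀ hx
    exact ⟨by linarith [this.1], by linarith [this.2]⟩
  have hemb := h.isClosedEmbedding_cantorPoint p₀
  let F : C(ℕ → Fin 2, ℝ) := ⟨fun ω => a + (b - a) * Real.ofDigits (fun k => ω (codePos k)), by
    refine continuous_const.add (continuous_const.mul (Real.continuous_ofDigits.comp ?_))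
    fun_prop⟩
  have hF : ∀ ω, F ω ∈ Icc a b := by
    intro ω
    have h1 := Real.ofDigits_nonneg (fun k => ω (codePos k))
    have h2 := Real.ofDigits_le_one (fun k => ω (codePos k))
    change a + (b - a) * _ ∈ Icc a b
    constructor <;> nlinarith
  obtain ⟨φ, hφ, hφF⟩ := F.exists_extension_forall_mem_of_isClosedEmbedding hF
    (nonempty_Icc.2 hab) hemb
  have hφF' : ∀ ω, φ (cantorPoint p₀ ℓ ω) = F ω := fun ω => congrFun hφF ω
  set ν := volume.withDensity (distDensity C φ p q) with hν
  have hne : C.Nonempty := range_nonempty _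
  have hoff : ∀ x, x ∉ C → ∃ K : ℝ, 0 < K ∧
      ∀ᶠ r in 𝓝[>] (0 : ℝ), ν (ball x r) ≤ ENNReal.ofReal (K * r) := fun x hx =>
    exists_measure_ball_le_of_notMem hemb.isClosed_range hne
      (fun y => ⟨by linarith [(hφ y).1], (hφ y).2.trans hb⟩) hx
  have hloc : ∀ x ∈ C, HasLocExp ν x (φ x) := by
    rintro _ ⟨ω, rfl⟩
    exact h.hasLocExp_distDensity hφ φ.continuous hva hb hsub ω
  have hcompl : ν (Icc p q)ᶜ = 0 := by
    rw [hν, withDensity_apply _ measurableSet_Icc.compl]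
    refine (setLIntegral_congr_fun measurableSet_Icc.compl fun y hy => ?_).trans lintegral_zero
    exact indicator_of_notMem hy _
  have hlevel : ∀ u ∈ Icc a b, ∃ c : ℕ → Fin 2,
      cantorPoint p₀ ℓ '' {ω | ∀ k, ω (codePos k) = c k} ⊆ {x ∈ C | φ x = u} := by
    intro u hu
    obtain ⟨t, ht, htu⟩ : ∃ t ∈ Icc (0 : ℝ) 1, a + (b - a) * t = u := by
      rcases hab.eq_or_lt with rfl | hab'
      · exact ⟨0, by simp, by linarith [hu.1, hu.2]⟩
      · have : 0 < b - a := by linarith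
        refine ⟨(u - a) / (b - a), ⟨div_nonneg (by linarith [hu.1]) this.le, ?_⟩,
          by field_simp; ring⟩
        rw [div_le_one this]
        linarith [hu.2]
    obtain ⟨c, -, hc⟩ := Real.ofDigits_SurjOn (b := 2) one_lt_two ht
    refine ⟨c, ?_⟩
    rintro _ ⟨ω, hω, rfl⟩
    refine ⟨mem_range_self ω, ?_⟩
    rw [hφF']
    change a + (b - a) * Real.ofDigits (fun k => ω (codePos k)) = u
    rw [show (fun k => ω (codePos k)) = c from funext hω, hc, htu]
  refine ⟨ν, C, φ, ⟨⟨?_⟩, hcompl, hsub, h.volume_range p₀, hoff, fun x _ => hφ x, hloc,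
    h.dimH_range_le p₀, fun u hu => ?_, fun u hu => ?_⟩⟩
  · have h1 : ν (Icc p q) < ⊤ := by
      refine isCompact_Icc.measure_lt_top_of_nhdsWithin fun x _ => ?_
      obtain ⟨r, hr, hr0⟩ : ∃ r : ℝ, ν (ball x r) < ⊤ ∧ 0 < r := by
        by_cases hx : x ∈ C
        · obtain ⟨K, -, hK⟩ := (hloc x hx).upper 1 one_pos
          obtain ⟨r, hr, hr0⟩ := (hK.and self_mem_nhdsWithin).exists
          exact ⟨r, hr.trans_lt ENNReal.ofReal_lt_top, hr0⟩
        · obtain ⟨K, -, hK⟩ := hoff x hx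
          obtain ⟨r, hr, hr0⟩ := (hK.and self_mem_nhdsWithin).exists
          exact ⟨r, hr.trans_lt ENNReal.ofReal_lt_top, hr0⟩
      exact ⟨ball x r, mem_nhdsWithin_of_mem_nhds (ball_mem_nhds x hr0), hr⟩
    rw [← measure_add_measure_compl measurableSet_Icc, hcompl, add_zero]
    exact h1
  · obtain ⟨c, hc⟩ := hlevel u hu
    exact ⟨_, hc (mem_image_of_mem _ fun k => mergeDigits_codePos c 0 k)⟩
  · obtain ⟨c, hc⟩ := hlevel u hu
    exact (h.le_dimH_code p₀ hfree c).trans (dimH_mono hc)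

/-- `ν` has at most linear growth at `x`. -/
def LinearGrowth (ν : Measure ℝ) (x : ℝ) : Prop :=
  ∃ K : ℝ, 0 < K ∧ ∀ᶠ r in 𝓝[>] (0:ℝ), ν (ball x r) ≤ ENNReal.ofReal (K * r)

theorem LinearGrowth.add {μ ν : Measure ℝ} {x : ℝ} (hμ : LinearGrowth μ x)
    (hν : LinearGrowth ν x) : LinearGrowth (μ + ν) x := by
  obtain ⟨K, hK, h⟩ := hμ
  obtain ⟨L, hL, h'⟩ := hν
  refine ⟨K + L, by positivity, ?_⟩
  filter_upwards [h, h', self_mem_nhdsWithin] with r h1 h2 hr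
  have hr : 0 < r := hr
  rw [Measure.add_apply, add_mul, ENNReal.ofReal_add (by positivity) (by positivity)]
  exact add_le_add h1 h2

theorem linearGrowth_zero (x : ℝ) : LinearGrowth 0 x :=
  ⟨1, one_pos, by simp⟩

theorem linearGrowth_finset_sum {ι : Type*} (s : Finset ι) {ρ : ι → Measure ℝ} {x : ℝ}
    (h : ∀ i, LinearGrowth (ρ i) x) : LinearGrowth (∑ i ∈ s, ρ i) x := by
  induction s using Finset.induction_on with
  | empty => simpa using linearGrowth_zero x
  | insert i s hi ih => simpa [Finset.sum_insert hi] using (h i).add ih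

/-- A locally finite superposition of measures carried by the dyadic intervals accumulating at
`0` inherits linear growth from its components. -/
theorem linearGrowth_sum {ρ : ℕ → Measure ℝ} {x : ℝ} (hx : 0 ≤ x)
    (hsupp : ∀ i, ρ i (Icc ((1/2:ℝ)^(i+1)) ((1/2)^i))ᶜ = 0)
    (hmass : ∀ i, ρ i univ ≤ (4⁻¹ : ℝ≥0∞)^(i+1))
    (h : ∀ i, LinearGrowth (ρ i) x) : LinearGrowth (Measure.sum ρ) x := by
  rcases hx.eq_or_lt with rfl | hx
  · refine ⟨1, one_pos, ?_⟩
    filter_upwards [self_mem_nhdsWithin] with r hr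
    have hr : 0 < r := hr
    rw [Measure.sum_apply _ measurableSet_ball, one_mul]
    have key : ∀ i, ρ i (ball 0 r) ≤ (2⁻¹ : ℝ≥0∞)^(i+1) * ENNReal.ofReal r := by
      intro i
      by_cases hi : (1/2:ℝ)^(i+1) < r
      · have h2 : (2⁻¹ : ℝ≥0∞)^(i+1) ≤ ENNReal.ofReal r := by
          have : (2⁻¹ : ℝ≥0∞)^(i+1) = ENNReal.ofReal ((1/2:ℝ)^(i+1)) := by
            rw [ENNReal.ofReal_pow (by norm_num), one_div,
              ENNReal.ofReal_inv_of_pos (by norm_num)]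
            norm_num
          rw [this]
          exact ENNReal.ofReal_le_ofReal hi.le
        have h4 : (4⁻¹ : ℝ≥0∞)^(i+1) = (2⁻¹ : ℝ≥0∞)^(i+1) * (2⁻¹ : ℝ≥0∞)^(i+1) := by
          rw [← mul_pow, ← ENNReal.mul_inv (by simp) (by simp)]
          norm_num
        calc ρ i (ball 0 r) ≤ ρ i univ := measure_mono (subset_univ _)
          _ ≤ _ := hmass i
          _ ≤ _ := by rw [h4]; gcongr
      · have : ρ i (ball 0 r) = 0 := by
          refine measure_mono_null (subset_compl_iff_disjoint_right.2 ?_) (hsupp i)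
          rw [Set.disjoint_left]
          intro y hy hy'
          rw [mem_ball, Real.dist_eq, sub_zero, abs_lt] at hy
          linarith [hy'.1, hy.2]
        rw [this]
        exact zero_le
    calc ∑' i, ρ i (ball 0 r) ≤ ∑' i, (2⁻¹ : ℝ≥0∞)^(i+1) * ENNReal.ofReal r :=
          ENNReal.tsum_le_tsum key
      _ = ENNReal.ofReal r := by
          rw [ENNReal.tsum_mul_right, ENNReal.tsum_geometric_add_one]
          rw [ENNReal.one_sub_inv_two, inv_inv, ENNReal.inv_mul_cancel (by simp) (by simp), one_mul]
  · obtain ⟨n, hn⟩ := exists_pow_lt_of_lt_one (half_pos hx) (by norm_num : (1/2:ℝ) < 1)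
    obtain ⟨K, hK, h⟩ := linearGrowth_finset_sum (Finset.range n) h
    refine ⟨K, hK, ?_⟩
    filter_upwards [h, Ioo_mem_nhdsGT (half_pos hx)] with r h hr
    rw [Measure.sum_apply _ measurableSet_ball, tsum_eq_sum (s := Finset.range n)]
    · simpa using h
    · intro i hi
      refine measure_mono_null (subset_compl_iff_disjoint_right.2 ?_) (hsupp i)
      rw [Set.disjoint_left]
      intro y hy hy'
      rw [mem_ball, Real.dist_eq, abs_lt] at hy
      have : (1/2:ℝ)^i ≤ (1/2)^n :=
        pow_le_pow_of_le_one (by norm_num) (by norm_num) (by simpa using hi)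
      linarith [hy'.2, hy.1, hr.2]

theorem linearGrowth_volume_restrict (s : Set ℝ) (x : ℝ) :
    LinearGrowth (volume.restrict s) x := by
  refine ⟨2, two_pos, Eventually.of_forall fun r => ?_⟩
  rw [← Real.volume_ball]
  exact Measure.restrict_apply_le _ _

theorem eventually_le_volume_restrict_ball {x : ℝ} (hx : x ∈ Icc (0:ℝ) 1) :
    ∀ᶠ r in 𝓝[>] (0:ℝ), ENNReal.ofReal r ≤ volume.restrict (Icc 0 1) (ball x r) := by
  filter_upwards [Ioo_mem_nhdsGT (by norm_num : (0:ℝ) < 1/2)] with r hr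
  rw [Measure.restrict_apply measurableSet_ball]
  obtain ⟨h0, h1⟩ := hx
  obtain ⟨hr0, hr1⟩ := hr
  rcases le_total x (1/2) with h | h
  · calc ENNReal.ofReal r = volume (Ioo x (x + r)) := by simp
      _ ≤ _ := measure_mono fun y hy => by
        refine ⟨?_, by linarith [hy.1], by linarith [hy.2]⟩
        rw [mem_ball, Real.dist_eq, abs_lt]
        constructor <;> linarith [hy.1, hy.2]
  · calc ENNReal.ofReal r = volume (Ioo (x - r) x) := by simp
      _ ≤ _ := measure_mono fun y hy => by
        refine ⟨?_, by linarith [hy.1], by linarith [hy.2]⟩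
        rw [mem_ball, Real.dist_eq, abs_lt]
        constructor <;> linarith [hy.1, hy.2]

theorem HasLocExp.smul {μ : Measure ℝ} {x h : ℝ} (hμ : HasLocExp μ x h) {w : ℝ} (hw : 0 < w) :
    HasLocExp (ENNReal.ofReal w • μ) x h where
  lower ε hε := by
    obtain ⟨c, hc, H⟩ := hμ.lower ε hε
    refine ⟨w * c, by positivity, ?_⟩
    filter_upwards [H] with r H
    rw [mul_assoc, ENNReal.ofReal_mul hw.le]
    simpa using mul_le_mul_right H _
  upper ε hε := by
    obtain ⟨c, hc, H⟩ := hμ.upper ε hε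
    refine ⟨w * c, by positivity, ?_⟩
    filter_upwards [H] with r H
    rw [mul_assoc, ENNReal.ofReal_mul hw.le]
    simpa using mul_le_mul_right H _

theorem LinearGrowth.smul {μ : Measure ℝ} {x : ℝ} (hμ : LinearGrowth μ x) {w : ℝ} (hw : 0 < w) :
    LinearGrowth (ENNReal.ofReal w • μ) x := by
  obtain ⟨c, hc, H⟩ := hμ
  refine ⟨w * c, by positivity, ?_⟩
  filter_upwards [H] with r H
  rw [mul_assoc, ENNReal.ofReal_mul hw.le]
  simpa using mul_le_mul_right H _

theorem IsBlock.smul {ν : Measure ℝ} {C : Set ℝ} {H : ℝ → ℝ} {p q v a b : ℝ}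
    (h : IsBlock ν C H p q v a b) {w : ℝ} (hw : 0 < w) :
    IsBlock (ENNReal.ofReal w • ν) C H p q v a b where
  finite := by
    have := h.finite
    exact Measure.smul_finite ν ENNReal.ofReal_ne_top
  compl := by simp [h.compl]
  subset := h.subset
  volume_eq := h.volume_eq
  off x hx := LinearGrowth.smul (h.off x hx) hw
  mem := h.mem
  locExp x hx := (h.locExp x hx).smul hw
  dimH_le := h.dimH_le
  nonempty := h.nonempty
  le_dimH := h.le_dimH

theorem IsBlock.exists_mass_le {ν : Measure ℝ} {C : Set ℝ} {H : ℝ → ℝ} {p q v a b : ℝ}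
    (h : IsBlock ν C H p q v a b) {δ : ℝ} (hδ : 0 < δ) :
    ∃ ν' : Measure ℝ, IsBlock ν' C H p q v a b ∧ ν' univ ≤ ENNReal.ofReal δ := by
  have := h.finite
  have hm : 0 ≤ (ν univ).toReal := ENNReal.toReal_nonneg
  refine ⟨_, h.smul (w := δ / (1 + (ν univ).toReal)) (by positivity), ?_⟩
  rw [Measure.smul_apply, smul_eq_mul, ← ENNReal.ofReal_toReal (measure_ne_top ν univ),
    ← ENNReal.ofReal_mul (by positivity)]
  apply ENNReal.ofReal_le_ofReal
  rw [ENNReal.toReal_ofReal hm, div_mul_eq_mul_div, div_le_iff₀ (by positivity)]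
  nlinarith

/-- Adding a measure of linear growth does not change a local exponent at most `1`. -/
theorem HasLocExp.add_of_linearGrowth {μ ν : Measure ℝ} {x h : ℝ} (hμ : HasLocExp μ x h)
    (hν : LinearGrowth ν x) (h1 : h ≤ 1) : HasLocExp (μ + ν) x h where
  lower ε hε := by
    obtain ⟨c, hc, H⟩ := hμ.lower ε hε
    refine ⟨c, hc, ?_⟩
    filter_upwards [H] with r H
    exact H.trans (by simp)
  upper ε hε := by
    obtain ⟨K, hK, H⟩ := hμ.upper ε hε
    obtain ⟨L, hL, H'⟩ := hν
    refine ⟨K + L, by positivity, ?_⟩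
    filter_upwards [H, H', Ioo_mem_nhdsGT one_pos] with r H H' hr
    have hr0 := hr.1
    have : r ≤ r ^ (h - ε) := by
      conv_lhs => rw [← Real.rpow_one r]
      exact Real.rpow_le_rpow_of_exponent_ge hr.1 hr.2.le (by linarith)
    rw [Measure.add_apply, add_mul, ENNReal.ofReal_add (by positivity) (by positivity)]
    exact add_le_add H (H'.trans (ENNReal.ofReal_le_ofReal (by gcongr)))

theorem LinearGrowth.hasLocExp_one {μ : Measure ℝ} {x : ℝ} (hμ : LinearGrowth μ x)
    (h : ∀ᶠ r in 𝓝[>] (0:ℝ), ENNReal.ofReal r ≤ μ (ball x r)) : HasLocExp μ x 1 where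
  lower ε hε := by
    refine ⟨1, one_pos, ?_⟩
    filter_upwards [h, Ioo_mem_nhdsGT one_pos] with r h hr
    refine le_trans (ENNReal.ofReal_le_ofReal ?_) h
    rw [one_mul]
    conv_rhs => rw [← Real.rpow_one r]
    exact Real.rpow_le_rpow_of_exponent_ge hr.1 hr.2.le (by linarith)
  upper ε hε := by
    obtain ⟨K, hK, H⟩ := hμ
    refine ⟨K, hK, ?_⟩
    filter_upwards [H, Ioo_mem_nhdsGT one_pos] with r h hr
    refine h.trans (ENNReal.ofReal_le_ofReal ?_)
    gcongr
    conv_lhs => rw [← Real.rpow_one r]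
    exact Real.rpow_le_rpow_of_exponent_ge hr.1 hr.2.le (by linarith)

theorem measure_sum_eq_add_sum_ite (ν : ℕ → Measure ℝ) (j : ℕ) :
    Measure.sum ν = ν j + Measure.sum fun i => if i = j then 0 else ν i := by
  have hite : ∀ (s : Set ℝ) (i : ℕ),
      (if i = j then (0 : Measure ℝ) else ν i) s = if i = j then 0 else ν i s := by
    intro s i
    split_ifs
    · exact Measure.coe_zero ▸ rfl
    · rfl
  refine Measure.ext fun s hs => ?_
  rw [Measure.add_apply, Measure.sum_apply _ hs, Measure.sum_apply _ hs, tsum_congr (hite s)]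
  convert ENNReal.tsum_eq_add_tsum_ite j

/-- A probability measure on `[0,1]` whose local dimension equals `1` outside a countable union of
prescribed blocks. -/
theorem exists_probabilityMeasure_of_blocks {v a b : ℕ → ℝ} (hv : ∀ j, 0 ≤ v j)
    (hva : ∀ j, v j < a j) (hab : ∀ j, a j ≤ b j) (hb : ∀ j, b j ≤ 1) :
    ∃ (μ : Measure ℝ) (ν : ℕ → Measure ℝ) (C : ℕ → Set ℝ) (H : ℕ → ℝ → ℝ),
      IsProbabilityMeasure μ ∧ μ (Icc (0:ℝ) 1)ᶜ = 0 ∧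
      (∀ j, IsBlock (ν j) (C j) (H j) ((1/2)^(j+1)) ((1/2)^j) (v j) (a j) (b j)) ∧
      (∀ j, ∀ x ∈ C j, locDim μ x = (H j x : EReal)) ∧
      ∀ x ∈ Icc (0:ℝ) 1, (∀ j, x ∉ C j) → locDim μ x = 1 := by
  have hlt : ∀ j : ℕ, (1/2:ℝ)^(j+1) < (1/2)^j := fun j =>
    pow_lt_pow_right_of_lt_one₀ (by norm_num) (by norm_num) (by simp)
  have hex : ∀ j, ∃ (ν : Measure ℝ) (C : Set ℝ) (H : ℝ → ℝ),
      IsBlock ν C H ((1/2)^(j+1)) ((1/2)^j) (v j) (a j) (b j) ∧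
        ν univ ≤ (4⁻¹ : ℝ≥0∞)^(j+1) := by
    intro j
    obtain ⟨ν, C, H, h⟩ := exists_isBlock (hlt j) (hv j) (hva j) (hab j) (hb j)
    obtain ⟨ν', h', hm⟩ := h.exists_mass_le (δ := (1/4)^(j+1)) (by positivity)
    refine ⟨ν', C, H, h', hm.trans_eq ?_⟩
    rw [ENNReal.ofReal_pow (by norm_num), one_div, ENNReal.ofReal_inv_of_pos (by norm_num)]
    norm_num
  choose ν C H hblock hmass using hex
  have hdisj : ∀ i j x, x ∈ C i → x ∈ C j → i = j := by
    intro i j x hi hj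
    have hi := (hblock i).subset hi
    have hj := (hblock j).subset hj
    by_contra hne
    rcases lt_or_gt_of_ne hne with h | h
    · have : (1/2:ℝ)^j ≤ (1/2)^(i+1) := pow_le_pow_of_le_one (by norm_num) (by norm_num) h
      linarith [hi.1, hj.2]
    · have : (1/2:ℝ)^i ≤ (1/2)^(j+1) := pow_le_pow_of_le_one (by norm_num) (by norm_num) h
      linarith [hi.2, hj.1]
  have hCpos : ∀ j, ∀ x ∈ C j, 0 < x := fun j x hx =>
    lt_trans (by positivity) ((hblock j).subset hx).1
  set μ₀ : Measure ℝ := volume.restrict (Icc 0 1) + Measure.sum ν with hμ₀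
  have hfin : IsFiniteMeasure μ₀ := by
    constructor
    rw [hμ₀, Measure.add_apply, Measure.sum_apply _ MeasurableSet.univ]
    refine ENNReal.add_lt_top.2 ⟨by simp, (ENNReal.tsum_le_tsum hmass).trans_lt ?_⟩
    rw [ENNReal.tsum_geometric_add_one]
    refine ENNReal.mul_lt_top (by simp) (ENNReal.inv_lt_top.2 (tsub_pos_of_lt ?_))
    exact ENNReal.inv_lt_one.2 (by norm_num)
  have hone : 1 ≤ (μ₀ univ).toReal := by
    rw [← ENNReal.toReal_one, ENNReal.toReal_le_toReal (by simp) (measure_ne_top _ _), hμ₀,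
      Measure.add_apply]
    simp
  have hpos : 0 < ((μ₀ univ).toReal)⁻¹ := by positivity
  have hinC : ∀ j, ∀ x ∈ C j, HasLocExp μ₀ x (H j x) := by
    intro j x hx
    have hdec : μ₀ = ν j + (volume.restrict (Icc 0 1) +
        Measure.sum fun i => if i = j then 0 else ν i) := by
      rw [hμ₀, measure_sum_eq_add_sum_ite ν j, add_left_comm]
    rw [hdec]
    refine ((hblock j).locExp x hx).add_of_linearGrowth
      ((linearGrowth_volume_restrict _ _).add (linearGrowth_sum (hCpos j x hx).le ?_ ?_ ?_))
      (((hblock j).mem x hx).2.trans (hb j))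
    · intro i
      split_ifs
      · simp
      · exact (hblock i).compl
    · intro i
      split_ifs
      · simp
      · exact hmass i
    · intro i
      split_ifs with hij
      · exact linearGrowth_zero x
      · exact (hblock i).off x fun hi => hij (hdisj i j x hi hx)
  have hoff : ∀ x ∈ Icc (0:ℝ) 1, (∀ j, x ∉ C j) → HasLocExp μ₀ x 1 := by
    intro x hx hxC
    refine LinearGrowth.hasLocExp_one ((linearGrowth_volume_restrict _ _).add
      (linearGrowth_sum hx.1 (fun i => (hblock i).compl) hmass
        fun i => (hblock i).off x (hxC i))) ?_
    filter_upwards [eventually_le_volume_restrict_ball hx] with r h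
    rw [hμ₀, Measure.add_apply]
    exact h.trans le_self_add
  refine ⟨ENNReal.ofReal ((μ₀ univ).toReal)⁻¹ • μ₀, ν, C, H, ⟨?_⟩, ?_, hblock,
    fun j x hx => ((hinC j x hx).smul hpos).locDim_eq,
    fun x hx hxC => ((hoff x hx hxC).smul hpos).locDim_eq⟩
  · rw [Measure.smul_apply, smul_eq_mul, ENNReal.ofReal_inv_of_pos (by positivity),
      ENNReal.ofReal_toReal (measure_ne_top _ _)]
    refine ENNReal.inv_mul_cancel (fun h0 => ?_) (measure_ne_top _ _)
    rw [h0] at hone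
    norm_num at hone
  · have : μ₀ (Icc (0:ℝ) 1)ᶜ = 0 := by
      rw [hμ₀, Measure.add_apply, Measure.sum_apply _ measurableSet_Icc.compl,
        Measure.restrict_apply measurableSet_Icc.compl]
      simp only [compl_inter_self, measure_empty, zero_add, ENNReal.tsum_eq_zero]
      intro i
      refine measure_mono_null (compl_subset_compl.2 (Icc_subset_Icc (by positivity) ?_))
        (hblock i).compl
      exact pow_le_one₀ (by norm_num) (by norm_num)
    simp [this]

/-- Every `f ∈ 𝓕` is a countable supremum of steps lying strictly below the diagonal. -/
theorem MemF.exists_strict_family {f : ℝ → EReal} (hf : MemF f) :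
    ∃ v a b : ℕ → ℝ, (∀ j, 0 ≤ v j) ∧ (∀ j, v j < a j) ∧ (∀ j, a j ≤ b j) ∧ (∀ j, b j ≤ 1) ∧
      ∀ x, f x = ⨆ j, if x ∈ Icc (a j) (b j) then (v j : EReal) else ⊥ := by
  obtain ⟨I, v, hI, hI01, ⟨c, hc, hcI⟩, hv, hvI, hf⟩ := hf
  choose a b hab hI using hI
  have hmem : ∀ n, a n ∈ I n := fun n => hI n ▸ left_mem_Icc.2 (hab n)
  have ha : ∀ n, 0 < a n := fun n => hc.trans_le (hcI n _ (hmem n))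
  have hb : ∀ n, b n ≤ 1 := fun n => (hI01 n (hI n ▸ right_mem_Icc.2 (hab n))).2
  have hex : ∀ n, ∃ u : ℝ, 0 ≤ u ∧ v n = u := by
    intro n
    have hne : v n ≠ ⊤ := ((hv n).2.trans_lt (EReal.coe_lt_top 1)).ne
    have hne' : v n ≠ ⊥ := (EReal.bot_lt_zero.trans_le (hv n).1).ne'
    exact ⟨(v n).toReal, EReal.toReal_nonneg (hv n).1, (EReal.coe_toReal hne hne').symm⟩
  choose u hu hvu using hex
  have hua : ∀ n, u n ≤ a n := fun n => by
    have := hvI n _ (hmem n)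
    rwa [hvu, EReal.coe_le_coe_iff] at this
  let g : ℕ × ℕ → ℝ := fun k => max 0 (u k.1 - 1 / ((k.2 : ℝ) + 1))
  have hg : ∀ k, g k ≤ u k.1 := fun k => max_le (hu _) (sub_le_self _ (by positivity))
  have hg_iSup : ∀ n, ⨆ m, ((g (n, m) : ℝ) : EReal) = u n := by
    intro n
    refine le_antisymm (iSup_le fun m => EReal.coe_le_coe_iff.2 (hg (n, m))) ?_
    have ht : Tendsto (fun m : ℕ => g (n, m)) atTop (𝓝 (u n)) := by
      have := (tendsto_const_nhds (x := (0:ℝ))).max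
        ((tendsto_const_nhds (x := u n)).sub (tendsto_one_div_add_atTop_nhds_zero_nat (𝕜 := ℝ)))
      simpa [g, max_eq_right (hu n)] using this
    exact le_of_tendsto ((continuous_coe_real_ereal.tendsto _).comp ht)
      (Eventually.of_forall fun m => le_iSup (fun m => ((g (n, m) : ℝ) : EReal)) m)
  refine ⟨fun j => g j.unpair, fun j => a j.unpair.1, fun j => b j.unpair.1,
    fun j => le_max_left _ _, fun j => max_lt (ha _) ?_, fun j => hab _, fun j => hb _,
    fun x => ?_⟩
  · exact (sub_lt_self _ (by positivity)).trans_le (hua _)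
  · rw [hf, Nat.surjective_unpair.iSup_comp
      (g := fun k : ℕ × ℕ => if x ∈ Icc (a k.1) (b k.1) then ((g k : ℝ) : EReal) else ⊥),
      iSup_prod]
    refine iSup_congr fun n => ?_
    rw [hI n]
    split_ifs
    · rw [hvu, hg_iSup]
    · simp

theorem dimHE_iUnion_level_eq {ν : ℕ → Measure ℝ} {C : ℕ → Set ℝ} {H : ℕ → ℝ → ℝ}
    {p q v a b : ℕ → ℝ} (hv : ∀ j, 0 ≤ v j)
    (hblock : ∀ j, IsBlock (ν j) (C j) (H j) (p j) (q j) (v j) (a j) (b j)) (h : ℝ) :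
    dimHE (⋃ j, {x ∈ C j | H j x = h}) =
      ⨆ j, if h ∈ Icc (a j) (b j) then (v j : EReal) else ⊥ := by
  have hempty : ∀ j, h ∉ Icc (a j) (b j) → {x ∈ C j | H j x = h} = ∅ := fun j hj =>
    eq_empty_of_forall_notMem fun x hx => hj (hx.2 ▸ (hblock j).mem x hx.1)
  have hcoe : ∀ j, ((ENNReal.ofReal (v j) : ℝ≥0∞) : EReal) = v j := fun j => by
    rw [EReal.coe_ennreal_ofReal, max_eq_left (hv j)]
  by_cases hh : ∃ j, h ∈ Icc (a j) (b j)
  · obtain ⟨i, hi⟩ := hh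
    rw [dimHE, if_pos (nonempty_iUnion.2 ⟨i, (hblock i).nonempty h hi⟩), dimH_iUnion]
    set F : EReal := ⨆ j, if h ∈ Icc (a j) (b j) then (v j : EReal) else ⊥ with hF
    have hle : ∀ j, h ∈ Icc (a j) (b j) → (v j : EReal) ≤ F := fun j hj =>
      le_iSup_of_le j (by rw [if_pos hj])
    have hF0 : 0 ≤ F := (EReal.coe_nonneg.2 (hv i)).trans (hle i hi)
    refine le_antisymm ?_ (iSup_le fun j => ?_)
    · rw [← EReal.coe_toENNReal hF0, EReal.coe_ennreal_le_coe_ennreal_iff]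
      refine iSup_le fun j => ?_
      by_cases hj : h ∈ Icc (a j) (b j)
      · calc dimH {x ∈ C j | H j x = h} ≤ dimH (C j) := dimH_mono (sep_subset _ _)
          _ ≤ ENNReal.ofReal (v j) := (hblock j).dimH_le
          _ = (v j : EReal).toENNReal := by rw [← hcoe, EReal.toENNReal_coe]
          _ ≤ F.toENNReal := EReal.toENNReal_le_toENNReal (hle j hj)
      · simp [hempty j hj]
    · split_ifs with hj
      · rw [← hcoe, EReal.coe_ennreal_le_coe_ennreal_iff]
        exact ((hblock j).le_dimH h hj).trans
          (le_iSup (fun j => dimH {x ∈ C j | H j x = h}) j)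
      · exact bot_le
  · push Not at hh
    rw [iUnion_congr fun j => hempty j (hh j)]
    simp [dimHE, hh]

/-- Prescription of the multifractal spectrum of a (non-HM) measure: for every `f ∈ 𝓕`
there is a Borel probability measure `μ` supported in `[0,1]` with `d_μ(h) = f(h)` for all
`h ∈ Support(f) \ {1}`, `d_μ(h) = -∞` for `h ∈ [0,∞) \ (Support(f) ∪ {1})`, and
`{x ∈ [0,1] : h_μ(x) = 1}` of Lebesgue measure `1`. -/
theorem prescription_nonHM (f : ℝ → EReal) (hf : MemF f) :
    ∃ μ : Measure ℝ, IsProbabilityMeasure μ ∧ μ (Set.Icc (0:ℝ) 1)ᶜ = 0 ∧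
      (∀ h : ℝ, ⊥ < f h → h ≠ 1 → spec μ (h : EReal) = f h) ∧
      (∀ h : ℝ, 0 ≤ h → f h = ⊥ → h ≠ 1 → spec μ (h : EReal) = ⊥) ∧
      volume {x ∈ Set.Icc (0:ℝ) 1 | locDim μ x = (1 : EReal)} = 1 := by
  obtain ⟨v, a, b, hv, hva, hab, hb, hf⟩ := hf.exists_strict_family
  obtain ⟨μ, ν, C, H, hμ, hμ01, hblock, hin, hoff⟩ :=
    exists_probabilityMeasure_of_blocks hv hva hab hb
  have hC01 : ∀ j, C j ⊆ Icc 0 1 := fun j x hx => by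
    have hx := (hblock j).subset hx
    have h1 : (1/2:ℝ)^j ≤ 1 := pow_le_one₀ (by norm_num) (by norm_num)
    have h0 : (0:ℝ) < (1/2)^(j+1) := by positivity
    exact ⟨by linarith [hx.1], by linarith [hx.2]⟩
  have hspec : ∀ h : ℝ, h ≠ 1 → spec μ (h : EReal) = f h := by
    intro h h1
    rw [hf, ← dimHE_iUnion_level_eq hv hblock h, spec]
    congr 1
    ext x
    simp only [mem_ofPred_eq, mem_iUnion]
    constructor
    · rintro ⟨hx, hxh⟩
      by_cases hxC : ∃ j, x ∈ C j
      · obtain ⟨j, hj⟩ := hxC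
        rw [hin j x hj, EReal.coe_eq_coe_iff] at hxh
        exact ⟨j, hj, hxh⟩
      · rw [hoff x hx (not_exists.1 hxC)] at hxh
        exact absurd (EReal.coe_eq_one.1 hxh.symm) h1
    · rintro ⟨j, hj, hjh⟩
      exact ⟨hC01 j hj, by rw [hin j x hj, hjh]⟩
  refine ⟨μ, hμ, hμ01, fun h _ h1 => hspec h h1, fun h _ hb h1 => hb ▸ hspec h h1, ?_⟩
  have hnull : volume (⋃ j, C j) = 0 := measure_iUnion_null fun j => (hblock j).volume_eq
  refine le_antisymm ?_ ?_
  · exact (measure_mono (sep_subset _ _)).trans (by simp)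
  · calc (1 : ℝ≥0∞) = volume (Icc (0:ℝ) 1) := by simp
      _ = volume (Icc (0:ℝ) 1 \ ⋃ j, C j) := (measure_sdiff_null hnull).symm
      _ ≤ volume {x ∈ Icc (0:ℝ) 1 | locDim μ x = (1 : EReal)} := measure_mono fun x hx =>
        ⟨hx.1, hoff x hx.1 fun j hj => hx.2 (mem_iUnion.2 ⟨j, hj⟩)⟩
end
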